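/- arXiv:1603.03983 — 3 statements merged into one kernel-verified Lean document; each statement's English description precedes it below -/
import Mathlib

section
/- Let K be a number field, let f, g ∈ K[X] be coprime polynomials with f of degree d and g of degree e, and set h = f/g ∈ K(X). Assume d − e > 1 and max{d, e} ≥ 2. Assume that for every positive integer m with 1 ≤ m ≤ d, the polynomial f(X) − Y^m g(X), regarded as a polynomial in X with coefficients in K^c(Y), has no root in K^c(Y). If h is not special, then the set S_h = {α ∈ K^c : the orbit element α_k is defined and is a root of unity for some k ≥ 1} is finite. -/
open Polynomial

set_option maxHeartbeats 1000000
set_option synthInstance.maxHeartbeats 400000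

/-- Composition of rational functions: `(p ∘ q)(X) = p(q(X))`. -/
noncomputable def ratFuncComp {F : Type} [Field F] (p q : RatFunc F) : RatFunc F :=
  RatFunc.eval (algebraMap F (RatFunc F)) q p

/-- A Möbius transformation `(aX + b)/(cX + d)` with `ad - bc ≠ 0`. -/
def IsMobius {F : Type} [Field F] (L : RatFunc F) : Prop :=
  ∃ a b c d : F, a * d - b * c ≠ 0 ∧
    L = (RatFunc.C a * RatFunc.X + RatFunc.C b) / (RatFunc.C c * RatFunc.X + RatFunc.C d)

/-- A rational function `h` is special if it is conjugate, under `L ∘ h ∘ L⁻¹` for a Möbius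
transformation `L` (with inverse `M`), to `±X^n` or to `±T_n(X)`, where `T_n` is the Chebyshev
polynomial normalized by `T_n(x + x⁻¹) = x^n + x⁻ⁿ` (the Dickson polynomial `dickson 1 1 n`). -/
def IsSpecialRatFunc {F : Type} [Field F] (h : RatFunc F) : Prop :=
  ∃ L M : RatFunc F, IsMobius L ∧ IsMobius M ∧
    ratFuncComp L M = RatFunc.X ∧ ratFuncComp M L = RatFunc.X ∧
    ∃ (n : ℕ) (ε : F), (ε = 1 ∨ ε = -1) ∧
      (ratFuncComp (ratFuncComp L h) M = RatFunc.C ε * RatFunc.X ^ n ∨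
       ratFuncComp (ratFuncComp L h) M =
         RatFunc.C ε * algebraMap (Polynomial F) (RatFunc F) (Polynomial.dickson 1 1 n))


open scoped IntermediateField


theorem ext_aux1 {F M ι : Type} [Field F] [Field M] [Algebra ℚ F] [Algebra ℚ M]
    [Algebra.IsAlgebraic ℚ F] (φ : F →+* M) (v : ι → M) (hv : AlgebraicIndependent ℚ v) :
    Function.Injective (MvPolynomial.eval₂Hom φ v) := by
  let _ := φ.toAlgebra
  have : IsScalarTower ℚ F M := .of_algebraMap_eq (fun x => by simp)
  exact hv.extendScalars F

theorem ext_aux2 {A M S : Type} [CommRing A] [Field M] [IsAlgClosed M] [Field S] [Algebra A S]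
    [FaithfulSMul A S]
    [Algebra.IsAlgebraic A S] (ψ : A →+* M) (h : Function.Injective ψ) :
    ∃ σ : S →+* M, ∀ a, σ (algebraMap A S a) = ψ a := by
  let _ := ψ.toAlgebra
  have : FaithfulSMul A M := (faithfulSMul_iff_algebraMap_injective A M).2 h
  have : IsDomain A := (FaithfulSMul.algebraMap_injective A S).isDomain
  let l : S →ₐ[A] M := IsAlgClosed.lift
  exact ⟨l.toRingHom, fun a => l.commutes a⟩

theorem ext_hom (F : Type) [Field F] [Algebra F ℂ] [Algebra ℚ F] 
    [Algebra.IsAlgebraic ℚ F] (φ : F →+* ℂ) : ∃ σ : ℂ →+* ℂ, ∀ x : F, σ (algebraMap F ℂ x) = φ x := by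
  have : IsScalarTower ℚ F ℂ := .of_algebraMap_eq (fun x => by simp)
  obtain ⟨ι, v, hv⟩ := exists_isTranscendenceBasis' ℚ ℂ
  have h1 : AlgebraicIndependent F v := hv.1.extendScalars F
  let A := Algebra.adjoin F (Set.range v)
  let ψ : A →+* ℂ := (MvPolynomial.eval₂Hom φ v).comp (h1.aevalEquiv.symm : A ≃ₐ[F] _).toRingEquiv.toRingHom
  have hψ : Function.Injective ψ := (ext_aux1 φ v hv.1).comp (h1.aevalEquiv.symm).injective
  have : Algebra.IsAlgebraic A ℂ := by
    have h2 := hv.isAlgebraic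
    refine ⟨fun x => ?_⟩
    obtain ⟨p, hp, hx⟩ := h2.1 x
    let i : Algebra.adjoin ℚ (Set.range v) →+* A :=
      (Subalgebra.inclusion (S := Algebra.adjoin ℚ (Set.range v)) (T := A.restrictScalars ℚ) 
        (Algebra.adjoin_le (by exact Algebra.subset_adjoin))).toRingHom
    have hi : Function.Injective i := Subalgebra.inclusion_injective _
    refine ⟨p.map i, (Polynomial.map_ne_zero_iff hi).2 hp, ?_⟩
    rw [← hx, Polynomial.aeval_def, Polynomial.aeval_def, Polynomial.eval₂_map]
    rfl
  obtain ⟨σ, hσ⟩ := ext_aux2 (S := ℂ) ψ hψ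
  refine ⟨σ, fun x => ?_⟩
  have := hσ (algebraMap F A x)
  rw [show algebraMap A ℂ (algebraMap F A x) = algebraMap F ℂ x from rfl] at this
  rw [this]
  have h3 : h1.aevalEquiv.symm (algebraMap F A x) = MvPolynomial.C x := by
    rw [AlgEquiv.commutes]; rfl
  change MvPolynomial.eval₂Hom φ v (h1.aevalEquiv.symm (algebraMap F A x)) = _
  rw [h3]; simp


theorem hajos (n : ℕ) : ∀ (P : ℂ[X]) (ρ : ℂ), ρ ≠ 0 → P ≠ 0 → (X - C ρ) ^ n ∣ P →
    n < P.support.card := by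
  induction n with
  | zero =>
    intro P ρ _ hP _
    exact Finset.card_pos.2 (Polynomial.support_nonempty.2 hP)
  | succ n ih =>
    intro P ρ hρ hP hd
    set k := P.natTrailingDegree with hk
    have hkm : k ∈ P.support := natTrailingDegree_mem_support_of_nonzero hP
    set Q : ℂ[X] := X * derivative P - C (k : ℂ) * P with hQ
    have hcoe : ∀ m, Q.coeff m = ((m : ℂ) - k) * P.coeff m := by
      intro m
      rw [hQ, coeff_sub, coeff_C_mul]
      cases m with
      | zero => simp
      | succ m => rw [coeff_X_mul, coeff_derivative]; push_cast; ring
    have hsup : Q.support ⊆ P.support.erase k := by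
      intro m hm
      rw [mem_support_iff, hcoe] at hm
      rw [Finset.mem_erase, mem_support_iff]
      refine ⟨?_, right_ne_zero_of_mul hm⟩
      rintro rfl
      simp at hm
    have hQd : (X - C ρ) ^ n ∣ Q := by
      apply dvd_sub
      · apply Dvd.dvd.mul_left
        obtain ⟨R, hR⟩ := hd
        rw [hR, derivative_mul, derivative_pow]
        apply dvd_add
        · simp only [Nat.add_sub_cancel]
          exact Dvd.dvd.mul_right (Dvd.dvd.mul_right (Dvd.dvd.mul_left dvd_rfl _) _) _
        · exact Dvd.dvd.mul_right (pow_dvd_pow _ (Nat.le_succ n)) _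
      · exact Dvd.dvd.mul_left ((pow_dvd_pow _ (Nat.le_succ n)).trans hd) _
    have hQ0 : Q ≠ 0 := by
      intro h0
      have : P = C (P.coeff k) * X ^ k := by
        ext m
        rw [coeff_C_mul_X_pow]
        split_ifs with h
        · rw [h]
        · have := hcoe m
          rw [h0, coeff_zero] at this
          rcases mul_eq_zero.1 this.symm with h1 | h1
          · exact absurd (by exact_mod_cast sub_eq_zero.1 h1) h
          · exact h1
      have hr : P.eval ρ = 0 := by
        have : (X - C ρ) ∣ P := (dvd_pow_self _ (Nat.succ_ne_zero n)).trans hd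
        exact dvd_iff_isRoot.1 this
      rw [this] at hr
      simp only [eval_mul, eval_C, eval_pow, eval_X] at hr
      exact mul_ne_zero (mem_support_iff.1 hkm) (pow_ne_zero _ hρ) hr
    have h1 := ih Q ρ hρ hQ0 hQd
    have h2 := Finset.card_le_card hsup
    rw [Finset.card_erase_of_mem hkm] at h2
    omega

theorem gap_pigeon (S : Finset ℕ) (x : ℕ → ℕ) (hx : Monotone x) :
    ∃ i ≤ S.card, ∀ n ∈ S, ¬ (x i < n ∧ n ≤ x (i+1)) := by
  by_contra! h
  choose! f hf using h
  have : (Finset.range (S.card + 1)).card ≤ S.card := by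
    apply Finset.card_le_card_of_injOn f
    · intro i hi
      exact (hf i (by simp at hi; omega)).1
    · intro i hi j hj hij
      simp only [Finset.coe_range, Set.mem_Iio] at hi hj
      have h1 := (hf i (by omega)).2
      have h2 := (hf j (by omega)).2
      rcases lt_trichotomy i j with h | h | h
      · have := hx (show i + 1 ≤ j from h); omega
      · exact h
      · have := hx (show j + 1 ≤ i from h); omega
  simp at this

theorem exists_trunc (W : ℂ[X]) (n : ℕ) : ∃ P : ℂ[X], P.natDegree ≤ n ∧
    (∀ k ≤ n, P.coeff k = W.coeff k) ∧ P.support ⊆ W.support := by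
  have hc : ∀ k, (∑ j ∈ Finset.range (n+1), monomial j (W.coeff j)).coeff k
      = if k ≤ n then W.coeff k else 0 := by
    intro k
    simp [finset_sum_coeff, coeff_monomial, Nat.lt_succ_iff]
  refine ⟨_, ?_, fun k hk => by rw [hc, if_pos hk], ?_⟩
  · rw [natDegree_le_iff_coeff_eq_zero]
    intro k hk
    rw [hc, if_neg (by omega)]
  · intro k hk
    rw [mem_support_iff, hc] at hk
    rw [mem_support_iff]
    split_ifs at hk with h
    · exact hk
    · exact absurd rfl hk

theorem lac (Y W : ℂ[X]) (B D T r : ℕ) (hY0 : Y.coeff 0 = 1)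
    (hYc : Y.support.card ≤ B) (hWc : W.support.card ≤ B) (hD : B ≤ D)
    (hdvd : X ^ T ∣ W - Y ^ D) (hr : 1 ≤ r) (hrT : (B+3)^(B+1) * r < T) : Y.coeff r = 0 := by
  by_contra hYr
  have hB : 0 < B := by
    refine lt_of_lt_of_le (Finset.card_pos.2 ⟨0, ?_⟩) hYc
    rw [mem_support_iff, hY0]; exact one_ne_zero
  obtain ⟨i, hi, hgap⟩ := gap_pigeon W.support (fun i => (B+3)^i * r)
    (fun a b h => Nat.mul_le_mul_right _ (Nat.pow_le_pow_right (by omega) h))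
  set n := (B+3)^i * r with hn
  have hn1 : r ≤ n := Nat.le_mul_of_pos_left _ (by positivity)
  have hnA : (B+3)^(i+1) * r = (B+3) * n := by rw [hn, pow_succ]; ring
  have hnT : (B+3) * n < T := by
    rw [← hnA]
    refine lt_of_le_of_lt (Nat.mul_le_mul_right _ (Nat.pow_le_pow_right (by omega) ?_)) hrT
    omega
  simp only [hnA] at hgap
  obtain ⟨P, hPd, hPc, hPs⟩ := exists_trunc W n
  obtain ⟨j, hj, hgapY⟩ := gap_pigeon Y.support (fun j => n * (j+1))
    (fun a b h => Nat.mul_le_mul_left _ (by simpa using h))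
  set k := n * (j+1) with hk
  have hkn : n * (j+1+1) = k + n := by rw [hk]; ring
  simp only [hkn] at hgapY
  have hk1 : n ≤ k := Nat.le_mul_of_pos_right _ (by omega)
  have hk2 : k + n + 1 ≤ (B+3) * n := by
    have : n * (j+1) ≤ n * (B+1) := Nat.mul_le_mul_left _ (by omega)
    nlinarith
  obtain ⟨Y1, hY1d, hY1c, hY1s⟩ := exists_trunc Y k
  have h1 : X ^ (k+n+1) ∣ Y - Y1 := by
    rw [X_pow_dvd_iff]
    intro m hm
    rw [coeff_sub]
    by_cases h : m ≤ k
    · rw [hY1c m h, sub_self]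
    · have a1 : Y.coeff m = 0 := by
        by_contra h'
        exact hgapY m (mem_support_iff.2 h') ⟨by omega, by omega⟩
      rw [a1, coeff_eq_zero_of_natDegree_lt (by omega), sub_zero]
  have h2 : X ^ (k+n+1) ∣ W - P := by
    rw [X_pow_dvd_iff]
    intro m hm
    rw [coeff_sub]
    by_cases h : m ≤ n
    · rw [hPc m h, sub_self]
    · have a1 : W.coeff m = 0 := by
        by_contra h'
        exact hgap m (mem_support_iff.2 h') ⟨by omega, by omega⟩
      rw [a1, coeff_eq_zero_of_natDegree_lt (by omega), sub_zero]
  have h3 : X ^ (k+n+1) ∣ Y1 ^ D - P := by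
    have e1 : X ^ (k+n+1) ∣ Y ^ D - Y1 ^ D := h1.trans (sub_dvd_pow_sub_pow _ _ _)
    have e2 : X ^ (k+n+1) ∣ W - Y ^ D := (pow_dvd_pow _ (by omega)).trans hdvd
    have : Y1 ^ D - P = (W - P) - (W - Y^D) - (Y ^ D - Y1 ^ D) := by ring
    rw [this]
    exact dvd_sub (dvd_sub h2 e2) e1
  set Z := Y1 ^ D - P with hZ
  have hD0 : 0 < D := by omega
  have hder : Y1 * derivative (Y1 ^ D) = C (D:ℂ) * derivative Y1 * Y1 ^ D := by
    rw [derivative_pow]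
    obtain ⟨D', rfl⟩ : ∃ D', D = D' + 1 := ⟨D - 1, by omega⟩
    simp only [Nat.add_sub_cancel, pow_succ]
    ring
  have hZ' : X ^ (k+n) ∣ derivative Z := by
    obtain ⟨V, hV⟩ := h3
    rw [hV, derivative_mul, derivative_X_pow]
    apply dvd_add
    · exact Dvd.dvd.mul_right (Dvd.dvd.mul_left (by simp) _) _
    · exact Dvd.dvd.mul_right (pow_dvd_pow _ (by omega)) _
  have hE : C (D:ℂ) * derivative Y1 * P - Y1 * derivative P = 0 := by
    set E := C (D:ℂ) * derivative Y1 * P - Y1 * derivative P with hEdef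
    have e1 : E = Y1 * derivative Z - C (D:ℂ) * derivative Y1 * Z := by
      rw [hEdef, hZ, derivative_sub, mul_sub, hder]; ring
    have e2 : X ^ (k+n) ∣ E := by
      rw [e1]
      exact dvd_sub (Dvd.dvd.mul_left hZ' _) (Dvd.dvd.mul_left ((pow_dvd_pow _ (by omega)).trans h3) _)
    have e3 : E.natDegree ≤ k + n - 1 := by
      apply (natDegree_sub_le _ _).trans
      apply max_le
      · refine natDegree_mul_le.trans ?_
        have a1 : (C (D:ℂ) * derivative Y1).natDegree ≤ k - 1 :=
          (natDegree_C_mul_le _ _).trans ((natDegree_derivative_le _).trans (by omega))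
        omega
      · refine natDegree_mul_le.trans ?_
        have a1 : (derivative P).natDegree ≤ n - 1 := (natDegree_derivative_le _).trans (by omega)
        omega
    ext m
    rw [coeff_zero]
    by_cases hm : m < k + n
    · exact X_pow_dvd_iff.1 e2 m hm
    · exact coeff_eq_zero_of_natDegree_lt (by omega)
  have hY10 : Y1.eval 0 = 1 := by
    rw [← coeff_zero_eq_eval_zero, hY1c 0 (by omega), hY0]
  have hZ0 : Z = 0 := by
    by_contra hne
    have q1 : Y1 * derivative Z = C (D:ℂ) * derivative Y1 * Z := by
      rw [hZ, derivative_sub, mul_sub, hder]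
      linear_combination hE
    obtain ⟨Z1, hZ1, hnd⟩ := exists_eq_pow_rootMultiplicity_mul_and_not_dvd Z hne 0
    have hv : k + n + 1 ≤ rootMultiplicity 0 Z := by
      rw [le_rootMultiplicity_iff hne]; simpa using h3
    obtain ⟨u, hu⟩ : ∃ u, rootMultiplicity 0 Z = u + 1 := ⟨rootMultiplicity 0 Z - 1, by omega⟩
    rw [hu] at hZ1
    simp only [C_0, sub_zero] at hZ1 hnd
    rw [hZ1, derivative_mul, derivative_X_pow] at q1
    simp only [Nat.add_sub_cancel] at q1
    have q2 : X ^ u * (Y1 * (C ((u+1 : ℕ) : ℂ) * Z1 + X * derivative Z1)) =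
        X ^ u * (C (D:ℂ) * derivative Y1 * X * Z1) := by
      rw [pow_succ] at q1
      linear_combination q1
    have q3 := mul_left_cancel₀ (pow_ne_zero u X_ne_zero) q2
    have q4 := congrArg (eval 0) q3
    simp only [eval_mul, eval_add, eval_X, eval_C, hY10, zero_mul, mul_zero, add_zero, one_mul,
      mul_eq_zero] at q4
    rcases q4 with q4 | q4
    · exact absurd q4 (by exact_mod_cast Nat.succ_ne_zero u)
    · apply hnd
      rw [X_dvd_iff, coeff_zero_eq_eval_zero, q4]
  have hPY : P = Y1 ^ D := by rw [hZ] at hZ0; exact (sub_eq_zero.1 hZ0).symm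
  have hY1r : Y1.coeff r ≠ 0 := by rw [hY1c r (by omega)]; exact hYr
  have hdeg : Y1.degree ≠ 0 := by
    intro h
    have : Y1.natDegree = 0 := natDegree_eq_of_degree_eq_some h
    exact hY1r (coeff_eq_zero_of_natDegree_lt (by omega))
  obtain ⟨ρ, hρ⟩ := IsAlgClosed.exists_root Y1 hdeg
  have hρ0 : ρ ≠ 0 := by
    rintro rfl
    rw [IsRoot, hY10] at hρ
    exact one_ne_zero hρ
  have hY1ne : Y1 ≠ 0 := by rintro rfl; simp at hY10
  have := hajos D P ρ hρ0 (by rw [hPY]; exact pow_ne_zero _ hY1ne)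
    (by rw [hPY]; exact pow_dvd_pow_of_dvd (dvd_iff_isRoot.2 hρ) _)
  have := Finset.card_le_card hPs
  omega


theorem no_zero_monomial (P : ℂ[X]) (h : ∀ z : ℂ, z ≠ 0 → P.eval z ≠ 0) :
    ∃ (c : ℂ) (n : ℕ), c ≠ 0 ∧ P = C c * X ^ n := by
  have hP : P ≠ 0 := by
    rintro rfl
    exact h 1 one_ne_zero (by simp)
  obtain ⟨Q, hQ, hnd⟩ := exists_eq_pow_rootMultiplicity_mul_and_not_dvd P hP 0
  simp only [C_0, sub_zero] at hQ hnd
  have hdeg : Q.degree = 0 := by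
    by_contra hne
    obtain ⟨x, hx⟩ := IsAlgClosed.exists_root Q hne
    by_cases hx0 : x = 0
    · apply hnd
      subst hx0; rw [X_dvd_iff, coeff_zero_eq_eval_zero]; exact hx
    · apply h x hx0
      rw [hQ, eval_mul, hx.eq_zero, mul_zero]
  rw [eq_C_of_degree_eq_zero hdeg] at hQ
  refine ⟨Q.coeff 0, rootMultiplicity 0 P, ?_, by rw [mul_comm]; exact hQ⟩
  intro h0
  rw [h0] at hQ
  simp at hQ
  exact hP hQ

theorem laurent_picard (P : ℂ[X]) (w : ℕ) (a b : ℂ) (hab : a ≠ b)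
    (ha : ∀ z : ℂ, z ≠ 0 → P.eval z / z ^ w ≠ a) (hb : ∀ z : ℂ, z ≠ 0 → P.eval z / z ^ w ≠ b) :
    ∃ k, P = C k * X ^ w := by
  have key : ∀ a : ℂ, (∀ z : ℂ, z ≠ 0 → P.eval z / z ^ w ≠ a) →
      ∃ (c : ℂ) (n : ℕ), c ≠ 0 ∧ P - C a * X ^ w = C c * X ^ n := by
    intro a ha
    apply no_zero_monomial
    intro z hz h
    apply ha z hz
    rw [div_eq_iff (pow_ne_zero _ hz)]
    simp only [eval_sub, eval_mul, eval_C, eval_pow, eval_X] at h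
    linear_combination h
  obtain ⟨c, n, hc, h1⟩ := key a ha
  obtain ⟨c', n', hc', h2⟩ := key b hb
  have hn : n = w := by
    by_contra hn
    have h3 : C (b - a) * X ^ w = C c * X ^ n - C c' * X ^ n' := by
      rw [← h1, ← h2, C_sub]; ring
    have h4 := congrArg (fun p => coeff p n) h3
    have h5 := congrArg (fun p => coeff p w) h3
    simp only [coeff_sub, coeff_C_mul_X_pow, if_neg hn, if_neg (Ne.symm hn), if_true] at h4 h5
    have h6 : b - a ≠ 0 := sub_ne_zero.2 hab.symm
    by_cases hwn : w = n'
    · rw [if_neg (by rw [← hwn]; exact hn)] at h4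
      apply hc; linear_combination -h4
    · rw [if_neg hwn] at h5
      apply h6; linear_combination h5
  refine ⟨c + a, ?_⟩
  rw [C_add, add_mul, ← hn]
  rw [← hn] at h1
  linear_combination h1

theorem omit_of_root (F G : ℂ[X]) (hcop : IsCoprime F G) (x y a : ℂ) (hy : y ≠ 0)
    (h : F.eval x = y * G.eval x) (ha : F.eval a = 0 ∨ G.eval a = 0) : x ≠ a := by
  rintro rfl
  obtain ⟨u, v, huv⟩ := hcop
  have h1 := congrArg (eval x) huv
  simp only [eval_add, eval_mul, eval_one] at h1
  have hF : F.eval x = 0 := by rcases ha with h0 | h0 <;> simp_all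
  have hG : G.eval x = 0 := by rcases ha with h0 | h0 <;> simp_all
  rw [hF, hG] at h1
  simp at h1

theorem partB1 (F G : ℂ[X]) (hcop : IsCoprime F G) (hdeg : 1 ≤ F.natDegree)
    (w : ℕ) (P : ℂ[X]) (q : ℂ → ℂ) (hq : ∀ z, z ≠ 0 → q z ≠ 0)
    (hch : ∀ z : ℂ, z ≠ 0 → F.eval (P.eval z / z ^ w) = q z * G.eval (P.eval z / z ^ w)) :
    (∃ k, P = C k * X ^ w) ∨
      (G.natDegree = 0 ∧ ∃ a, F = C F.leadingCoeff * (X - C a) ^ F.natDegree) := by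
  by_cases hk : ∃ k, P = C k * X ^ w
  · exact Or.inl hk
  right
  have hom : ∀ a, (F.eval a = 0 ∨ G.eval a = 0) → ∀ z, z ≠ 0 → P.eval z / z ^ w ≠ a :=
    fun a ha z hz => omit_of_root F G hcop _ (q z) a (hq z hz) (hch z hz) ha
  obtain ⟨a, ha⟩ := IsAlgClosed.exists_root F (by
    rw [degree_eq_natDegree (by rintro rfl; simp at hdeg)]; exact_mod_cast (by omega))
  have hall : ∀ b, (F.eval b = 0 ∨ G.eval b = 0) → b = a := by
    intro b hb
    by_contra hne
    exact hk (laurent_picard P w b a hne (hom b hb) (hom a (Or.inl ha)))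
  constructor
  · by_contra hne
    obtain ⟨b, hb⟩ := IsAlgClosed.exists_root G (fun h => hne (natDegree_eq_of_degree_eq_some h))
    have := hall b (Or.inr hb)
    subst this
    obtain ⟨u, v, huv⟩ := hcop
    have h1 := congrArg (eval b) huv
    simp only [eval_add, eval_mul, eval_one, ha.eq_zero, hb.eq_zero] at h1
    simp at h1
  · refine ⟨a, ?_⟩
    have hs := IsAlgClosed.splits F
    have h1 := hs.eq_prod_roots
    have h2 : F.roots = Multiset.replicate F.natDegree a := by
      rw [Multiset.eq_replicate]
      refine ⟨hs.natDegree_eq_card_roots.symm, fun b hb => hall b (Or.inl ?_)⟩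
      exact (mem_roots'.1 hb).2
    rw [h2] at h1
    simpa using h1

theorem partB2 (F G : ℂ[X]) (hcop : IsCoprime F G) (hdeg : G.natDegree < F.natDegree)
    (hG : G.natDegree ≠ 0)
    (w : ℕ) (P P1 P2 : ℂ[X])
    (hch : ∀ z : ℂ, z ≠ 0 →
      F.eval (P.eval z / z ^ w) = (P1.eval z / z ^ w) * G.eval (P.eval z / z ^ w))
    (hch1 : ∀ z : ℂ, z ≠ 0 →
      F.eval (P1.eval z / z ^ w) = (P2.eval z / z ^ w) * G.eval (P1.eval z / z ^ w)) :
    ∃ k, P = C k * X ^ w := by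
  have hne : ∀ x, F.eval x = 0 → G.eval x = 0 → False := by
    intro x hF hG
    obtain ⟨u, v, huv⟩ := hcop
    have h1 := congrArg (eval x) huv
    simp only [eval_add, eval_mul, eval_one, hF, hG] at h1
    simp at h1
  obtain ⟨a, ha⟩ := IsAlgClosed.exists_root G (fun h => hG (natDegree_eq_of_degree_eq_some h))
  have ha : G.eval a = 0 := ha
  have hom0 : ∀ z : ℂ, z ≠ 0 → P.eval z / z ^ w ≠ a := by
    intro z hz h
    have := hch z hz
    rw [h, ha, mul_zero] at this
    exact hne a this ha
  have hom1 : ∀ z : ℂ, z ≠ 0 → P1.eval z / z ^ w ≠ a := by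
    intro z hz h
    have := hch1 z hz
    rw [h, ha, mul_zero] at this
    exact hne a this ha
  have hd : (F - C a * G).natDegree = F.natDegree :=
    natDegree_sub_eq_left_of_natDegree_lt (lt_of_le_of_lt (natDegree_C_mul_le _ _) hdeg)
  obtain ⟨x, hx⟩ := IsAlgClosed.exists_root (F - C a * G)
    (fun h => by have h0 : (F - C a * G).natDegree = 0 := natDegree_eq_of_degree_eq_some h
                 omega)
  simp only [IsRoot, eval_sub, eval_mul, eval_C, sub_eq_zero] at hx
  have hxa : a ≠ x := by
    rintro rfl
    rw [ha, mul_zero] at hx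
    exact hne _ hx ha
  refine laurent_picard P w a x hxa hom0 ?_
  intro z hz h
  have h1 := hch z hz
  rw [h, hx] at h1
  have hGx : G.eval x ≠ 0 := by
    intro h0
    rw [h0, mul_zero] at hx
    exact hne _ hx h0
  exact hom1 z hz (mul_right_cancel₀ hGx h1).symm


noncomputable def ynext (h : ℂ[X]) (d : ℕ) (c : ℂ) (m : ℕ) (Y : ℂ[X]) : ℂ[X] :=
  Y ^ d + ∑ k ∈ Finset.range (d - 1), C (h.coeff k * c ^ k / c ^ d) * X ^ (m * (d - k)) * Y ^ k

theorem ynext_dvd (h : ℂ[X]) (d : ℕ) (c : ℂ) (m : ℕ) (Y : ℂ[X]) :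
    X ^ (2 * m) ∣ ynext h d c m Y - Y ^ d := by
  rw [ynext, add_sub_cancel_left]
  apply Finset.dvd_sum
  intro k hk
  rw [Finset.mem_range] at hk
  refine Dvd.dvd.mul_right (Dvd.dvd.mul_left (pow_dvd_pow _ ?_) _) _
  rw [mul_comm]
  exact Nat.mul_le_mul_left m (by omega)

theorem ynext_coeff (h : ℂ[X]) (d : ℕ) (c : ℂ) (m : ℕ) (hm : 1 ≤ m) (Y : ℂ[X])
    (hY : Y.coeff 0 = 1) : (ynext h d c m Y).coeff 0 = 1 := by
  have h1 := X_pow_dvd_iff.1 (ynext_dvd h d c m Y) 0 (by omega)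
  rw [coeff_sub, sub_eq_zero] at h1
  rw [h1, coeff_zero_eq_eval_zero, eval_pow, ← coeff_zero_eq_eval_zero, hY, one_pow]

theorem ynext_deg (h : ℂ[X]) (d : ℕ) (c : ℂ) (m : ℕ) (Y : ℂ[X])
    (hY : Y.natDegree ≤ 2 * m) : (ynext h d c m Y).natDegree ≤ 2 * (m * d) := by
  rw [ynext]
  refine (natDegree_add_le _ _).trans (max_le ?_ ?_)
  · refine natDegree_pow_le.trans ((Nat.mul_le_mul_left d hY).trans (by ring_nf; rfl))
  · refine natDegree_sum_le_of_forall_le _ _ (fun k hk => ?_)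
    rw [Finset.mem_range] at hk
    have h1 : (C (h.coeff k * c ^ k / c ^ d) * X ^ (m * (d - k)) : ℂ[X]).natDegree ≤ m * (d - k) :=
      natDegree_C_mul_X_pow_le _ _
    have h2 : (Y ^ k).natDegree ≤ k * (2 * m) := natDegree_pow_le.trans (Nat.mul_le_mul_left k hY)
    refine natDegree_mul_le.trans ((add_le_add h1 h2).trans ?_)
    obtain ⟨t, ht⟩ : ∃ t, d = k + t := ⟨d - k, by omega⟩
    subst ht
    rw [Nat.add_sub_cancel_left]
    nlinarith

theorem ynext_eval (h : ℂ[X]) (d : ℕ) (hd : 2 ≤ d) (hdeg : h.natDegree = d)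
    (hmon : h.coeff d = 1) (hcen : h.coeff (d - 1) = 0)
    (c : ℂ) (hc : c ≠ 0) (m : ℕ) (Y : ℂ[X]) (z : ℂ) (hz : z ≠ 0) :
    h.eval (c / z ^ m * Y.eval z) = c ^ d / z ^ (m * d) * (ynext h d c m Y).eval z := by
  rw [eval_eq_sum_range, hdeg]
  obtain ⟨e, rfl⟩ : ∃ e, d = e + 1 := ⟨d - 1, by omega⟩
  rw [Finset.sum_range_succ, Finset.sum_range_succ, hmon]
  rw [Nat.add_sub_cancel] at hcen
  rw [hcen, ynext, Nat.add_sub_cancel, eval_add, eval_finsetSum, mul_add, Finset.mul_sum]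
  simp only [eval_mul, eval_C, eval_pow, eval_X]
  rw [add_comm, zero_mul, add_zero, one_mul, mul_pow, div_pow, ← pow_mul]
  congr 1
  apply Finset.sum_congr rfl
  intro k hk
  rw [Finset.mem_range] at hk
  obtain ⟨t, ht⟩ : ∃ t, e + 1 = k + t := ⟨e + 1 - k, by omega⟩
  rw [ht, Nat.add_sub_cancel_left, mul_pow, div_pow, mul_add, pow_add z, ← pow_mul]
  field_simp

noncomputable def yseq (h : ℂ[X]) (d : ℕ) (c : ℂ) (m : ℕ) (Y : ℂ[X]) : ℕ → ℂ[X]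
  | 0 => Y
  | i + 1 => ynext h d (c ^ d ^ i) (m * d ^ i) (yseq h d c m Y i)

theorem yseq_dvd (h : ℂ[X]) (d : ℕ) (hd : 2 ≤ d) (c : ℂ) (m : ℕ) (Y : ℂ[X]) (i j : ℕ) :
    X ^ (2 * (m * d ^ i)) ∣ yseq h d c m Y (i + j) - yseq h d c m Y i ^ d ^ j := by
  induction j with
  | zero => simp
  | succ j ih =>
    have h1 := ynext_dvd h d (c ^ d ^ (i+j)) (m * d ^ (i+j)) (yseq h d c m Y (i+j))
    have h2 := ih.trans (sub_dvd_pow_sub_pow _ _ d)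
    rw [← pow_mul, ← pow_succ] at h2
    have h3 := dvd_add ((pow_dvd_pow X (Nat.mul_le_mul_left 2 (Nat.mul_le_mul_left m
      (Nat.pow_le_pow_right (by omega) (Nat.le_add_right i j))))).trans h1) h2
    rw [sub_add_sub_cancel] at h3
    exact h3

theorem yseq_coeff (h : ℂ[X]) (d : ℕ) (hd : 2 ≤ d) (c : ℂ) (m : ℕ) (hm : 1 ≤ m) (Y : ℂ[X])
    (hY : Y.coeff 0 = 1) (i : ℕ) : (yseq h d c m Y i).coeff 0 = 1 := by
  induction i with
  | zero => exact hY
  | succ i ih => exact ynext_coeff _ _ _ _ (Nat.mul_pos hm (by positivity)) _ ih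

theorem poly_eq_of_nonzero (P Q : ℂ[X]) (h : ∀ z : ℂ, z ≠ 0 → P.eval z = Q.eval z) : P = Q := by
  apply Polynomial.eq_of_infinite_eval_eq
  refine Set.Infinite.mono (s := {0}ᶜ) (fun z hz => h z hz) ?_
  exact (Set.finite_singleton (0:ℂ)).infinite_compl

theorem card_supp_mul (P : ℂ[X]) (c : ℂ) (hc : c ≠ 0) (n : ℕ) :
    (C c * X ^ n * P).support.card = P.support.card := by
  have : (C c * X ^ n * P).support = P.support.map (addRightEmbedding n) := by
    ext i
    rw [mul_assoc, mem_support_iff, coeff_C_mul, mul_comm (X ^ n) P, coeff_mul_X_pow']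
    simp only [Finset.mem_map, mem_support_iff, addRightEmbedding_apply]
    constructor
    · intro hi
      have hni : n ≤ i := by by_contra hlt; simp [hlt] at hi
      simp [hni, hc] at hi
      exact ⟨i - n, hi, by omega⟩
    · rintro ⟨k, hk, rfl⟩
      simp [hk, hc]
  rw [this, Finset.card_map]

theorem pow_sub_one_dvd (Y : ℂ[X]) (hY : Y.coeff 0 = 1) (D n : ℕ) (hD : D ≠ 0)
    (h : X ^ n ∣ Y ^ D - 1) : X ^ n ∣ Y - 1 := by
  rw [← mul_geom_sum] at h
  refine IsCoprime.dvd_of_dvd_mul_right ?_ h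
  apply IsCoprime.pow_left
  rw [Irreducible.coprime_iff_not_dvd irreducible_X, X_dvd_iff, coeff_zero_eq_eval_zero,
    eval_finsetSum]
  have : eval 0 Y = 1 := by rw [← coeff_zero_eq_eval_zero, hY]
  simp [this, hD]

def LF (B : ℕ) (q : ℂ → ℂ) : Prop :=
  ∃ (u : ℕ) (S : ℂ[X]), S.support.card ≤ B ∧ ∀ z : ℂ, z ≠ 0 → z ^ u * q z = S.eval z

theorem b3a (h : ℂ[X]) (d : ℕ) (hd : 2 ≤ d) (hdeg : h.natDegree = d)
    (hmon : h.coeff d = 1) (hcen : h.coeff (d - 1) = 0) (B n j : ℕ)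
    (hj : B ≤ d ^ j) (hn : (B+3)^(B+1) < d ^ n) (q : ℕ → ℂ → ℂ)
    (hR : ∀ i ≤ n + j, LF B (q i))
    (hch : ∀ i < n + j, ∀ z : ℂ, z ≠ 0 → h.eval (q i z) = q (i+1) z)
    (c : ℂ) (hc : c ≠ 0) (m : ℕ) (hm : 1 ≤ m) (Y : ℂ[X]) (hY : Y.coeff 0 = 1)
    (hYd : Y.natDegree ≤ 2 * m)
    (h0 : ∀ z : ℂ, z ≠ 0 → q 0 z = c / z ^ m * Y.eval z) :
    ∃ b, Y = 1 + C b * X ^ (2 * m) := by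
  have hd0 : ∀ i, d ^ i ≠ 0 := fun i => pow_ne_zero _ (by omega)
  have hfun : ∀ i ≤ n + j, ∀ z : ℂ, z ≠ 0 → q i z =
      c ^ d ^ i / z ^ (m * d ^ i) * (yseq h d c m Y i).eval z := by
    intro i
    induction i with
    | zero => intro _ z hz; simpa [yseq] using h0 z hz
    | succ i ih =>
      intro hi z hz
      rw [← hch i (by omega) z hz, ih (by omega) z hz,
        ynext_eval h d hd hdeg hmon hcen _ (pow_ne_zero _ hc) _ _ z hz, ← pow_mul, mul_assoc,
        ← pow_succ]
      rfl
  have hcard : ∀ i ≤ n + j, (yseq h d c m Y i).support.card ≤ B := by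
    intro i hi
    obtain ⟨w, S, hS, hSe⟩ := hR i hi
    have h1 : C 1 * X ^ (m * d ^ i) * S = C (c ^ d ^ i) * X ^ w * yseq h d c m Y i := by
      apply poly_eq_of_nonzero
      intro z hz
      have := hfun i hi z hz
      simp only [eval_mul, eval_C, eval_pow, eval_X]
      rw [← hSe z hz, this]
      field_simp
    rw [← card_supp_mul _ (c ^ d ^ i) (pow_ne_zero _ hc) w, ← h1, card_supp_mul _ 1 one_ne_zero]
    exact hS
  have hlac := lac (yseq h d c m Y n) (yseq h d c m Y (n+j)) B (d ^ j) (2 * (m * d ^ n))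
  have h2 : X ^ (2 * m) ∣ yseq h d c m Y n - 1 := by
    rw [X_pow_dvd_iff]
    intro r hr
    rcases Nat.eq_zero_or_pos r with rfl | hr0
    · simp [yseq_coeff h d hd c m hm Y hY n]
    · rw [coeff_sub, hlac r (yseq_coeff h d hd c m hm Y hY n) (hcard n (by omega))
        (hcard (n+j) le_rfl) hj (yseq_dvd h d hd c m Y n j) hr0 (by
          have q1 := Nat.mul_le_mul_right r hn.le
          have q2 := Nat.mul_lt_mul_of_pos_left hr (Nat.pos_of_ne_zero (hd0 n))
          nlinarith)]
      rw [coeff_one, if_neg (by omega), sub_zero]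
  have h3 := yseq_dvd h d hd c m Y 0 n
  rw [pow_zero, mul_one, zero_add] at h3
  have h4 : X ^ (2 * m) ∣ Y ^ d ^ n - 1 := by
    have := dvd_sub h2 h3
    rwa [sub_sub_sub_cancel_left] at this
  obtain ⟨V, hV⟩ := pow_sub_one_dvd Y hY _ _ (hd0 n) h4
  have hY2 : Y = 1 + X ^ (2*m) * V := by linear_combination hV
  refine ⟨Y.coeff (2 * m), ?_⟩
  ext k
  rw [coeff_add, coeff_C_mul_X_pow, coeff_one]
  rcases lt_trichotomy k (2 * m) with hk | hk | hk
  · rw [if_neg (show ¬ k = 2 * m by omega), add_zero, hY2, coeff_add, coeff_X_pow_mul',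
      if_neg (show ¬ 2 * m ≤ k by omega), coeff_one, add_zero]
  · rw [hk, if_neg (by omega), if_pos rfl, zero_add]
  · rw [if_neg (by omega), if_neg (by omega), coeff_eq_zero_of_natDegree_lt (by omega), add_zero]

theorem LF.inv {B : ℕ} {q : ℂ → ℂ} (h : LF B q) : LF B (fun z => q z⁻¹) := by
  obtain ⟨u, S, hS, he⟩ := h
  refine ⟨S.natDegree, C 1 * X ^ u * S.reverse, ?_, ?_⟩
  · rw [card_supp_mul _ _ one_ne_zero, reverse, reflect_support]
    exact Finset.card_image_le.trans hS
  · intro z hz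
    have h1 := he z⁻¹ (inv_ne_zero hz)
    let _ := invertibleOfNonzero (inv_ne_zero hz)
    have h2 := eval₂_reverse_mul_pow (RingHom.id ℂ) z⁻¹ S
    simp only [invOf_eq_inv, inv_inv, eval₂_id] at h2
    rw [← h2] at h1
    simp only [eval_mul, eval_C, eval_pow, eval_X]
    rw [inv_pow, inv_pow] at h1
    field_simp at h1
    rw [one_div] at h1
    linear_combination h1

theorem LF.affine {B : ℕ} {q : ℂ → ℂ} (h : LF B q) (s v : ℂ) :
    LF (B+1) (fun z => s * (q z - v)) := by
  obtain ⟨u, S, hS, he⟩ := h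
  refine ⟨u, C s * (S - C v * X ^ u), ?_, ?_⟩
  · have h1 : (C s * (S - C v * X ^ u)).support ⊆ S.support ∪ {u} := by
      intro i hi
      rw [mem_support_iff, coeff_C_mul, coeff_sub, coeff_C_mul_X_pow] at hi
      rw [Finset.mem_union, mem_support_iff, Finset.mem_singleton]
      by_contra hcon
      push Not at hcon
      rw [if_neg hcon.2, hcon.1] at hi
      simp at hi
    refine (Finset.card_le_card h1).trans ((Finset.card_union_le _ _).trans ?_)
    simpa using hS
  · intro z hz
    simp only [eval_mul, eval_C, eval_pow, eval_X, eval_sub, ← he z hz]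
    ring

theorem LF.extreme {B : ℕ} {q : ℂ → ℂ} (h : LF B q) (hnc : ¬ ∃ k, ∀ z, z ≠ 0 → q z = k) :
    ∃ (c : ℂ) (m : ℕ) (Y : ℂ[X]), c ≠ 0 ∧ 1 ≤ m ∧ Y.coeff 0 = 1 ∧ Y.natDegree ≤ 2 * m ∧
      ((∀ z, z ≠ 0 → q z = c / z ^ m * Y.eval z) ∨
       (∀ z, z ≠ 0 → q z⁻¹ = c / z ^ m * Y.eval z)) := by
  obtain ⟨w, P, hS, he⟩ := h
  have hP : P ≠ 0 := by
    rintro rfl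
    refine hnc ⟨0, fun z hz => ?_⟩
    have := he z hz
    simpa [hz] using this
  obtain ⟨Q, hQ, hnd⟩ := exists_eq_pow_rootMultiplicity_mul_and_not_dvd P hP 0
  simp only [C_0, sub_zero] at hQ hnd
  set lo := rootMultiplicity 0 P
  have hQ0 : Q.coeff 0 ≠ 0 := fun h => hnd (X_dvd_iff.2 h)
  have hQne : Q ≠ 0 := by rintro rfl; simp at hQ0
  have hdeg : P.natDegree = lo + Q.natDegree := by
    rw [hQ, natDegree_mul (pow_ne_zero _ X_ne_zero) hQne, natDegree_X_pow]
  by_cases hlo : lo + P.natDegree ≤ 2 * w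
  · have hm : 1 ≤ w - lo := by
      by_contra hcon
      have h1 : lo = w := by omega
      have h2 : Q.natDegree = 0 := by omega
      rw [eq_C_of_natDegree_eq_zero h2] at hQ
      refine hnc ⟨Q.coeff 0, fun z hz => ?_⟩
      have := he z hz
      rw [hQ, h1] at this
      simp only [eval_mul, eval_C, eval_pow, eval_X] at this
      exact mul_left_cancel₀ (pow_ne_zero _ hz) this
    refine ⟨Q.coeff 0, w - lo, C (Q.coeff 0)⁻¹ * Q, hQ0, hm, by simp [hQ0], ?_, Or.inl ?_⟩
    · exact (natDegree_C_mul_le _ _).trans (by omega)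
    · intro z hz
      have h1 := he z hz
      rw [hQ] at h1
      simp only [eval_mul, eval_C, eval_pow, eval_X] at h1 ⊢
      have h2 : z ^ w = z ^ lo * z ^ (w - lo) := by rw [← pow_add]; congr 1; omega
      rw [h2] at h1
      field_simp
      have := pow_ne_zero lo hz
      rw [mul_assoc] at h1
      linear_combination (mul_left_cancel₀ this h1)
  · have hlc : P.leadingCoeff ≠ 0 := leadingCoeff_ne_zero.2 hP
    refine ⟨P.leadingCoeff, P.natDegree - w, C P.leadingCoeff⁻¹ * P.reverse, hlc, by omega, ?_, ?_,
      Or.inr ?_⟩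
    · simp [hlc]
    · refine (natDegree_C_mul_le _ _).trans ?_
      rw [reverse_natDegree]
      have : lo ≤ P.natTrailingDegree := by
        apply le_natTrailingDegree hP
        intro i hi
        rw [hQ, coeff_X_pow_mul', if_neg (by omega)]
      omega
    · intro z hz
      have h1 := he z⁻¹ (inv_ne_zero hz)
      let _ := invertibleOfNonzero (inv_ne_zero hz)
      have h2 := eval₂_reverse_mul_pow (RingHom.id ℂ) z⁻¹ P
      simp only [invOf_eq_inv, inv_inv, eval₂_id] at h2
      rw [← h2] at h1
      simp only [eval_mul, eval_C]
      have h3 : z ^ P.natDegree = z ^ w * z ^ (P.natDegree - w) := by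
        rw [← pow_add]; congr 1; omega
      rw [inv_pow, inv_pow, h3] at h1
      field_simp at h1 ⊢
      exact h1

theorem b3c (h : ℂ[X]) (d : ℕ) (hd : 2 ≤ d) (hdeg : h.natDegree = d)
    (hmon : h.coeff d = 1) (hcen : h.coeff (d - 1) = 0) (B n j : ℕ)
    (hj : B ≤ d ^ j) (hn : (B+3)^(B+1) < d ^ n) (q : ℕ → ℂ → ℂ)
    (hR : ∀ i ≤ n + j + 2, LF B (q i))
    (hch : ∀ i < n + j + 2, ∀ z : ℂ, z ≠ 0 → h.eval (q i z) = q (i+1) z)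
    (c : ℂ) (hc : c ≠ 0) (m : ℕ) (hm : 1 ≤ m) (Y : ℂ[X]) (hY : Y.coeff 0 = 1)
    (hYd : Y.natDegree ≤ 2 * m)
    (h0 : ∀ z : ℂ, z ≠ 0 → q 0 z = c / z ^ m * Y.eval z) :
    ∃ b b' b'' : ℂ, (∀ t, t ≠ 0 → h.eval (t + b / t) = t ^ d + b' / t ^ d) ∧
      (∀ t, t ≠ 0 → h.eval (t + b' / t) = t ^ d + b'' / t ^ d) := by
  have step : ∀ i ≤ 2, ∀ (c : ℂ), c ≠ 0 → ∀ (m : ℕ), 1 ≤ m → ∀ (Y : ℂ[X]), Y.coeff 0 = 1 →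
      Y.natDegree ≤ 2 * m → (∀ z : ℂ, z ≠ 0 → q i z = c / z ^ m * Y.eval z) →
      ∃ b, ∀ z : ℂ, z ≠ 0 → q i z = c / z ^ m + b / (c / z ^ m) := by
    intro i hi c hc m hm Y hY hYd h0
    obtain ⟨b, hb⟩ := b3a h d hd hdeg hmon hcen B n j hj hn (fun k => q (i + k))
      (fun k hk => hR (i+k) (by omega)) (fun k hk z hz => hch (i+k) (by omega) z hz)
      c hc m hm Y hY hYd (fun z hz => h0 z hz)
    refine ⟨c ^ 2 * b, fun z hz => ?_⟩
    rw [h0 z hz, hb]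
    simp only [eval_add, eval_one, eval_mul, eval_C, eval_pow, eval_X]
    have : z ^ (2 * m) = (z ^ m) ^ 2 := by rw [← pow_mul, mul_comm]
    rw [this]
    field_simp
  have hdp : 0 < d := by omega
  have e1 : ∀ z : ℂ, z ≠ 0 → q 1 z = c ^ d / z ^ (m * d) * (ynext h d c m Y).eval z := by
    intro z hz
    rw [← hch 0 (by omega) z hz, h0 z hz, ynext_eval h d hd hdeg hmon hcen c hc m Y z hz]
  have e2 : ∀ z : ℂ, z ≠ 0 → q 2 z = (c ^ d) ^ d / z ^ (m * d * d) *
      (ynext h d (c ^ d) (m * d) (ynext h d c m Y)).eval z := by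
    intro z hz
    rw [← hch 1 (by omega) z hz, e1 z hz,
      ynext_eval h d hd hdeg hmon hcen _ (pow_ne_zero _ hc) _ _ z hz]
  have hm1 : 1 ≤ m * d := Nat.mul_pos hm hdp
  obtain ⟨b0, hb0⟩ := step 0 (by omega) c hc m hm Y hY hYd h0
  obtain ⟨b1, hb1⟩ := step 1 (by omega) _ (pow_ne_zero _ hc) _ hm1 _
    (ynext_coeff h d c m hm Y hY) (ynext_deg h d c m Y hYd) e1
  obtain ⟨b2, hb2⟩ := step 2 (by omega) _ (pow_ne_zero _ (pow_ne_zero _ hc)) _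
    (Nat.mul_pos hm1 hdp) _
    (ynext_coeff h d _ _ hm1 _ (ynext_coeff h d c m hm Y hY))
    (ynext_deg h d _ _ _ (ynext_deg h d c m Y hYd)) e2
  have surj : ∀ (c : ℂ), c ≠ 0 → ∀ m : ℕ, 1 ≤ m → ∀ t : ℂ, t ≠ 0 → ∃ z, z ≠ 0 ∧ c / z ^ m = t := by
    intro c hc m hm t ht
    obtain ⟨z, hz⟩ := IsAlgClosed.exists_pow_nat_eq (c / t) (n := m) (by omega)
    refine ⟨z, ?_, ?_⟩
    · rintro rfl
      rw [zero_pow (by omega)] at hz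
      exact div_ne_zero hc ht hz.symm
    · rw [hz]; field_simp
  refine ⟨b0, b1, b2, fun t ht => ?_, fun t ht => ?_⟩
  · obtain ⟨z, hz, rfl⟩ := surj c hc m hm t ht
    rw [← hb0 z hz, hch 0 (by omega) z hz, hb1 z hz, div_pow, ← pow_mul]
  · obtain ⟨z, hz, rfl⟩ := surj (c ^ d) (pow_ne_zero _ hc) (m * d) hm1 t ht
    rw [← hb1 z hz, hch 1 (by omega) z hz, hb2 z hz, div_pow, pow_mul z (m * d)]


theorem dickson_coeffs (n : ℕ) :
    (∀ k, n < k → (dickson 1 (1:ℂ) n).coeff k = 0) ∧ (1 ≤ n → (dickson 1 (1:ℂ) n).coeff n = 1) ∧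
    (2 ≤ n → (dickson 1 (1:ℂ) n).coeff (n - 2) = - (n : ℂ)) := by
  induction n using Nat.strong_induction_on with
  | _ n ih =>
    match n, ih with
    | 0, _ =>
      refine ⟨fun k hk => ?_, by omega, by omega⟩
      rw [dickson_zero]
      have : (3 - ((1:ℕ) : ℂ[X])) = C 2 := by rw [show (C 2 : ℂ[X]) = 2 from rfl]; norm_num
      rw [this, coeff_C, if_neg (by omega)]
    | 1, _ =>
      refine ⟨fun k hk => ?_, fun _ => ?_, by omega⟩
      · rw [dickson_one, coeff_X, if_neg (by omega)]
      · rw [dickson_one, coeff_X_one]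
    | n + 2, ih =>
      obtain ⟨a1, a2, a3⟩ := ih (n+1) (by omega)
      obtain ⟨b1, b2, b3⟩ := ih n (by omega)
      refine ⟨fun k hk => ?_, fun _ => ?_, fun _ => ?_⟩
      · obtain ⟨k, rfl⟩ : ∃ k', k = k' + 1 := ⟨k - 1, by omega⟩
        rw [dickson_add_two, coeff_sub, coeff_X_mul, coeff_C_mul, a1 k (by omega),
          b1 _ (by omega)]
        simp
      · rw [dickson_add_two, coeff_sub, coeff_X_mul, coeff_C_mul, a2 (by omega), b1 _ (by omega)]
        simp
      · rw [dickson_add_two, coeff_sub, coeff_C_mul, Nat.add_sub_cancel]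
        rcases Nat.eq_zero_or_pos n with rfl | hn
        · have : (3 - ((1:ℕ) : ℂ[X])) = C 2 := by rw [show (C 2 : ℂ[X]) = 2 from rfl]; norm_num
          rw [dickson_zero, this]
          simp
        · rw [b2 hn]
          obtain ⟨k, rfl⟩ : ∃ k', n = k' + 1 := ⟨n - 1, by omega⟩
          rw [coeff_X_mul]
          have := a3 (by omega)
          rw [show k + 1 + 1 - 2 = k by omega] at this
          rw [this]
          push_cast; ring

theorem fun_to_dickson (h : ℂ[X]) (d : ℕ) (δ : ℂ) (hδ : δ ≠ 0)
    (h1 : ∀ t : ℂ, t ≠ 0 → h.eval (t + δ ^ 2 / t) = t ^ d + (δ ^ 2) ^ d / t ^ d) :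
    h.comp (C δ * X) = C (δ ^ d) * dickson 1 1 d := by
  apply Polynomial.funext
  intro x
  obtain ⟨s, hs0, hs⟩ : ∃ s : ℂ, s ≠ 0 ∧ x = s + s⁻¹ := by
    obtain ⟨s, hs⟩ := IsAlgClosed.exists_root (X ^ 2 - C x * X + C 1 : ℂ[X]) (by
      have : (X ^ 2 - C x * X + C 1 : ℂ[X]).degree = 2 := by compute_degree!
      rw [this]; norm_num)
    simp only [IsRoot, eval_add, eval_sub, eval_pow, eval_X, eval_mul, eval_C] at hs
    have hs0 : s ≠ 0 := by rintro rfl; simp at hs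
    refine ⟨s, hs0, ?_⟩
    field_simp
    linear_combination -hs
  have h2 := dickson_one_one_eval_add_inv s s⁻¹ (mul_inv_cancel₀ hs0) d
  have h3 := h1 (δ * s) (mul_ne_zero hδ hs0)
  simp only [eval_comp, eval_mul, eval_C, eval_X]
  rw [hs, h2]
  have e1 : δ * s + δ ^ 2 / (δ * s) = δ * (s + s⁻¹) := by field_simp
  have e2 : (δ * s) ^ d + (δ ^ 2) ^ d / (δ * s) ^ d = δ ^ d * (s ^ d + s⁻¹ ^ d) := by
    rw [mul_pow, inv_pow, ← pow_mul, mul_comm 2 d, pow_mul]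
    field_simp
  rw [← e1, ← e2, h3]

theorem fun_eq_cases (h : ℂ[X]) (d : ℕ) (hd : 2 ≤ d) (b b' : ℂ)
    (h1 : ∀ t : ℂ, t ≠ 0 → h.eval (t + b / t) = t ^ d + b' / t ^ d) :
    b' = b ^ d ∧ h.coeff (d - 2) = - d * b ∧ (b = 0 → h = X ^ d) := by
  by_cases hb : b = 0
  · subst hb
    have e1 : X ^ d * h = X ^ (2 * d) + C b' := by
      apply poly_eq_of_nonzero
      intro z hz
      have := h1 z hz
      rw [zero_div, add_zero] at this
      simp only [eval_mul, eval_pow, eval_X, eval_add, eval_C, this]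
      field_simp
      ring
    have e2 := congrArg (fun p => coeff p 0) e1
    simp only [coeff_X_pow_mul', coeff_add, coeff_X_pow, coeff_C_zero] at e2
    rw [if_neg (by omega), if_neg (by omega), zero_add] at e2
    subst e2
    rw [C_0, add_zero, two_mul, pow_add] at e1
    have e3 := mul_left_cancel₀ (pow_ne_zero d X_ne_zero) e1
    refine ⟨by rw [zero_pow (by omega)], ?_, fun _ => e3⟩
    rw [e3, coeff_X_pow, if_neg (by omega)]; simp
  · have hb' : b' = b ^ d := by
      obtain ⟨t, ht⟩ := IsAlgClosed.exists_pow_nat_eq (2 * b ^ d) (n := d * 2) (by omega)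
      have hbd := pow_ne_zero d hb
      have ht0 : t ≠ 0 := by
        rintro rfl
        rw [zero_pow (by omega)] at ht
        exact mul_ne_zero two_ne_zero hbd ht.symm
      have e1 := h1 t ht0
      have e2 := h1 (b / t) (div_ne_zero hb ht0)
      have e3 : b / t + b / (b / t) = t + b / t := by field_simp; ring
      rw [e3, e1, div_pow] at e2
      have htd := pow_ne_zero d ht0
      field_simp at e2
      rw [pow_mul] at ht
      rw [ht] at e2
      have : b ^ d * (b ^ d - b') = 0 := by linear_combination e2
      rcases mul_eq_zero.1 this with h0 | h0
      · exact absurd h0 hbd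
      · exact (sub_eq_zero.1 h0).symm
    obtain ⟨δ, hδ⟩ := IsAlgClosed.exists_pow_nat_eq b (n := 2) (by omega)
    have hδ0 : δ ≠ 0 := by rintro rfl; rw [zero_pow two_ne_zero] at hδ; exact hb hδ.symm
    have e1 := fun_to_dickson h d δ hδ0 (by rw [hδ, ← hb']; exact h1)
    have e2 := congrArg (fun p => coeff p (d - 2)) e1
    simp only [comp_C_mul_X_coeff, coeff_C_mul] at e2
    rw [(dickson_coeffs d).2.2 hd] at e2
    refine ⟨hb', ?_, fun h => absurd h hb⟩
    obtain ⟨k, rfl⟩ : ∃ k, d = k + 2 := ⟨d - 2, by omega⟩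
    rw [Nat.add_sub_cancel] at e2 ⊢
    apply mul_right_cancel₀ (pow_ne_zero k hδ0)
    rw [e2, ← hδ]; ring

theorem special_shape (h : ℂ[X]) (d : ℕ) (hd : 2 ≤ d) (b b' b'' : ℂ)
    (h1 : ∀ t : ℂ, t ≠ 0 → h.eval (t + b / t) = t ^ d + b' / t ^ d)
    (h2 : ∀ t : ℂ, t ≠ 0 → h.eval (t + b' / t) = t ^ d + b'' / t ^ d) :
    ∃ δ ε : ℂ, δ ≠ 0 ∧ (ε = 1 ∨ ε = -1) ∧
      (C δ⁻¹ * h.comp (C δ * X) = C ε * X ^ d ∨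
        C δ⁻¹ * h.comp (C δ * X) = C ε * dickson 1 1 d) := by
  obtain ⟨a1, a2, a3⟩ := fun_eq_cases h d hd b b' h1
  obtain ⟨b1, b2, b3⟩ := fun_eq_cases h d hd b' b'' h2
  have hbb : b = b' := by
    have : (d:ℂ) ≠ 0 := by exact_mod_cast (by omega)
    rw [a2] at b2
    have : (d:ℂ) * (b - b') = 0 := by linear_combination -b2
    rcases mul_eq_zero.1 this with h0 | h0
    · contradiction
    · exact sub_eq_zero.1 h0
  by_cases hb : b = 0
  · refine ⟨1, 1, one_ne_zero, Or.inl rfl, Or.inl ?_⟩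
    simp [a3 hb]
  · obtain ⟨δ, hδ⟩ := IsAlgClosed.exists_pow_nat_eq b (n := 2) (by omega)
    have hδ0 : δ ≠ 0 := by rintro rfl; rw [zero_pow two_ne_zero] at hδ; exact hb hδ.symm
    have e1 := fun_to_dickson h d δ hδ0 (by rw [hδ, ← a1]; exact h1)
    refine ⟨δ, δ⁻¹ * δ ^ d, hδ0, ?_, Or.inr ?_⟩
    · apply sq_eq_one_iff.1
      rw [← hbb, ← hδ, ← pow_mul, mul_comm 2 d, pow_mul] at a1
      rw [mul_pow, ← a1, inv_pow, inv_mul_cancel₀ (pow_ne_zero _ hδ0)]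
    · rw [e1, C_mul, mul_assoc]


theorem comp_polys (p q : ℂ[X]) :
    ratFuncComp (algebraMap ℂ[X] (RatFunc ℂ) p) (algebraMap ℂ[X] (RatFunc ℂ) q) =
      algebraMap ℂ[X] (RatFunc ℂ) (p.comp q) := by
  rw [ratFuncComp, RatFunc.eval_algebraMap, comp, hom_eval₂]
  rfl

theorem mobius_affine (u v : ℂ) (hu : u ≠ 0) :
    IsMobius (algebraMap ℂ[X] (RatFunc ℂ) (C u * X + C v)) := by
  refine ⟨u, v, 0, 1, by simpa using hu, ?_⟩
  simp

theorem special_of_poly (h : ℂ[X]) (u v ε : ℂ) (n : ℕ) (hu : u ≠ 0) (hε : ε = 1 ∨ ε = -1)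
    (hh : C u⁻¹ * (h.comp (C u * X + C v) - C v) = C ε * X ^ n ∨
      C u⁻¹ * (h.comp (C u * X + C v) - C v) = C ε * dickson 1 1 n) :
    IsSpecialRatFunc (algebraMap ℂ[X] (RatFunc ℂ) h) := by
  refine ⟨algebraMap ℂ[X] (RatFunc ℂ) (C u⁻¹ * X + C (- u⁻¹ * v)),
    algebraMap ℂ[X] (RatFunc ℂ) (C u * X + C v), mobius_affine _ _ (inv_ne_zero hu),
    mobius_affine _ _ hu, ?_, ?_, n, ε, hε, ?_⟩
  · rw [comp_polys, ← RatFunc.algebraMap_X]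
    congr 1
    apply Polynomial.funext
    intro x
    simp only [eval_comp, eval_add, eval_mul, eval_C, eval_X]
    field_simp; ring
  · rw [comp_polys, ← RatFunc.algebraMap_X]
    congr 1
    apply Polynomial.funext
    intro x
    simp only [eval_comp, eval_add, eval_mul, eval_C, eval_X]
    field_simp; ring
  · rw [comp_polys, comp_polys]
    have : ((C u⁻¹ * X + C (- u⁻¹ * v)).comp h).comp (C u * X + C v) =
        C u⁻¹ * (h.comp (C u * X + C v) - C v) := by
      apply Polynomial.funext
      intro x
      simp only [eval_comp, eval_add, eval_mul, eval_C, eval_X, eval_sub]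
      field_simp; ring
    rw [this, ← RatFunc.algebraMap_C, ← RatFunc.algebraMap_X, ← map_pow, ← map_mul, ← map_mul]
    rcases hh with hh | hh
    · left; rw [hh]
    · right; rw [hh]

theorem normalize_poly (H : ℂ[X]) (d : ℕ) (hd : 2 ≤ d) (hdeg : H.natDegree = d) :
    ∃ u v : ℂ, u ≠ 0 ∧ (C u⁻¹ * (H.comp (C u * X + C v) - C v)).natDegree = d ∧
      (C u⁻¹ * (H.comp (C u * X + C v) - C v)).coeff d = 1 ∧
      (C u⁻¹ * (H.comp (C u * X + C v) - C v)).coeff (d - 1) = 0 := by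
  have hl : H.coeff d ≠ 0 := by
    rw [← hdeg]; apply leadingCoeff_ne_zero.2; rintro rfl; simp at hdeg; omega
  obtain ⟨u, hu⟩ := IsAlgClosed.exists_pow_nat_eq (H.coeff d)⁻¹ (n := d - 1) (by omega)
  have hu0 : u ≠ 0 := by
    rintro rfl
    rw [zero_pow (by omega)] at hu
    exact inv_ne_zero hl hu.symm
  set v := - H.coeff (d - 1) / (d * H.coeff d) with hv
  have hcomp : H.comp (C u * X + C v) = (taylor v H).comp (C u * X) := by
    rw [taylor_apply, comp_assoc]; simp
  have hco : ∀ k, 1 ≤ k → (C u⁻¹ * (H.comp (C u * X + C v) - C v)).coeff k =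
      u⁻¹ * ((taylor v H).coeff k * u ^ k) := by
    intro k hk
    rw [coeff_C_mul, hcomp, coeff_sub, comp_C_mul_X_coeff, coeff_C, if_neg (by omega), sub_zero]
  have hup : u ^ d = u * (H.coeff d)⁻¹ := by
    rw [← hu, ← pow_succ']; congr 1; omega
  have htd : (taylor v H).natDegree = d := by rw [natDegree_taylor, hdeg]
  have ht1 : (taylor v H).coeff d = H.coeff d := by
    have := leadingCoeff_taylor v H
    rwa [leadingCoeff, leadingCoeff, htd, hdeg] at this
  have hcd : (C u⁻¹ * (H.comp (C u * X + C v) - C v)).coeff d = 1 := by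
    rw [hco d (by omega), ht1, hup]
    field_simp
  refine ⟨u, v, hu0, ?_, hcd, ?_⟩
  · apply natDegree_eq_of_le_of_coeff_ne_zero _ (by rw [hcd]; exact one_ne_zero)
    rw [natDegree_le_iff_coeff_eq_zero]
    intro k hk
    rw [hco k (by omega), coeff_eq_zero_of_natDegree_lt (by omega)]; simp
  · rw [hco _ (by omega)]
    have : (taylor v H).coeff (d - 1) = 0 := by
      rw [taylor_coeff]
      have h1 : (hasseDeriv (d-1) H).natDegree ≤ 1 :=
        (natDegree_hasseDeriv_le H (d-1)).trans (by omega)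
      rw [eval_eq_sum_range' (n := 2) (by omega)]
      rw [Finset.sum_range_succ, Finset.sum_range_one, hasseDeriv_coeff, hasseDeriv_coeff]
      have h2 : (1 + (d - 1)) = d := by omega
      have h3 : d.choose (d - 1) = d := by
        rw [← Nat.choose_symm (by omega), show d - (d - 1) = 1 by omega, Nat.choose_one_right]
      rw [zero_add, h2, h3, Nat.choose_self, hv]
      have : (d : ℂ) ≠ 0 := by exact_mod_cast (by omega)
      field_simp
      simp
    rw [this]; simp

theorem partB (F G : ℂ[X]) (hcop : IsCoprime F G) (hdeg : G.natDegree + 1 < F.natDegree)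
    (hspec : ¬ IsSpecialRatFunc (algebraMap ℂ[X] (RatFunc ℂ) F / algebraMap ℂ[X] (RatFunc ℂ) G))
    (B : ℕ) : ∃ L : ℕ, 1 ≤ L ∧ ∀ (w : ℕ) (P : ℕ → ℂ[X]), (∀ i ≤ L, (P i).support.card ≤ B) →
      (∀ i < L, ∀ z : ℂ, z ≠ 0 → F.eval ((P i).eval z / z ^ w) =
        (P (i+1)).eval z / z ^ w * G.eval ((P i).eval z / z ^ w)) → ∃ k, P 0 = C k * X ^ w := by
  by_cases hG : G.natDegree = 0
  swap
  · refine ⟨2, by omega, fun w P _ hch => ?_⟩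
    exact partB2 F G hcop (by omega) hG w (P 0) (P 1) (P 2) (hch 0 (by omega)) (hch 1 (by omega))
  set d := F.natDegree with hd
  have hd2 : 2 ≤ d := by omega
  obtain ⟨g, hg⟩ : ∃ g, G = C g := ⟨_, eq_C_of_natDegree_eq_zero hG⟩
  have hg0 : g ≠ 0 := by
    rintro rfl
    rw [hg, C_0, isCoprime_zero_right] at hcop
    have := natDegree_eq_zero_of_isUnit hcop
    omega
  set H := C g⁻¹ * F with hH
  have hHd : H.natDegree = d := natDegree_C_mul (inv_ne_zero hg0)
  have hrat : algebraMap ℂ[X] (RatFunc ℂ) F / algebraMap ℂ[X] (RatFunc ℂ) G =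
      algebraMap ℂ[X] (RatFunc ℂ) H := by
    have : algebraMap ℂ[X] (RatFunc ℂ) (C g) ≠ 0 := by
      rw [Ne, map_eq_zero_iff _ (RatFunc.algebraMap_injective ℂ)]; simpa using hg0
    rw [hg, div_eq_iff this, ← map_mul, hH]
    congr 1
    rw [mul_right_comm, ← C_mul, inv_mul_cancel₀ hg0, C_1, one_mul]
  rw [hrat] at hspec
  obtain ⟨u, v, hu, n1, n2, n3⟩ := normalize_poly H d hd2 hHd
  set h := C u⁻¹ * (H.comp (C u * X + C v) - C v) with hh
  obtain ⟨j, hj⟩ := pow_unbounded_of_one_lt (B+1) (show 1 < d by omega)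
  obtain ⟨n, hn⟩ := pow_unbounded_of_one_lt ((B+1+3)^(B+1+1)) (show 1 < d by omega)
  refine ⟨n + j + 2, by omega, fun w P hP hch => ?_⟩
  by_contra hnc
  apply hspec
  let q : ℕ → ℂ → ℂ := fun i z => u⁻¹ * ((P i).eval z / z ^ w - v)
  have hq : ∀ i ≤ n + j + 2, LF (B+1) (q i) := by
    intro i hi
    have : LF B (fun z => (P i).eval z / z ^ w) := by
      refine ⟨w, P i, hP i hi, fun z hz => ?_⟩
      field_simp
    exact this.affine u⁻¹ v
  have hqc : ∀ i < n + j + 2, ∀ z, z ≠ 0 → h.eval (q i z) = q (i+1) z := by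
    intro i hi z hz
    have h1 := hch i hi z hz
    rw [hg, eval_C] at h1
    simp only [hh, hH, eval_mul, eval_C, eval_sub, eval_comp, eval_add, eval_X, q]
    have : u * (u⁻¹ * (eval z (P i) / z ^ w - v)) + v = eval z (P i) / z ^ w := by
      field_simp; ring
    rw [this, h1]
    field_simp
  have hq0 : ¬ ∃ k, ∀ z, z ≠ 0 → q 0 z = k := by
    rintro ⟨k, hk⟩
    apply hnc
    refine ⟨u * k + v, poly_eq_of_nonzero _ _ fun z hz => ?_⟩
    rw [← hk z hz]
    simp only [eval_mul, eval_C, eval_pow, eval_X, q]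
    field_simp; ring
  have fin : ∃ b b' b'' : ℂ, (∀ t, t ≠ 0 → h.eval (t + b / t) = t ^ d + b' / t ^ d) ∧
      (∀ t, t ≠ 0 → h.eval (t + b' / t) = t ^ d + b'' / t ^ d) := by
    obtain ⟨c, m, Y, hc, hm, hY, hYd, h0 | h0⟩ := (hq 0 (by omega)).extreme hq0
    · exact b3c h d hd2 n1 n2 n3 (B+1) n j hj.le hn q hq hqc c hc m hm Y hY hYd h0
    · exact b3c h d hd2 n1 n2 n3 (B+1) n j hj.le hn (fun i z => q i z⁻¹)
        (fun i hi => (hq i hi).inv) (fun i hi z hz => hqc i hi z⁻¹ (inv_ne_zero hz))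
        c hc m hm Y hY hYd h0
  obtain ⟨b, b', b'', f1, f2⟩ := fin
  obtain ⟨δ, ε, hδ, hε, hs⟩ := special_shape h d hd2 b b' b'' f1 f2
  have hcomp : C δ⁻¹ * h.comp (C δ * X) =
      C (u * δ)⁻¹ * (H.comp (C (u * δ) * X + C v) - C v) := by
    apply Polynomial.funext
    intro x
    simp only [hh, eval_comp, eval_add, eval_mul, eval_C, eval_X, eval_sub]
    rw [mul_inv, mul_assoc u δ x]; ring
  rw [hcomp] at hs
  exact special_of_poly H (u * δ) v ε d (mul_ne_zero hu hδ) hε hs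


def Nice (D : ℕ) (R : ℝ) (x : ℂ) : Prop :=
  IsIntegral ℤ ((D : ℂ) * x) ∧ ∀ σ : ℂ →+* ℂ, ‖σ x‖ ≤ R

theorem Nice.map {D : ℕ} {R : ℝ} {x : ℂ} (h : Nice D R x) (τ : ℂ →+* ℂ) : Nice D R (τ x) := by
  refine ⟨?_, fun σ => h.2 (σ.comp τ)⟩
  have := h.1.map τ.toIntAlgHom
  simpa using this

theorem nice_root_unity (x : ℂ) (n : ℕ) (hn : 0 < n) (hx : x ^ n = 1) : Nice 1 1 x := by
  constructor
  · rw [Nat.cast_one, one_mul]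
    exact IsIntegral.of_pow hn (by rw [hx]; exact isIntegral_one)
  · intro σ
    have : (σ x) ^ n = 1 := by rw [← map_pow, hx, map_one]
    exact (Complex.norm_eq_one_of_pow_eq_one this (by omega)).le

theorem house_exists (x : ℂ) (hx : IsAlgebraic ℚ x) : ∃ R : ℝ, ∀ σ : ℂ →+* ℂ, ‖σ x‖ ≤ R := by
  have hint := hx.isIntegral
  let S := (minpoly ℚ x).rootSet ℂ
  have hS : S.Finite := rootSet_finite _ _
  obtain ⟨R, hR⟩ := (hS.image (fun z => ‖z‖)).bddAbove
  refine ⟨R, fun σ => hR ⟨σ x, ?_, rfl⟩⟩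
  rw [mem_rootSet]
  refine ⟨minpoly.ne_zero hint, ?_⟩
  have : σ.toRatAlgHom (aeval x (minpoly ℚ x)) = 0 := by rw [minpoly.aeval, map_zero]
  rw [← aeval_algHom_apply] at this
  exact this

theorem den_exists (x : ℂ) (hx : IsAlgebraic ℚ x) : ∃ D : ℕ, 0 < D ∧ IsIntegral ℤ ((D:ℂ) * x) := by
  have hx' : IsAlgebraic ℤ x := (IsFractionRing.isAlgebraic_iff ℤ ℚ ℂ).2 hx
  obtain ⟨y, hy, h⟩ := hx'.exists_integral_multiple
  refine ⟨y.natAbs, Int.natAbs_pos.2 hy, ?_⟩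
  rcases Int.natAbs_eq y with h1 | h1
  · rw [h1] at h; simpa using h
  · rw [h1] at h
    have := h.neg
    simpa using this

theorem nice_exists (x : ℂ) (hx : IsAlgebraic ℚ x) : ∃ (D : ℕ) (R : ℝ), 0 < D ∧ Nice D R x := by
  obtain ⟨R, hR⟩ := house_exists x hx
  obtain ⟨D, hD, h⟩ := den_exists x hx
  exact ⟨D, R, hD, h, hR⟩

theorem Nice.mono {D D' : ℕ} {R R' : ℝ} {x : ℂ} (h : Nice D R x) (hD : D ∣ D') (hR : R ≤ R') :
    Nice D' R' x := by
  refine ⟨?_, fun σ => (h.2 σ).trans hR⟩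
  obtain ⟨k, rfl⟩ := hD
  push_cast
  rw [mul_comm (D:ℂ) k, mul_assoc]
  exact (isIntegral_natCast k).mul h.1


theorem nice_family {ι : Type} (s : Finset ι) (a : ι → ℂ) (ha : ∀ i ∈ s, IsAlgebraic ℚ (a i)) :
    ∃ (D : ℕ) (R : ℝ), 0 < D ∧ 0 < R ∧ ∀ i ∈ s, Nice D R (a i) := by
  classical
  induction s using Finset.induction_on with
  | empty => exact ⟨1, 1, one_pos, one_pos, by simp⟩
  | insert i s hi ih =>
    obtain ⟨D, R, hD, hR, h⟩ := ih (fun j hj => ha j (Finset.mem_insert_of_mem hj))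
    obtain ⟨D', R', hD', h'⟩ := nice_exists (a i) (ha i (Finset.mem_insert_self _ _))
    refine ⟨D * D', max R R', Nat.mul_pos hD hD', lt_max_of_lt_left hR, fun j hj => ?_⟩
    rcases Finset.mem_insert.1 hj with rfl | hj
    · exact h'.mono (dvd_mul_left _ _) (le_max_right _ _)
    · exact (h j hj).mono (dvd_mul_right _ _) (le_max_left _ _)

theorem integral_of_eq (x : ℂ) (d : ℕ) (c : ℕ → ℂ) (hc : ∀ k, IsIntegral ℤ (c k))
    (h : x ^ d = ∑ k ∈ Finset.range d, c k * x ^ k) : IsIntegral ℤ x := by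
  let O := integralClosure ℤ ℂ
  let c' : ℕ → O := fun k => ⟨c k, hc k⟩
  have h1 : IsIntegral O x := by
    refine ⟨X ^ d - ∑ k ∈ Finset.range d, C (c' k) * X ^ k, ?_, ?_⟩
    · apply monic_X_pow_sub
      refine (degree_sum_le _ _).trans_lt ((Finset.sup_lt_iff (WithBot.bot_lt_coe d)).2 ?_)
      intro k hk
      exact (degree_C_mul_X_pow_le _ _).trans_lt (WithBot.coe_lt_coe.2 (Finset.mem_range.1 hk))
    · rw [eval₂_sub, eval₂_finsetSum, eval₂_pow, eval₂_X, h, sub_eq_zero]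
      refine Finset.sum_congr rfl fun k hk => ?_
      rw [eval₂_mul, eval₂_C, eval₂_pow, eval₂_X]; rfl
  exact isIntegral_trans x h1

theorem house_of_eq (x y : ℂ) (d : ℕ) (hd : 2 ≤ d) (a b : ℕ → ℂ) (M R : ℝ) 
    (ha : ∀ k < d, ‖a k‖ ≤ M) (hb : ∀ k < d, ‖b k‖ ≤ M) (hR1 : 1 ≤ R) (hRM : 2 * d * M ≤ R)
    (hy : ‖y‖ ≤ R)
    (h : x ^ d = ∑ k ∈ Finset.range d, a k * x ^ k + y * ∑ k ∈ Finset.range (d-1), b k * x ^ k) :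
    ‖x‖ ≤ R := by
  by_contra hx
  push Not at hx
  have hx1 : 1 ≤ ‖x‖ := by linarith
  have hM : 0 ≤ M := (norm_nonneg _).trans (ha 0 (by omega))
  have h1 : ‖∑ k ∈ Finset.range d, a k * x ^ k‖ ≤ d * (M * ‖x‖ ^ (d-1)) := by
    refine (norm_sum_le_of_le (f := fun k => a k * x ^ k) (n := fun _ => M * ‖x‖ ^ (d-1)) _ fun k hk => ?_).trans (by simp)
    rw [Finset.mem_range] at hk
    rw [norm_mul, norm_pow]
    exact mul_le_mul (ha k hk) (pow_le_pow_right₀ hx1 (by omega)) (by positivity) hM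
  have h2 : ‖∑ k ∈ Finset.range (d-1), b k * x ^ k‖ ≤ d * (M * ‖x‖ ^ (d-2)) := by
    refine (norm_sum_le_of_le (f := fun k => b k * x ^ k) (n := fun _ => M * ‖x‖ ^ (d-2)) _ fun k hk => ?_).trans ?_
    · rw [Finset.mem_range] at hk
      rw [norm_mul, norm_pow]
      exact mul_le_mul (hb k (by omega)) (pow_le_pow_right₀ hx1 (by omega)) (by positivity) hM
    · rw [Finset.sum_const, Finset.card_range, nsmul_eq_mul]
      apply mul_le_mul_of_nonneg_right _ (by positivity)
      exact_mod_cast (Nat.sub_le d 1)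
  have h3 : ‖x‖ ^ d ≤ d * (M * ‖x‖ ^ (d-1)) + R * (d * (M * ‖x‖ ^ (d-2))) := by
    rw [← norm_pow, h]
    refine (norm_add_le _ _).trans (add_le_add h1 ?_)
    rw [norm_mul]
    exact mul_le_mul hy h2 (norm_nonneg _) (by linarith)
  obtain ⟨n, rfl⟩ : ∃ n, d = n + 2 := ⟨d - 2, by omega⟩
  simp only [Nat.add_sub_cancel, show n + 2 - 1 = n + 1 by omega] at h3
  have hp : 0 < ‖x‖ ^ n := by positivity
  have h4 : ‖x‖ ^ 2 ≤ ((n+2:ℕ):ℝ) * M * ‖x‖ + R * (((n+2:ℕ):ℝ) * M) := by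
    have : ‖x‖ ^ n * ‖x‖ ^ 2 ≤ ‖x‖ ^ n * (((n+2:ℕ):ℝ) * M * ‖x‖ + R * (((n+2:ℕ):ℝ) * M)) := by
      calc _ = ‖x‖ ^ (n+2) := by ring
        _ ≤ _ := h3
        _ = _ := by ring
    exact le_of_mul_le_mul_left this hp
  set A := ((n+2:ℕ):ℝ) * M
  have hA : 0 ≤ A := by positivity
  nlinarith

theorem nice_pullback (F G : ℂ[X]) (hdeg : G.natDegree + 1 < F.natDegree)
    (hF : ∀ k, IsAlgebraic ℚ (F.coeff k)) (hG : ∀ k, IsAlgebraic ℚ (G.coeff k)) :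
    ∃ (D : ℕ) (R : ℝ), 0 < D ∧ 1 ≤ R ∧
      ∀ x y : ℂ, F.eval x = y * G.eval x → Nice D R y → Nice D R x := by
  set d := F.natDegree with hd
  set l := F.coeff d with hl
  have hl0 : l ≠ 0 := by
    rw [hl, hd]; apply leadingCoeff_ne_zero.2; rintro rfl; simp at hd; omega
  have hli : IsAlgebraic ℚ l⁻¹ := (hF d).inv
  let a : ℕ → ℂ := fun k => - (l⁻¹ * F.coeff k)
  let b : ℕ → ℂ := fun k => l⁻¹ * G.coeff k
  obtain ⟨D1, R1, hD1, hR1, h1⟩ := nice_family (Finset.range d) a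
    (fun k _ => (hli.mul (hF k)).neg)
  obtain ⟨D2, R2, hD2, hR2, h2⟩ := nice_family (Finset.range d) b
    (fun k _ => (hli.mul (hG k)))
  set D := D1 * D2
  set M := max R1 R2
  have ha : ∀ k < d, Nice D M (a k) := fun k hk =>
    (h1 k (Finset.mem_range.2 hk)).mono (dvd_mul_right _ _) (le_max_left _ _)
  have hb : ∀ k < d, Nice D M (b k) := fun k hk =>
    (h2 k (Finset.mem_range.2 hk)).mono (dvd_mul_left _ _) (le_max_right _ _)
  have key : ∀ x y : ℂ, F.eval x = y * G.eval x →
      x ^ d = ∑ k ∈ Finset.range d, a k * x ^ k + y * ∑ k ∈ Finset.range (d-1), b k * x ^ k := by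
    intro x y h
    rw [eval_eq_sum_range, eval_eq_sum_range' (n := d - 1) (by omega), ← hd,
      Finset.sum_range_succ, ← hl] at h
    simp only [a, b, neg_mul, Finset.sum_neg_distrib, mul_assoc, ← Finset.mul_sum]
    field_simp
    linear_combination h
  refine ⟨D, max 1 (2 * d * M), Nat.mul_pos hD1 hD2, le_max_left _ _, fun x y h hy => ?_⟩
  have hk := key x y h
  constructor
  · let c : ℕ → ℂ := fun k => if k < d then (D * a k) * (D:ℂ) ^ (d - 1 - k) +
      (if k < d - 1 then (D * y) * ((D * b k) * (D:ℂ) ^ (d - 2 - k)) else 0) else 0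
    refine integral_of_eq _ d c (fun k => ?_) ?_
    · simp only [c]
      split_ifs with q1 q2
      · exact ((ha k q1).1.mul ((isIntegral_natCast D).pow _)).add
          (hy.1.mul ((hb k q1).1.mul ((isIntegral_natCast D).pow _)))
      · exact ((ha k q1).1.mul ((isIntegral_natCast D).pow _)).add isIntegral_zero
      · exact isIntegral_zero
    · have e1 : ∑ k ∈ Finset.range d, c k * (D * x) ^ k =
          ∑ k ∈ Finset.range d, (D:ℂ) ^ d * (a k * x ^ k) +
          ∑ k ∈ Finset.range d, if k < d - 1 then (D:ℂ) ^ d * (y * (b k * x ^ k)) else 0 := by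
        rw [← Finset.sum_add_distrib]
        refine Finset.sum_congr rfl fun k hk => ?_
        rw [Finset.mem_range] at hk
        simp only [c, if_pos hk]
        have e2 : (D:ℂ) ^ d = D * D ^ (d - 1 - k) * D ^ k := by
          rw [← pow_succ', ← pow_add]; congr 1; omega
        split_ifs with q2
        · have e3 : (D:ℂ) ^ d = D * D * D ^ (d - 2 - k) * D ^ k := by
            rw [← pow_two, ← pow_add, ← pow_add]; congr 1; omega
          rw [add_mul, e2]
          rw [e2] at e3
          congr 1
          · ring
          · rw [e3]; ring
        · rw [e2]; ring
      rw [e1, mul_pow, hk, mul_add, Finset.mul_sum]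
      congr 1
      rw [← Finset.sum_filter, Finset.mul_sum, Finset.mul_sum]
      apply Finset.sum_congr
      · ext k; simp; omega
      · intros; rfl
  · intro σ
    refine house_of_eq (σ x) (σ y) d (by omega) (fun k => σ (a k)) (fun k => σ (b k)) M _
      (fun k hk => (ha k hk).2 σ) (fun k hk => (hb k hk).2 σ) (le_max_left _ _) (le_max_right _ _)
      (hy.2 σ) ?_
    have := congrArg σ hk
    simpa [map_sum] using this


theorem conj_exists (k : Type) [Field k] [Algebra k ℂ] [Algebra ℚ k] [Algebra.IsAlgebraic ℚ k]
    (θ θ' : ℂ) (hθ : IsIntegral k θ) (h : aeval θ' (minpoly k θ) = 0) :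
    ∃ σ : ℂ →+* ℂ, (∀ x : k, σ (algebraMap k ℂ x) = algebraMap k ℂ x) ∧ σ θ = θ' := by
  let F := k⟮θ⟯
  have : IsScalarTower ℚ k ℂ := .of_algebraMap_eq (fun x => by simp)
  have : FiniteDimensional k F := IntermediateField.adjoin.finiteDimensional hθ
  have : Algebra.IsAlgebraic k F := Algebra.IsAlgebraic.of_finite k F
  have : IsScalarTower ℚ k F := .of_algebraMap_eq (fun x => by simp)
  have : Algebra.IsAlgebraic ℚ F := Algebra.IsAlgebraic.trans ℚ k F
  let pb := IntermediateField.adjoin.powerBasis hθ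
  have hg : pb.gen = IntermediateField.AdjoinSimple.gen k θ := rfl
  have hm : aeval θ' (minpoly k pb.gen) = 0 := by
    rw [hg, IntermediateField.minpoly_gen]; exact h
  let φ : F →ₐ[k] ℂ := pb.lift θ' hm
  obtain ⟨σ, hσ⟩ := ext_hom F φ.toRingHom
  refine ⟨σ, fun x => ?_, ?_⟩
  · have := hσ (algebraMap k F x)
    rw [← IsScalarTower.algebraMap_apply] at this
    rw [this]
    exact φ.commutes x
  · have := hσ pb.gen
    rw [show algebraMap F ℂ pb.gen = θ from rfl] at this
    rw [this]
    exact pb.lift_gen θ' hm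

theorem conj_prim (N : ℕ) (hN : 0 < N) (x y : ℂ) (hx : IsPrimitiveRoot x N)
    (hy : IsPrimitiveRoot y N) : ∃ σ : ℂ →+* ℂ, σ x = y := by
  obtain ⟨σ, -, h⟩ := conj_exists ℚ x y (hx.isIntegral hN).tower_top (by
    rw [← cyclotomic_eq_minpoly_rat hx hN, aeval_def, eval₂_eq_eval_map, map_cyclotomic]
    have : NeZero (N : ℂ) := ⟨by exact_mod_cast hN.ne'⟩
    exact (isRoot_cyclotomic_iff).2 hy)
  exact ⟨σ, h⟩

noncomputable def zr (N : ℕ) : ℂ := Complex.exp (2 * Real.pi * Complex.I / N)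

theorem zr_prim (N : ℕ) (hN : 0 < N) : IsPrimitiveRoot (zr N) N :=
  Complex.isPrimitiveRoot_exp N hN.ne'

noncomputable def Cy (N : ℕ) : IntermediateField ℚ ℂ := ℚ⟮zr N⟯

theorem zr_mem (N : ℕ) : zr N ∈ Cy N := IntermediateField.mem_adjoin_simple_self ℚ _

theorem mem_Cy (N : ℕ) (hN : 0 < N) (x : ℂ) (hx : x ^ N = 1) : x ∈ Cy N := by
  have : NeZero N := ⟨hN.ne'⟩
  obtain ⟨i, -, rfl⟩ := (zr_prim N hN).eq_pow_of_pow_eq_one hx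
  exact pow_mem (zr_mem N) _

theorem Cy_mono {N M : ℕ} (hM : 0 < M) (h : N ∣ M) : Cy N ≤ Cy M := by
  have hN : 0 < N := Nat.pos_of_dvd_of_pos h hM
  rw [Cy, IntermediateField.adjoin_simple_le_iff]
  apply mem_Cy M hM
  obtain ⟨k, rfl⟩ := h
  rw [pow_mul, (zr_prim N hN).pow_eq_one, one_pow]

theorem Cy_eq (N : ℕ) (hN : 0 < N) (x : ℂ) (hx : IsPrimitiveRoot x N) : Cy N = ℚ⟮x⟯ := by
  have : NeZero N := ⟨hN.ne'⟩
  apply le_antisymm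
  · rw [Cy, IntermediateField.adjoin_simple_le_iff]
    obtain ⟨i, -, h⟩ := hx.eq_pow_of_pow_eq_one (zr_prim N hN).pow_eq_one
    rw [← h]
    exact pow_mem (IntermediateField.mem_adjoin_simple_self ℚ _) _
  · rw [IntermediateField.adjoin_simple_le_iff]
    exact mem_Cy N hN x hx.pow_eq_one

theorem adj_aux {L : Type} [Field L] [Algebra ℚ L] {x' y : L} {N : ℕ} (h : x' ^ N = 1) (p : ℚ[X])
    (hp : y = aeval x' p) : y ∈ Algebra.adjoin ℚ {b : L | b ^ N = 1} := by
  rw [hp]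
  have h1 : ({x'} : Set L) ⊆ {b : L | b ^ N = 1} := by
    intro b hb
    rw [Set.mem_singleton_iff] at hb
    rw [hb]
    exact h
  have h2 : Algebra.adjoin ℚ ({x'} : Set L) ≤ Algebra.adjoin ℚ {b : L | b ^ N = 1} :=
    Algebra.adjoin_mono h1
  have h3 : aeval x' p ∈ Algebra.adjoin ℚ ({x'} : Set L) := aeval_mem_adjoin_singleton ℚ x'
  exact h2 h3

theorem integral_poly (N : ℕ) (hN : 0 < N) (x : ℂ) (hx : IsPrimitiveRoot x N) (a : ℂ)
    (ha : a ∈ Cy N) (hi : IsIntegral ℤ a) : ∃ P : ℤ[X], aeval x P = a := by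
  have : NeZero N := ⟨hN.ne'⟩
  rw [Cy_eq N hN x hx] at ha
  let x' : ℚ⟮x⟯ := IntermediateField.AdjoinSimple.gen ℚ x
  have hx' : IsPrimitiveRoot x' N := by
    refine IsPrimitiveRoot.of_map_of_injective (f := algebraMap ℚ⟮x⟯ ℂ) ?_ (algebraMap ℚ⟮x⟯ ℂ).injective
    exact hx
  have hint : IsIntegral ℚ x := (hx.isIntegral hN).tower_top
  have : IsCyclotomicExtension {N} ℚ ℚ⟮x⟯ := by
    rw [IsCyclotomicExtension.iff_singleton]
    refine ⟨⟨x', hx'⟩, fun y => ?_⟩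
    obtain ⟨p, hp⟩ := (IntermediateField.adjoin.powerBasis hint).exists_eq_aeval' y
    exact adj_aux hx'.pow_eq_one p hp
  have := IsCyclotomicExtension.Rat.isIntegralClosure_adjoin_singleton hx'
  have hi' : IsIntegral ℤ (⟨a, ha⟩ : ℚ⟮x⟯) := by
    rw [← isIntegral_algebraMap_iff (B := ℂ) (algebraMap ℚ⟮x⟯ ℂ).injective]
    exact hi
  obtain ⟨⟨y, hy⟩, hya⟩ := (IsIntegralClosure.isIntegral_iff (A := Algebra.adjoin ℤ {x'})).1 hi'
  rw [Algebra.adjoin_singleton_eq_range_aeval] at hy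
  obtain ⟨P, hP⟩ := hy
  refine ⟨P, ?_⟩
  have h1 : y = (⟨a, ha⟩ : ℚ⟮x⟯) := hya
  rw [← hP] at h1
  have h2 := congrArg (algebraMap ℚ⟮x⟯ ℂ) h1
  change algebraMap ℚ⟮x⟯ ℂ (aeval x' P) = a at h2
  rw [← aeval_algebraMap_apply] at h2
  exact h2

theorem amgm_prim (N : ℕ) (hN : 0 < N) (A : ℤ[X]) (x : ℂ) (hx : IsPrimitiveRoot x N)
    (hA : aeval x A ≠ 0) :
    (N.totient : ℝ) ≤ ∑ z ∈ primitiveRoots N ℂ, ‖aeval z A‖ ^ 2 := by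
  have hne : ∀ z ∈ primitiveRoots N ℂ, aeval z A ≠ 0 := by
    intro z hz h
    obtain ⟨σ, hσ⟩ := conj_prim N hN z x ((mem_primitiveRoots hN).1 hz) hx
    apply hA
    have := congrArg σ h
    rw [map_zero] at this
    rw [← hσ, ← this]
    exact aeval_algHom_apply σ.toIntAlgHom z A
  have hprod : ∃ n : ℤ, ∏ z ∈ primitiveRoots N ℂ, aeval z A = (n:ℂ) := by
    have h1 : (cyclotomic N ℂ).roots = (primitiveRoots N ℂ).1 := by
      have : NeZero (N:ℂ) := ⟨by exact_mod_cast hN.ne'⟩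
      rw [cyclotomic.roots_eq_primitiveRoots_val]
    have h2 := resultant_eq_prod_eval (cyclotomic N ℂ) (A.map (Int.castRingHom ℂ))
      A.natDegree (natDegree_map_le) (IsAlgClosed.splits _)
    rw [h1, (cyclotomic.monic N ℂ).leadingCoeff, one_pow, one_mul] at h2
    refine ⟨resultant (cyclotomic N ℤ) A, ?_⟩
    have h3 := resultant_map_map (cyclotomic N ℤ) A (cyclotomic N ℤ).natDegree A.natDegree
      (Int.castRingHom ℂ)
    rw [map_cyclotomic] at h3
    rw [natDegree_cyclotomic] at h2 h3
    rw [h3] at h2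
    simp only [eq_intCast] at h2
    rw [natDegree_cyclotomic, h2]
    rw [Finset.prod]
    simp only [aeval_def, eval₂_eq_eval_map]
    rfl
  obtain ⟨n, hn⟩ := hprod
  have hn0 : n ≠ 0 := by
    rintro rfl
    rw [Int.cast_zero, Finset.prod_eq_zero_iff] at hn
    obtain ⟨z, hz, h⟩ := hn
    exact hne z hz h
  have hnorm : 1 ≤ ∏ z ∈ primitiveRoots N ℂ, ‖aeval z A‖ ^ 2 := by
    rw [Finset.prod_pow, ← norm_prod, hn]
    apply one_le_pow₀
    rw [Complex.norm_intCast]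
    exact_mod_cast Int.one_le_abs hn0
  have hlog := Real.log_nonneg hnorm
  rw [Real.log_prod (fun z hz => pow_ne_zero _ (norm_ne_zero_iff.2 (hne z hz)))] at hlog
  rw [← Complex.card_primitiveRoots N, Finset.card_eq_sum_ones, Nat.cast_sum]
  have : ∀ z ∈ primitiveRoots N ℂ, 
      ((1:ℕ):ℝ) ≤ ‖aeval z A‖ ^ 2 - Real.log (‖aeval z A‖ ^ 2) := by
    intro z hz
    have := Real.log_le_sub_one_of_pos (x := ‖aeval z A‖ ^ 2)
      (by have := norm_pos_iff.2 (hne z hz); positivity)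
    push_cast; linarith
  have := Finset.sum_le_sum this
  rw [Finset.sum_sub_distrib] at this
  linarith


theorem decomp (q : ℕ) (hq : 0 < q) (P : ℤ[X]) : ∃ Γ : ℕ → ℤ[X], ∀ z : ℂ,
    aeval z P = ∑ i ∈ Finset.range q, z ^ i * aeval (z ^ q) (Γ i) := by
  induction P using Polynomial.induction_on' with
  | add P1 P2 h1 h2 =>
    obtain ⟨Γ1, h1⟩ := h1
    obtain ⟨Γ2, h2⟩ := h2
    refine ⟨fun i => Γ1 i + Γ2 i, fun z => ?_⟩
    simp only [map_add, mul_add, Finset.sum_add_distrib, h1, h2]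
  | monomial n a =>
    refine ⟨fun i => if i = n % q then monomial (n / q) a else 0, fun z => ?_⟩
    rw [Finset.sum_eq_single (n % q)]
    · simp only [if_true, aeval_monomial]
      rw [← pow_mul, mul_left_comm, ← pow_add, Nat.mod_add_div]
    · intro b _ hb
      simp [hb]
    · intro h
      exact absurd (Finset.mem_range.2 (Nat.mod_lt n hq)) h

theorem sum_pow_root (q : ℕ) (x : ℂ) (hx : x ^ q = 1) :
    ∑ j ∈ Finset.range q, x ^ j = if x = 1 then (q : ℂ) else 0 := by
  split_ifs with h
  · simp [h]
  · have := mul_geom_sum x q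
    rw [hx, sub_self] at this
    exact (mul_eq_zero.1 this).resolve_left (sub_ne_zero.2 h)

theorem parseval (q : ℕ) (hq : 0 < q) (e : ℂ) (he : IsPrimitiveRoot e q) (c : ℕ → ℂ) :
    ∑ j ∈ Finset.range q, ‖∑ i ∈ Finset.range q, c i * (e ^ j) ^ i‖ ^ 2
      = q * ∑ i ∈ Finset.range q, ‖c i‖ ^ 2 := by
  have hcast : ∀ x : ℂ, ((‖x‖ ^ 2 : ℝ) : ℂ) = x * (starRingEnd ℂ) x := by
    intro x; rw [Complex.mul_conj']; push_cast; rfl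
  apply Complex.ofReal_injective
  simp only [Complex.ofReal_sum, Complex.ofReal_mul, hcast, Complex.ofReal_natCast]
  have hce : (starRingEnd ℂ) e = e⁻¹ := by
    rw [Complex.inv_def, Complex.normSq_eq_norm_sq,
      Complex.norm_eq_one_of_pow_eq_one he.pow_eq_one hq.ne']
    simp
  have he0 : e ≠ 0 := he.ne_zero hq.ne'
  simp only [map_sum, map_mul, map_pow, hce, Finset.sum_mul_sum]
  rw [Finset.sum_comm, Finset.mul_sum]
  apply Finset.sum_congr rfl
  intro i hi
  rw [Finset.sum_comm]
  have key : ∀ k ∈ Finset.range q, ∑ j ∈ Finset.range q,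
      (c i * (e ^ j) ^ i * ((starRingEnd ℂ) (c k) * (e⁻¹ ^ j) ^ k))
      = if k = i then q * (c i * (starRingEnd ℂ) (c i)) else 0 := by
    intro k hk
    have h1 : ∀ j, c i * (e ^ j) ^ i * ((starRingEnd ℂ) (c k) * (e⁻¹ ^ j) ^ k)
        = (c i * (starRingEnd ℂ) (c k)) * (e ^ i * (e⁻¹) ^ k) ^ j := by
      intro j; rw [mul_pow, ← pow_mul, ← pow_mul, ← pow_mul, ← pow_mul, mul_comm j i, mul_comm j k]
      ring
    simp only [h1]
    rw [← Finset.mul_sum, sum_pow_root]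
    · have h2 : e ^ i * e⁻¹ ^ k = 1 ↔ k = i := by
        rw [inv_pow, ← div_eq_mul_inv, div_eq_one_iff_eq (pow_ne_zero _ he0)]
        constructor
        · intro h
          exact (he.pow_inj (Finset.mem_range.1 hi) (Finset.mem_range.1 hk) h).symm
        · rintro rfl; rfl
      simp only [h2]
      split_ifs with h
      · subst h; ring
      · ring
    · rw [mul_pow, ← pow_mul, ← pow_mul, mul_comm i, mul_comm k, pow_mul, pow_mul, inv_pow,
        he.pow_eq_one]
      simp
  rw [Finset.sum_congr rfl key, Finset.sum_ite_eq' (Finset.range q) i, if_pos hi]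

theorem norm_le_of_nice {D : ℕ} {R : ℝ} {a : ℂ} (h : Nice D R a) (N : ℕ) (hN : 0 < N)
    (P : ℤ[X]) (ζ : ℂ) (hζ : IsPrimitiveRoot ζ N) (hP : aeval ζ P = D * a) (z : ℂ)
    (hz : IsPrimitiveRoot z N) : ‖aeval z P‖ ^ 2 ≤ (D * R) ^ 2 := by
  obtain ⟨σ, hσ⟩ := conj_prim N hN ζ z hζ hz
  have h1 : aeval z P = D * σ a := by
    have := aeval_algHom_apply σ.toIntAlgHom ζ P
    rw [hP] at this
    have h2 : σ.toIntAlgHom ζ = z := hσ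
    rw [h2] at this
    rw [this]
    simp
  rw [h1, norm_mul]
  apply pow_le_pow_left₀ (by positivity)
  rw [Complex.norm_natCast]
  exact mul_le_mul_of_nonneg_left (h.2 σ) (by positivity)

theorem aeval_mem_Cy {N : ℕ} {x : ℂ} (hx : x ∈ Cy N) (P : ℤ[X]) : aeval x P ∈ Cy N := by
  rw [aeval_eq_sum_range]
  refine sum_mem fun i _ => ?_
  rw [zsmul_eq_mul]
  exact mul_mem (intCast_mem _ _) (pow_mem hx _)

theorem prim_shift (p s N' : ℕ) (hp : p.Prime) (hN' : 0 < N') (hpN : p ∣ N') (z : ℂ) (N'' : ℕ)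
    (hd : N' ∣ N'')
    (hz : IsPrimitiveRoot z (N' * p ^ s)) (l : ℕ) : IsPrimitiveRoot (z ^ (1 + N'' * l)) (N' * p ^ s) := by
  apply hz.pow_of_coprime
  have h1 : Nat.Coprime (1 + N'' * l) N' := by
    obtain ⟨k, rfl⟩ := hd
    rw [mul_assoc]
    simp
  exact Nat.Coprime.mul_right h1 ((h1.coprime_dvd_right hpN).pow_right s)

theorem cassels1 (p s N' : ℕ) (hp : p.Prime) (hN' : 0 < N') (hpN : p ∣ N') (ζ : ℂ)
    (hζ : IsPrimitiveRoot ζ (N' * p ^ s)) (D : ℕ) (R : ℝ) (hD : 0 < D) (hR : 0 < R) (a : ℂ)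
    (ha : a ∈ Cy (N' * p ^ s)) (hn : Nice D R a) :
    ∃ I ⊆ Finset.range (p ^ s), ∃ c : ℕ → ℂ, (∀ i, c i ∈ Cy N') ∧ a = ∑ i ∈ I, c i * ζ ^ i ∧
      (I.card : ℝ) < 2 * (D * R) ^ 2 := by
  have hq : 0 < p ^ s := pow_pos hp.pos s
  set q := p ^ s with hqdef
  have hN : 0 < N' * q := Nat.mul_pos hN' hq
  have haD : (D:ℂ) * a ∈ Cy (N' * q) := mul_mem (natCast_mem _ _) ha
  obtain ⟨P, hP⟩ := integral_poly (N' * q) hN ζ hζ _ haD hn.1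
  obtain ⟨Γ, hΓ⟩ := decomp q hq P
  have hζ' : ζ ^ q ∈ Cy N' := by
    apply mem_Cy N' hN'
    rw [← pow_mul, mul_comm, hζ.pow_eq_one]
  have hD0 : (D:ℂ) ≠ 0 := by exact_mod_cast hD.ne'
  classical
  let I := (Finset.range q).filter (fun i => aeval (ζ ^ q) (Γ i) ≠ 0)
  refine ⟨I, Finset.filter_subset _ _, fun i => aeval (ζ ^ q) (Γ i) / D, ?_, ?_, ?_⟩
  · intro i
    exact div_mem (aeval_mem_Cy hζ' _) (natCast_mem _ _)
  · have h1 : a = (aeval ζ P) / D := by rw [hP]; field_simp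
    rw [h1, hΓ, Finset.sum_div, Finset.sum_filter]
    apply Finset.sum_congr rfl
    intro i _
    split_ifs with h
    · ring
    · push Not at h; rw [h]; simp
  · have h1 : ∀ z ∈ primitiveRoots (N' * q) ℂ,
        ∑ i ∈ Finset.range q, ‖aeval (z ^ q) (Γ i)‖ ^ 2 ≤ (D * R) ^ 2 := by
      intro z hz
      rw [mem_primitiveRoots hN] at hz
      have hzn : ‖z‖ = 1 := Complex.norm_eq_one_of_pow_eq_one hz.pow_eq_one hN.ne'
      have he : IsPrimitiveRoot (z ^ N') q := hz.pow hN rfl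
      have hpa := parseval q hq (z ^ N') he (fun i => z ^ i * aeval (z ^ q) (Γ i))
      have h2 : ∀ j ∈ Finset.range q, ‖∑ i ∈ Finset.range q,
          (z ^ i * aeval (z ^ q) (Γ i)) * ((z ^ N') ^ j) ^ i‖ ^ 2 ≤ (D * R) ^ 2 := by
        intro j _
        have h3 := norm_le_of_nice hn (N' * q) hN P ζ hζ hP (z ^ (1 + N' * j))
          (prim_shift p s N' hp hN' hpN z N' dvd_rfl hz j)
        rw [hΓ] at h3
        convert h3 using 4 with i hi
        have : (z ^ (1 + N' * j)) ^ q = z ^ q := by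
          rw [pow_add, mul_pow, pow_one, ← pow_mul, mul_right_comm, pow_mul, hz.pow_eq_one, one_pow,
            mul_one]
        rw [this, pow_add, mul_pow, pow_mul, pow_one]
        ring
      have h4 := Finset.sum_le_sum h2
      rw [hpa, Finset.sum_const, Finset.card_range, nsmul_eq_mul] at h4
      have h5 := le_of_mul_le_mul_left h4 (by exact_mod_cast hq)
      simpa [norm_mul, norm_pow, hzn] using h5
    have h6 := Finset.sum_le_sum h1
    rw [Finset.sum_comm, Finset.sum_const, Complex.card_primitiveRoots, nsmul_eq_mul] at h6
    have h7 : ∑ i ∈ I, ((N' * q).totient : ℝ) ≤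
        ∑ i ∈ Finset.range q, ∑ z ∈ primitiveRoots (N' * q) ℂ, ‖aeval (z ^ q) (Γ i)‖ ^ 2 := by
      rw [Finset.sum_filter]
      apply Finset.sum_le_sum
      intro i _
      split_ifs with h
      · have := amgm_prim (N' * q) hN (expand ℤ q (Γ i)) ζ hζ (by rw [expand_aeval]; exact h)
        simpa only [expand_aeval] using this
      · positivity
    rw [Finset.sum_const, nsmul_eq_mul] at h7
    have h8 := h7.trans h6
    have h9 : (0:ℝ) < (N' * q).totient := by exact_mod_cast Nat.totient_pos.2 hN
    rw [mul_comm] at h8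
    have h10 := le_of_mul_le_mul_left h8 h9
    have : 0 < ((D:ℝ) * R) ^ 2 := by positivity
    linarith


theorem sum_sub_sq (p : ℕ) (γ : ℕ → ℂ) :
    ∑ i ∈ Finset.range p, ∑ k ∈ Finset.range p, ‖γ i - γ k‖ ^ 2
      = 2 * (p * ∑ i ∈ Finset.range p, ‖γ i‖ ^ 2) - 2 * ‖∑ i ∈ Finset.range p, γ i‖ ^ 2 := by
  have h1 : ‖∑ i ∈ Finset.range p, γ i‖ ^ 2
      = ∑ i ∈ Finset.range p, ∑ k ∈ Finset.range p, inner ℝ (γ i) (γ k) := by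
    rw [← real_inner_self_eq_norm_sq, sum_inner]
    simp only [inner_sum]
  rw [h1]
  simp only [norm_sub_sq_real, Finset.sum_add_distrib, Finset.sum_sub_distrib, Finset.sum_const,
    Finset.card_range, nsmul_eq_mul, ← Finset.mul_sum]
  ring

theorem parseval2 (p : ℕ) (hp : p.Prime) (e : ℂ) (he : IsPrimitiveRoot e p) (γ : ℕ → ℂ) (B : ℝ)
    (h : ∀ j ∈ Finset.Ico 1 p, ‖∑ i ∈ Finset.range p, γ i * (e ^ j) ^ i‖ ^ 2 ≤ B) :
    ∑ i ∈ Finset.range p, ∑ k ∈ Finset.range p, ‖γ i - γ k‖ ^ 2 ≤ 2 * ((p - 1) * B) := by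
  rw [sum_sub_sq, ← parseval p hp.pos e he, Finset.range_eq_Ico, Finset.sum_eq_sum_Ico_succ_bot hp.pos]
  have h1 := Finset.sum_le_sum h
  rw [Finset.sum_const, Nat.card_Ico, nsmul_eq_mul, Nat.cast_sub hp.one_lt.le] at h1
  simp only [pow_zero, one_pow, mul_one]
  push_cast at h1
  rw [← Finset.range_eq_Ico] at *
  rw [zero_add]
  linarith

theorem prim_mul (p N' : ℕ) (hpN : Nat.Coprime N' p) (y ω : ℂ)
    (hy : IsPrimitiveRoot y N') (hω : IsPrimitiveRoot ω p) : IsPrimitiveRoot (y * ω) (N' * p) := by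
  rw [IsPrimitiveRoot.iff_orderOf] at *
  rw [(Commute.all y ω).orderOf_mul_eq_mul_orderOf_of_coprime (by rw [hy, hω]; exact hpN), hy, hω]

theorem cassels2 (p N' : ℕ) (hp : p.Prime) (hN' : 0 < N') (hpN : ¬ p ∣ N') (ω : ℂ)
    (hω : IsPrimitiveRoot ω p) (D : ℕ) (R : ℝ) (hD : 0 < D) (hR : 0 < R) (a : ℂ)
    (ha : a ∈ Cy (N' * p)) (hn : Nice D R a) :
    ∃ I ⊆ Finset.range p, ∃ c : ℕ → ℂ, (∀ i, c i ∈ Cy N') ∧ a = ∑ i ∈ I, c i * ω ^ i ∧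
      (I.card : ℝ) < 2 * (D * R) ^ 2 := by
  have hN : 0 < N' * p := Nat.mul_pos hN' hp.pos
  have hcop : Nat.Coprime N' p := ((Nat.Prime.coprime_iff_not_dvd hp).2 hpN).symm
  have haD : (D:ℂ) * a ∈ Cy (N' * p) := mul_mem (natCast_mem _ _) ha
  set y := zr N' with hydef
  have hy : IsPrimitiveRoot y N' := zr_prim N' hN'
  have hζ := prim_mul p N' hcop y ω hy hω
  obtain ⟨P, hP⟩ := integral_poly (N' * p) hN _ hζ _ haD hn.1
  obtain ⟨Γ, hΓ⟩ := decomp p hp.pos P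
  have hD0 : (D:ℂ) ≠ 0 := by exact_mod_cast hD.ne'
  let A : ℕ → ℤ[X] := fun i => X ^ i * expand ℤ p (Γ i)
  have hA : ∀ (z e : ℂ), e ^ p = 1 → aeval (z * e) P = ∑ i ∈ Finset.range p, aeval z (A i) * e ^ i := by
    intro z e he
    rw [hΓ]
    apply Finset.sum_congr rfl
    intro i _
    simp only [A, map_mul, map_pow, aeval_X, expand_aeval, mul_pow, he, mul_one]
    ring
  classical
  have hsum : ∀ z ∈ primitiveRoots N' ℂ, ∑ i ∈ Finset.range p, ∑ k ∈ Finset.range p,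
      ‖aeval z (A i - A k)‖ ^ 2 ≤ 2 * ((p - 1) * (D * R) ^ 2) := by
    intro z hz
    rw [mem_primitiveRoots hN'] at hz
    have := parseval2 p hp ω hω (fun i => aeval z (A i)) ((D * R) ^ 2) (by
      intro j hj
      rw [Finset.mem_Ico] at hj
      have hj' : IsPrimitiveRoot (ω ^ j) p := hω.pow_of_coprime j
        ((Nat.Prime.coprime_iff_not_dvd hp).2 (Nat.not_dvd_of_pos_of_lt (by omega) hj.2)).symm
      rw [← hA z (ω ^ j) hj'.pow_eq_one]
      exact norm_le_of_nice hn (N' * p) hN P _ hζ hP _ (prim_mul p N' hcop z _ hz hj'))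
    simpa only [map_sub] using this
  have h1 := Finset.sum_le_sum hsum
  rw [Finset.sum_comm, Finset.sum_const, Complex.card_primitiveRoots, nsmul_eq_mul] at h1
  let I : ℕ → Finset ℕ := fun k => (Finset.range p).filter (fun i => aeval y (A i - A k) ≠ 0)
  have h2 : ∑ k ∈ Finset.range p, ((I k).card * (N'.totient : ℝ)) ≤
      ∑ x ∈ Finset.range p, ∑ z ∈ primitiveRoots N' ℂ, ∑ k ∈ Finset.range p,
        ‖aeval z (A x - A k)‖ ^ 2 := by
    apply Finset.sum_le_sum
    intro k _
    rw [Finset.sum_comm, ← nsmul_eq_mul, ← Finset.sum_const, Finset.sum_filter]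
    apply Finset.sum_le_sum
    intro i _
    split_ifs with h
    · have := amgm_prim N' hN' (A i - A k) y hy h
      refine this.trans (le_of_eq ?_)
      apply Finset.sum_congr rfl
      intro z _
      rw [map_sub, map_sub, norm_sub_rev]
    · positivity
  have h3 := h2.trans h1
  have htot : (0:ℝ) < N'.totient := by exact_mod_cast Nat.totient_pos.2 hN'
  rw [← Finset.sum_mul, mul_comm] at h3
  have h4 := le_of_mul_le_mul_left h3 htot
  have hDR : 0 < ((D:ℝ) * R) ^ 2 := by positivity
  have h5 : ∃ k ∈ Finset.range p, ((I k).card : ℝ) < 2 * (D * R) ^ 2 := by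
    by_contra hcon
    push Not at hcon
    have := Finset.sum_le_sum hcon
    rw [Finset.sum_const, Finset.card_range, nsmul_eq_mul] at this
    nlinarith
  obtain ⟨k, hk, hlt⟩ := h5
  refine ⟨I k, Finset.filter_subset _ _, fun i => aeval y (A i - A k) / D, ?_, ?_, hlt⟩
  · intro i
    exact div_mem (aeval_mem_Cy (zr_mem N') _) (natCast_mem _ _)
  · have h6 : a = (aeval (y * ω) P) / D := by rw [hP]; field_simp
    have h7 : ∑ i ∈ Finset.range p, ω ^ i = 0 := hω.geom_sum_eq_zero hp.one_lt
    have h8 : ∑ i ∈ Finset.range p, aeval y (A i) * ω ^ i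
        = ∑ i ∈ Finset.range p, aeval y (A i - A k) * ω ^ i := by
      simp only [map_sub, sub_mul, Finset.sum_sub_distrib, ← Finset.mul_sum, h7, mul_zero, sub_zero]
    rw [h6, hA _ _ hω.pow_eq_one, h8, Finset.sum_div, Finset.sum_filter]
    apply Finset.sum_congr rfl
    intro i _
    split_ifs with h
    · ring
    · push Not at h; rw [h]; simp


def Indep (S : Set ℂ) (t : ℂ) (D : ℕ) : Prop :=
  ∀ P : ℂ[X], (∀ k, P.coeff k ∈ S) → P.natDegree ≤ D → P.eval t = 0 → P = 0

theorem indep_of_conj (S : Set ℂ) (t : ℂ) (D : ℕ) (T : Finset ℂ) (hT : D < T.card)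
    (h : ∀ τ ∈ T, ∃ σ : ℂ →+* ℂ, (∀ x ∈ S, σ x = x) ∧ σ t = τ) : Indep S t D := by
  intro P hP hdeg h0
  apply eq_zero_of_natDegree_lt_card_of_eval_eq_zero' P T _ (by omega)
  intro τ hτ
  obtain ⟨σ, hσ, rfl⟩ := h τ hτ
  have h1 : P.map σ = P := by
    ext k
    rw [coeff_map, hσ _ (hP k)]
  rw [← h1, eval_map_apply, h0, map_zero]

theorem fix_Cy (N : ℕ) (hN : 0 < N) (x : ℂ) (hx : IsPrimitiveRoot x N) (σ : ℂ →+* ℂ)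
    (h : σ x = x) : ∀ y ∈ Cy N, σ y = y := by
  intro y hy
  rw [Cy_eq N hN x hx] at hy
  induction hy using IntermediateField.adjoin_induction with
  | mem y hy => rw [Set.mem_singleton_iff] at hy; rw [hy, h]
  | algebraMap r => exact σ.toRatAlgHom.commutes r
  | add a b _ _ ha hb => rw [map_add, ha, hb]
  | inv a _ ha => rw [map_inv₀, ha]
  | mul a b _ _ ha hb => rw [map_mul, ha, hb]

theorem dirichlet (q Q k : ℕ) (hq : 0 < q) (hQ : 0 < Q) (J : Finset ℕ) (hJ : J.card ≤ k) :
    ∃ j, 1 ≤ j ∧ j ≤ Q ^ k ∧ ∀ n ∈ J, ∃ m v : ℤ, (j:ℤ) * n = m + q * v ∧ |m| * Q ≤ q := by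
  classical
  let f : ℕ → (J → Fin Q) := fun j n => ⟨(j * n % q) * Q / q, by
    rw [Nat.div_lt_iff_lt_mul hq]
    have := Nat.mod_lt (j * n) hq
    rw [mul_comm Q q]
    exact Nat.mul_lt_mul_of_pos_right this hQ⟩
  have hcard : (Finset.univ : Finset (J → Fin Q)).card < (Finset.range (Q ^ k + 1)).card := by
    rw [Finset.card_univ, Fintype.card_fun, Fintype.card_fin, Fintype.card_coe, Finset.card_range]
    exact Nat.lt_succ_of_le (Nat.pow_le_pow_right hQ hJ)
  obtain ⟨j1, h1, j2, h2, hne, heq⟩ := Finset.exists_ne_map_eq_of_card_lt_of_maps_to hcard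
    (f := f) (fun _ _ => Finset.mem_univ _)
  wlog hlt : j1 < j2 generalizing j1 j2
  · exact this j2 h2 j1 h1 hne.symm heq.symm (by omega)
  rw [Finset.mem_range] at h1 h2
  refine ⟨j2 - j1, by omega, by omega, ?_⟩
  intro n hn
  refine ⟨((j2 * n % q : ℕ) : ℤ) - ((j1 * n % q : ℕ) : ℤ),
    ((j2 * n / q : ℕ) : ℤ) - ((j1 * n / q : ℕ) : ℤ), ?_, ?_⟩
  · have e1 : ((j1 * n % q : ℕ) : ℤ) + q * ((j1 * n / q : ℕ) : ℤ) = j1 * n := by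
      exact_mod_cast Nat.mod_add_div (j1 * n) q
    have e2 : ((j2 * n % q : ℕ) : ℤ) + q * ((j2 * n / q : ℕ) : ℤ) = j2 * n := by
      exact_mod_cast Nat.mod_add_div (j2 * n) q
    rw [Nat.cast_sub hlt.le]
    linarith
  · have h3 : (j1 * n % q) * Q / q = (j2 * n % q) * Q / q := by
      have := congrFun heq ⟨n, hn⟩
      exact congrArg Fin.val this
    set a := j1 * n % q
    set b := j2 * n % q
    have a1 := Nat.div_mul_le_self (a * Q) q
    have a2 := Nat.lt_div_mul_add hq (a := a * Q)
    have b1 := Nat.div_mul_le_self (b * Q) q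
    have b2 := Nat.lt_div_mul_add hq (a := b * Q)
    rw [h3] at a1 a2
    zify at a1 a2 b1 b2
    have hQ' : (0:ℤ) < Q := by exact_mod_cast hQ
    have : |((b:ℤ) - a) * Q| ≤ q := by
      rw [abs_le]; constructor <;> nlinarith
    rwa [abs_mul, abs_of_pos hQ'] at this

def RedOK (N N' : ℕ) (ζ : ℂ) (Λ k : ℕ) : Prop :=
  ∀ J : Finset ℕ, J.card ≤ k → ∃ (N'' : ℕ) (t : ℂ) (w : ℕ) (m : ℕ → ℤ) (c : ℕ → ℂ),
    N' ∣ N'' ∧ N'' ∣ N ∧ N'' < N ∧ t ≠ 0 ∧ t ∈ Cy N ∧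
    (∀ n ∈ J, c n ∈ Cy N'' ∧ ζ ^ n = c n * t ^ (m n) ∧ |m n| ≤ w) ∧ Indep (Cy N'') t (Λ * w)

theorem exists_inv (j q : ℕ) (hq : 0 < q) (h : Nat.Coprime j q) : ∃ (j' : ℕ) (l : ℤ),
    (j:ℤ) * j' = 1 + q * l ∧ Nat.Coprime j' q := by
  suffices ∃ (j' : ℕ) (l : ℤ), (j:ℤ) * j' = 1 + q * l by
    obtain ⟨j', l, h⟩ := this
    refine ⟨j', l, h, ?_⟩
    rw [← Nat.isCoprime_iff_coprime]
    exact ⟨j, -l, by linarith⟩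
  rcases Nat.lt_or_ge 1 q with h1 | h1
  · obtain ⟨j', -, hj⟩ := Nat.exists_mul_mod_eq_one_of_coprime h h1
    refine ⟨j', ((j * j' / q : ℕ) : ℤ), ?_⟩
    have := Nat.mod_add_div (j * j') q
    rw [hj] at this
    exact_mod_cast this.symm
  · obtain rfl : q = 1 := by omega
    exact ⟨1, j - 1, by push_cast; ring⟩

theorem wbound (Λ Q q w : ℕ) (hQ : Q = Λ + 2) (hq : 1 < q) (hw : w = q / Q) : Λ * w < q - 1 := by
  have h1 : w * Q ≤ q := by rw [hw]; exact Nat.div_mul_le_self q Q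
  rcases Nat.eq_zero_or_pos w with h | h
  · rw [h]; omega
  · subst hQ
    have : w * (Λ + 2) = Λ * w + 2 * w := by ring
    omega

theorem red2 (p N' : ℕ) (hp : p.Prime) (hN' : 0 < N') (hpN : ¬ p ∣ N') (ω : ℂ)
    (hω : IsPrimitiveRoot ω p) (Λ k : ℕ) (hk : (Λ + 2) ^ k < p) : RedOK (N' * p) N' ω Λ k := by
  intro J hJ
  have hN : 0 < N' * p := Nat.mul_pos hN' hp.pos
  have hcop : Nat.Coprime N' p := ((Nat.Prime.coprime_iff_not_dvd hp).2 hpN).symm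
  obtain ⟨j, hj1, hj2, hj⟩ := dirichlet p (Λ + 2) k hp.pos (by omega) J hJ
  have hjp : Nat.Coprime j p :=
    ((Nat.Prime.coprime_iff_not_dvd hp).2 (Nat.not_dvd_of_pos_of_lt (by omega) (by omega))).symm
  obtain ⟨j', l, hjj, hj'p⟩ := exists_inv j p hp.pos hjp
  choose! m v hmv hm using hj
  have ht : IsPrimitiveRoot (ω ^ j') p := hω.pow_of_coprime j' hj'p
  have hω0 : ω ≠ 0 := hω.ne_zero hp.ne_zero
  set t := ω ^ j' with htdef
  have ht0 : t ≠ 0 := ht.ne_zero hp.ne_zero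
  refine ⟨N', t, p / (Λ + 2), m, fun _ => 1, dvd_rfl, dvd_mul_right _ _, ?_, ht0,
    mem_Cy _ hN _ (by rw [mul_comm, pow_mul, ht.pow_eq_one, one_pow]), ?_, ?_⟩
  · exact lt_mul_of_one_lt_right hN' hp.one_lt
  · intro n hn
    refine ⟨one_mem _, ?_, ?_⟩
    · have e1 : (n:ℤ) = j' * m n + p * (j' * v n - l * n) := by
        have := hmv n hn
        linear_combination (j':ℤ) * this - (n:ℤ) * hjj
      rw [one_mul, htdef, ← zpow_natCast ω n, e1, zpow_add₀ hω0, zpow_mul, zpow_mul, zpow_natCast,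
        zpow_natCast, hω.pow_eq_one, one_zpow, mul_one]
    · have := hm n hn
      rw [Int.natCast_div]
      rw [Int.le_ediv_iff_mul_le (by positivity)]
      exact_mod_cast this
  · classical
    apply indep_of_conj _ _ _ ((Finset.Ico 1 p).image (fun i => t ^ i))
    · rw [Finset.card_image_of_injOn, Nat.card_Ico]
      · exact wbound Λ _ p _ rfl hp.one_lt rfl
      · intro a ha b hb hab
        simp only [Finset.coe_Ico, Set.mem_Ico] at ha hb
        exact ht.pow_inj ha.2 hb.2 hab
    · intro τ hτ
      rw [Finset.mem_image] at hτ
      obtain ⟨i, hi, rfl⟩ := hτ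
      rw [Finset.mem_Ico] at hi
      have hi' : IsPrimitiveRoot (t ^ i) p := ht.pow_of_coprime i
        ((Nat.Prime.coprime_iff_not_dvd hp).2 (Nat.not_dvd_of_pos_of_lt (by omega) hi.2)).symm
      have hy := zr_prim N' hN'
      set y := zr N' with hydef
      have hy0 : y ≠ 0 := hy.ne_zero hN'.ne'
      obtain ⟨σ, hσ⟩ := conj_prim (N' * p) hN _ _ (prim_mul p N' hcop y t hy ht)
        (prim_mul p N' hcop y _ hy hi')
      obtain ⟨p', l', hpp, -⟩ := exists_inv p N' hN' hcop.symm
      have hyp : y ^ (p * p') = y := by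
        rw [← zpow_natCast]; push_cast
        rw [hpp, zpow_add₀ hy0, zpow_mul, zpow_natCast, hy.pow_eq_one, one_zpow, mul_one, zpow_one]
      have hσy : σ y = y := by
        have e1 : (y * t) ^ (p * p') = y := by
          rw [mul_pow, hyp, pow_mul t, ht.pow_eq_one, one_pow, mul_one]
        have e2 : (y * t ^ i) ^ (p * p') = y := by
          rw [mul_pow, hyp, pow_mul (t ^ i), hi'.pow_eq_one, one_pow, mul_one]
        rw [← hσ, ← map_pow, e1] at e2
        exact e2
      refine ⟨σ, fix_Cy N' hN' y hy σ hσy, ?_⟩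
      rw [map_mul, hσy] at hσ
      exact mul_left_cancel₀ hy0 hσ

theorem red1 (p s N' : ℕ) (hp : p.Prime) (hN' : 0 < N') (hpN : p ∣ N') (ζ : ℂ)
    (hζ : IsPrimitiveRoot ζ (N' * p ^ s)) (Λ k : ℕ) (hk : (Λ + 2) ^ k < p ^ s) :
    RedOK (N' * p ^ s) N' ζ Λ k := by
  intro J hJ
  have hps := pow_pos hp.pos s
  have hN : 0 < N' * p ^ s := Nat.mul_pos hN' hps
  obtain ⟨j, hj1, hj2, hj⟩ := dirichlet (p ^ s) (Λ + 2) k hps (by omega) J hJ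
  obtain ⟨u, j₁, hpj, rfl⟩ := Nat.exists_eq_pow_mul_and_not_dvd (n := j) (by omega) p hp.ne_one
  have hus : u < s := by
    rw [← Nat.pow_lt_pow_iff_right hp.one_lt]
    have : 0 < j₁ := Nat.pos_of_ne_zero (by rintro rfl; simp at hpj)
    have := Nat.le_mul_of_pos_right (p ^ u) this
    omega
  obtain ⟨e, rfl⟩ := Nat.exists_eq_add_of_le hus.le
  have hpe : 0 < p ^ e := pow_pos hp.pos e
  have hpu : 0 < p ^ u := pow_pos hp.pos u
  have hpe1 : 1 < p ^ e := Nat.one_lt_pow (by omega) hp.one_lt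
  have hjp : Nat.Coprime j₁ (p ^ e) := ((Nat.Prime.coprime_iff_not_dvd hp).2 hpj).symm.pow_right e
  obtain ⟨j', l, hjj, hj'p⟩ := exists_inv j₁ (p ^ e) hpe hjp
  have hj2 : ∀ n ∈ J, ∃ m v : ℤ, (j₁:ℤ) * n = m + (p ^ e : ℕ) * v ∧ |m| * (Λ + 2 : ℕ) ≤ (p ^ e : ℕ) := by
    intro n hn
    obtain ⟨m, v, h1, h2⟩ := hj n hn
    have hpu' : (0:ℤ) < (p:ℤ) ^ u := by exact_mod_cast hpu
    refine ⟨j₁ * n - (p ^ e : ℕ) * v, v, by ring, ?_⟩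
    have h3 : m = (p:ℤ) ^ u * (j₁ * n - (p ^ e : ℕ) * v) := by
      push_cast at h1 ⊢
      rw [pow_add] at h1
      linear_combination -h1
    rw [h3, abs_mul, abs_of_pos hpu'] at h2
    rw [pow_add] at h2
    push_cast at h2 ⊢
    rw [mul_assoc] at h2
    exact le_of_mul_le_mul_left h2 hpu'
  choose! m v hmv hm using hj2
  have hζ0 : ζ ≠ 0 := hζ.ne_zero hN.ne'
  have hN'' : 0 < N' * p ^ u := Nat.mul_pos hN' hpu
  have hNe : N' * p ^ (u + e) = N' * p ^ u * p ^ e := by rw [pow_add, mul_assoc]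
  have hη : IsPrimitiveRoot (ζ ^ (p ^ e)) (N' * p ^ u) := hζ.pow hN (by rw [hNe, mul_comm])
  have he : IsPrimitiveRoot ((ζ ^ (N' * p ^ u)) ^ j') (p ^ e) :=
    (hζ.pow hN hNe).pow_of_coprime j' hj'p
  refine ⟨N' * p ^ u, ζ ^ j', p ^ e / (Λ + 2), m,
    fun n => (ζ ^ (p ^ e)) ^ (j' * v n - l * n), dvd_mul_right _ _, ?_, ?_, pow_ne_zero _ hζ0,
    pow_mem (mem_Cy _ hN _ hζ.pow_eq_one) _, ?_, ?_⟩
  · rw [hNe]; exact dvd_mul_right _ _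
  · rw [hNe]; exact lt_mul_of_one_lt_right hN'' hpe1
  · intro n hn
    refine ⟨zpow_mem (mem_Cy _ hN'' _ hη.pow_eq_one) _, ?_, ?_⟩
    · have e1 : (n:ℤ) = (p ^ e : ℕ) * (j' * v n - l * n) + j' * m n := by
        have := hmv n hn
        linear_combination (j':ℤ) * this - (n:ℤ) * hjj
      conv_lhs => rw [← zpow_natCast ζ n, e1]
      rw [zpow_add₀ hζ0, zpow_mul, zpow_mul, zpow_natCast, zpow_natCast]
    · have := hm n hn
      rw [Int.natCast_div]
      rw [Int.le_ediv_iff_mul_le (by positivity)]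
      exact_mod_cast this
  · classical
    apply indep_of_conj _ _ _ ((Finset.range (p ^ e)).image
      (fun i => ζ ^ j' * ((ζ ^ (N' * p ^ u)) ^ j') ^ i))
    · rw [Finset.card_image_of_injOn, Finset.card_range]
      · have := wbound Λ _ (p ^ e) _ rfl hpe1 rfl
        omega
      · intro a ha b hb hab
        simp only [Finset.coe_range, Set.mem_Iio] at ha hb
        exact he.pow_inj ha hb (mul_left_cancel₀ (pow_ne_zero _ hζ0) hab)
    · intro τ hτ
      rw [Finset.mem_image] at hτ
      obtain ⟨i, hi, rfl⟩ := hτ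
      obtain ⟨σ, hσ⟩ := conj_prim _ hN ζ _ hζ
        (prim_shift p (u + e) N' hp hN' hpN ζ (N' * p ^ u) (dvd_mul_right _ _) hζ i)
      refine ⟨σ, fix_Cy _ hN'' _ hη σ ?_, ?_⟩
      · rw [map_pow, hσ, pow_add, mul_pow, pow_one, ← pow_mul ζ (N' * p ^ u * i),
          mul_right_comm, ← hNe, pow_mul ζ _ i, hζ.pow_eq_one, one_pow, mul_one]
      · rw [map_pow, hσ, pow_add, mul_pow, pow_one, pow_mul ζ _ i, ← pow_mul, ← pow_mul, ← pow_mul,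
          ← pow_mul]
        congr 2
        ring


def CasOK (N N' : ℕ) (ζ : ℂ) : Prop :=
  ∀ (D : ℕ) (R : ℝ) (a : ℂ), 0 < D → 0 < R → a ∈ Cy N → Nice D R a →
    ∃ (I : Finset ℕ) (c : ℕ → ℂ), (∀ i, c i ∈ Cy N') ∧ a = ∑ i ∈ I, c i * ζ ^ i ∧
      (I.card : ℝ) < 2 * (D * R) ^ 2

theorem prime_drop (M0 N p a Λ k : ℕ) (hN : 0 < N) (hM : M0 ∣ N) (hp : p.Prime) (h1 : p ^ a ∣ N)
    (h2 : ¬ p ^ (a + 1) ∣ N) (hbig : ((Λ + 2) ^ k) ^ 2 * M0 < p ^ a) :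
    ∃ (N' : ℕ) (ζ : ℂ), M0 ∣ N' ∧ CasOK N N' ζ ∧ RedOK N N' ζ Λ k := by
  obtain ⟨u, rfl⟩ := h1
  have hu : ¬ p ∣ u := by
    rintro ⟨c, rfl⟩
    exact h2 ⟨c, by ring⟩
  have hu0 : 0 < u := Nat.pos_of_mul_pos_left hN
  have hM0 : 0 < M0 := Nat.pos_of_dvd_of_pos hM hN
  obtain ⟨v, u', hpu', rfl⟩ := Nat.exists_eq_pow_mul_and_not_dvd (n := M0) hM0.ne' p hp.ne_one
  have hu' : u' ∣ u := by
    have : u' ∣ p ^ a * u := (Dvd.intro_left _ rfl).trans hM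
    exact (Nat.Coprime.dvd_of_dvd_mul_left
      (((Nat.Prime.coprime_iff_not_dvd hp).2 hpu').symm.pow_right a) this)
  have hva : v ≤ a := by
    have : p ^ v ∣ p ^ a * u := (Dvd.intro _ rfl).trans hM
    have := (Nat.Coprime.dvd_of_dvd_mul_right
      (((Nat.Prime.coprime_iff_not_dvd hp).2 hu).pow_left v) this)
    exact (Nat.pow_dvd_pow_iff_le_right hp.one_lt).1 this
  set T := (Λ + 2) ^ k with hT
  have hT1 : 1 ≤ T := Nat.one_le_pow _ _ (by omega)
  have ha : 1 ≤ a := by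
    by_contra h
    obtain rfl : a = 0 := by omega
    rw [pow_zero] at hbig
    have : 0 < T ^ 2 * (p ^ v * u') := Nat.mul_pos (by positivity) hM0
    omega
  have hTT : T ≤ T ^ 2 := by nlinarith
  by_cases hc : a = 1 ∧ v = 0
  · obtain ⟨rfl, rfl⟩ := hc
    have hTp : T < p := by
      have : T ^ 2 ≤ T ^ 2 * (p ^ 0 * u') := Nat.le_mul_of_pos_right _ hM0
      rw [pow_one] at hbig
      omega
    rw [pow_one, mul_comm p u]
    have hω := zr_prim p hp.pos
    refine ⟨u, zr p, ?_, ?_, ?_⟩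
    · simpa using hu'
    · intro D R a hD hR haC hn
      obtain ⟨I, -, c, h⟩ := cassels2 p u hp hu0 hu _ hω D R hD hR a haC hn
      exact ⟨I, c, h⟩
    · exact red2 p u hp hu0 hu _ hω Λ k hTp
  · obtain ⟨a1, ha1, hva1, haa1, hprop⟩ : ∃ a1, 1 ≤ a1 ∧ v ≤ a1 ∧ a1 ≤ a ∧
        ((a1 = v) ∨ (a1 = 1 ∧ 2 ≤ a)) := by
      by_cases hv : 1 ≤ v
      · exact ⟨v, hv, le_rfl, hva, Or.inl rfl⟩
      · exact ⟨1, le_rfl, by omega, ha, Or.inr ⟨rfl, by omega⟩⟩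
    obtain ⟨s, rfl⟩ := Nat.exists_eq_add_of_le haa1
    have hTs : T < p ^ s := by
      rcases hprop with h | ⟨h, h'⟩
      · subst h
        rw [pow_add] at hbig
        have e1 : T * p ^ a1 ≤ T ^ 2 * (p ^ a1 * u') := by
          apply Nat.mul_le_mul hTT
          exact Nat.le_mul_of_pos_right _ (Nat.pos_of_mul_pos_left hM0)
        rw [mul_comm (p ^ a1) (p ^ s)] at hbig
        exact Nat.lt_of_mul_lt_mul_right (e1.trans_lt hbig)
      · subst h
        have e1 : T ^ 2 ≤ T ^ 2 * (p ^ v * u') := Nat.le_mul_of_pos_right _ hM0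
        have e2 : p ^ (1 + s) ≤ (p ^ s) ^ 2 := by
          rw [← pow_mul]
          exact Nat.pow_le_pow_right hp.pos (by omega)
        exact lt_of_pow_lt_pow_left₀ 2 (by positivity) (e1.trans_lt (hbig.trans_le e2))
    have hNe : p ^ (a1 + s) * u = (p ^ a1 * u) * p ^ s := by rw [pow_add]; ring
    rw [hNe]
    have hN' : 0 < p ^ a1 * u := Nat.mul_pos (pow_pos hp.pos _) hu0
    have hpN : p ∣ p ^ a1 * u := (dvd_pow_self p (by omega)).mul_right u
    have hζ := zr_prim (p ^ a1 * u * p ^ s) (Nat.mul_pos hN' (pow_pos hp.pos _))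
    refine ⟨p ^ a1 * u, _, Nat.mul_dvd_mul (pow_dvd_pow p hva1) hu', ?_,
      red1 p s _ hp hN' hpN _ hζ Λ k hTs⟩
    intro D R a hD hR haC hn
    obtain ⟨I, -, c, h⟩ := cassels1 p s _ hp hN' hpN _ hζ D R hD hR a haC hn
    exact ⟨I, c, h⟩


noncomputable def Qc : IntermediateField ℚ ℂ :=
  IntermediateField.adjoin ℚ {x : ℂ | ∃ n : ℕ, 0 < n ∧ x ^ n = 1}

theorem Cy_le_Qc (N : ℕ) (hN : 0 < N) : Cy N ≤ Qc := by
  rw [Cy, IntermediateField.adjoin_simple_le_iff]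
  exact IntermediateField.subset_adjoin _ _ ⟨N, hN, (zr_prim N hN).pow_eq_one⟩

theorem mem_Qc (x : ℂ) (hx : x ∈ Qc) : ∃ N, 0 < N ∧ x ∈ Cy N := by
  unfold Qc at hx
  induction hx using IntermediateField.adjoin_induction with
  | mem y hy => obtain ⟨n, hn, h⟩ := hy; exact ⟨n, hn, mem_Cy n hn y h⟩
  | algebraMap r => exact ⟨1, one_pos, (Cy 1).algebraMap_mem r⟩
  | add a b _ _ ha hb =>
    obtain ⟨n, hn, ha⟩ := ha
    obtain ⟨m, hm, hb⟩ := hb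
    have := Nat.mul_pos hn hm
    exact ⟨n * m, this, add_mem (Cy_mono this (dvd_mul_right _ _) ha) (Cy_mono this (dvd_mul_left _ _) hb)⟩
  | inv a _ ha => obtain ⟨n, hn, ha⟩ := ha; exact ⟨n, hn, inv_mem ha⟩
  | mul a b _ _ ha hb =>
    obtain ⟨n, hn, ha⟩ := ha
    obtain ⟨m, hm, hb⟩ := hb
    have := Nat.mul_pos hn hm
    exact ⟨n * m, this, mul_mem (Cy_mono this (dvd_mul_right _ _) ha) (Cy_mono this (dvd_mul_left _ _) hb)⟩

instance : Algebra.IsAlgebraic ℚ Qc := by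
  constructor
  intro x
  obtain ⟨N, hN, hx⟩ := mem_Qc x x.2
  have h1 : IsIntegral ℚ (zr N) := ((zr_prim N hN).isIntegral hN).tower_top
  have : FiniteDimensional ℚ ℚ⟮zr N⟯ := IntermediateField.adjoin.finiteDimensional h1
  have h2 : IsAlgebraic ℚ (⟨x, hx⟩ : Cy N) :=
    (Algebra.IsAlgebraic.of_finite ℚ ℚ⟮zr N⟯).isAlgebraic _
  have h3 : IsAlgebraic ℚ (x : ℂ) := h2.algebraMap (A := ℂ)
  exact (isAlgebraic_algebraMap_iff (algebraMap Qc ℂ).injective).1 h3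

noncomputable def SA (θ : ℂ) (N : ℕ) : IntermediateField (Cy N) ℂ := (Cy N)⟮θ⟯

noncomputable def rr (θ : ℂ) : ℕ := (minpoly Qc θ).natDegree

theorem theta_mem (θ : ℂ) (N : ℕ) : θ ∈ SA θ N := IntermediateField.mem_adjoin_simple_self _ _

theorem Cy_mem_SA (θ : ℂ) (N : ℕ) {x : ℂ} (hx : x ∈ Cy N) : x ∈ SA θ N :=
  (SA θ N).algebraMap_mem (⟨x, hx⟩ : Cy N)

theorem SA_poly (θ : ℂ) (hθ : IsAlgebraic ℚ θ) (N : ℕ) (x : ℂ) (hx : x ∈ SA θ N) :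
    ∃ P : (Cy N)[X], aeval θ P = x := by
  have h1 : IsIntegral (Cy N) θ := hθ.isIntegral.tower_top
  have h2 : x ∈ ((Cy N)⟮θ⟯).toSubalgebra := hx
  rw [IntermediateField.adjoin_simple_toSubalgebra_of_isAlgebraic h1.isAlgebraic,
    Algebra.adjoin_singleton_eq_range_aeval] at h2
  exact h2

theorem SA_mono (θ : ℂ) (hθ : IsAlgebraic ℚ θ) {N M : ℕ} (hM : 0 < M) (h : N ∣ M) {x : ℂ}
    (hx : x ∈ SA θ N) : x ∈ SA θ M := by
  obtain ⟨P, rfl⟩ := SA_poly θ hθ N x hx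
  rw [aeval_eq_sum_range]
  refine sum_mem fun i _ => ?_
  rw [Algebra.smul_def]
  exact mul_mem (Cy_mem_SA θ M (Cy_mono hM h (P.coeff i).2)) (pow_mem (theta_mem θ M) _)

theorem uniq (θ : ℂ) (a : ℕ → ℂ) (ha : ∀ j, a j ∈ Qc)
    (h : ∑ j ∈ Finset.range (rr θ), a j * θ ^ j = 0) : ∀ j < rr θ, a j = 0 := by
  have h1 := linearIndependent_pow (K := Qc) θ
  rw [Fintype.linearIndependent_iff] at h1
  intro j hj
  have h2 := h1 (fun i => ⟨a i, ha i⟩) (by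
    rw [← h, ← Fin.sum_univ_eq_sum_range (fun j => a j * θ ^ j)]
    rfl) ⟨j, hj⟩
  exact congrArg Subtype.val h2

theorem rr_pos (θ : ℂ) (hθ : IsAlgebraic ℚ θ) : 0 < rr θ :=
  minpoly.natDegree_pos hθ.isIntegral.tower_top

theorem finset_Qc (s : Finset ℂ) (h : ∀ x ∈ s, x ∈ Qc) : ∃ N, 0 < N ∧ ∀ x ∈ s, x ∈ Cy N := by
  classical
  induction s using Finset.induction_on with
  | empty => exact ⟨1, one_pos, by simp⟩
  | insert a s _ ih =>
    obtain ⟨N, hN, h1⟩ := ih (fun x hx => h x (Finset.mem_insert_of_mem hx))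
    obtain ⟨M, hM, h2⟩ := mem_Qc a (h a (Finset.mem_insert_self _ _))
    have := Nat.mul_pos hN hM
    refine ⟨N * M, this, fun x hx => ?_⟩
    rcases Finset.mem_insert.1 hx with rfl | hx
    · exact Cy_mono this (dvd_mul_left _ _) h2
    · exact Cy_mono this (dvd_mul_right _ _) (h1 x hx)

theorem exists_M0 (θ : ℂ) (hθ : IsAlgebraic ℚ θ) : ∃ M0, 0 < M0 ∧ ∀ N, 0 < N → M0 ∣ N →
    ∀ x ∈ SA θ N, ∃ a : ℕ → ℂ, (∀ j, a j ∈ Cy N) ∧ x = ∑ j ∈ Finset.range (rr θ), a j * θ ^ j := by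
  classical
  obtain ⟨M0, hM0, h⟩ := finset_Qc (((minpoly Qc θ).map (algebraMap Qc ℂ)).coeffs) (by
    intro x hx
    rw [mem_coeffs_iff] at hx
    obtain ⟨n, -, rfl⟩ := hx
    rw [coeff_map]
    exact ((minpoly Qc θ).coeff n).2)
  refine ⟨M0, hM0, fun N hN hd x hx => ?_⟩
  obtain ⟨P, rfl⟩ := SA_poly θ hθ N x hx
  have hint : IsIntegral Qc θ := hθ.isIntegral.tower_top
  set μ := (minpoly Qc θ).map (algebraMap Qc ℂ) with hμ
  have hmon : μ.Monic := (minpoly.monic hint).map _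
  have hdeg : μ.natDegree = rr θ := natDegree_map _
  have hl : μ ∈ lifts (algebraMap (Cy N) ℂ) := by
    rw [lifts_iff_coeff_lifts]
    intro n
    by_cases h0 : μ.coeff n = 0
    · rw [h0]; exact ⟨0, map_zero _⟩
    · exact ⟨⟨_, Cy_mono hN hd (h _ (coeff_mem_coeffs h0))⟩, rfl⟩
  obtain ⟨ν, hν, hνd, hνm⟩ := lifts_and_natDegree_eq_and_monic hl hmon
  have hν0 : aeval θ ν = 0 := by
    rw [aeval_def, eval₂_eq_eval_map, hν, hμ, ← eval₂_eq_eval_map, ← aeval_def, minpoly.aeval]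
  have h1 : aeval θ P = aeval θ (P %ₘ ν) := by
    conv_lhs => rw [← modByMonic_add_div P ν]
    simp [hν0]
  have hlt : (P %ₘ ν).natDegree < rr θ := by
    rw [← hdeg, ← hνd]
    apply natDegree_modByMonic_lt _ hνm
    rintro rfl
    rw [natDegree_one, hdeg] at hνd
    have := rr_pos θ hθ
    omega
  refine ⟨fun j => ((P %ₘ ν).coeff j : ℂ), fun j => ((P %ₘ ν).coeff j).2, ?_⟩
  rw [h1, aeval_eq_sum_range' hlt]
  rfl

theorem SA_inter_Qc (θ : ℂ) (hθ : IsAlgebraic ℚ θ) (N : ℕ) (hN : 0 < N) (x : ℂ) (hx : x ∈ Qc)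
    (a : ℕ → ℂ) (ha : ∀ j, a j ∈ Cy N) (h : x = ∑ j ∈ Finset.range (rr θ), a j * θ ^ j) :
    x ∈ Cy N := by
  have hr := rr_pos θ hθ
  have h1 := uniq θ (fun j => a j - if j = 0 then x else 0) (by
    intro j
    apply sub_mem (Cy_le_Qc N hN (ha j))
    split_ifs
    · exact hx
    · exact zero_mem _) (by
    simp only [sub_mul, Finset.sum_sub_distrib, ← h, ite_mul, zero_mul]
    rw [Finset.sum_ite_eq' , if_pos (Finset.mem_range.2 hr)]
    simp) 0 hr
  simp only [if_true] at h1
  rw [← sub_eq_zero.1 h1]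
  exact ha 0

theorem indep_SA (θ : ℂ) (N : ℕ) (hN : 0 < N) (t : ℂ) (ht : t ∈ Qc) (D : ℕ)
    (hS : ∀ x ∈ SA θ N, ∃ a : ℕ → ℂ, (∀ j, a j ∈ Cy N) ∧
      x = ∑ j ∈ Finset.range (rr θ), a j * θ ^ j)
    (h : Indep (Cy N) t D) : Indep (SA θ N) t D := by
  intro P hP hdeg h0
  choose a ha hPa using fun k => hS _ (hP k)
  have h1 : ∀ j < rr θ, ∑ k ∈ Finset.range (D + 1), a k j * t ^ k = 0 := by
    apply uniq θ (fun j => ∑ k ∈ Finset.range (D + 1), a k j * t ^ k)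
    · intro j
      exact sum_mem fun k _ => mul_mem (Cy_le_Qc N hN (ha k j)) (pow_mem ht _)
    · rw [← h0, eval_eq_sum_range' (Nat.lt_succ_of_le hdeg)]
      simp only [hPa, Finset.sum_mul]
      rw [Finset.sum_comm]
      apply Finset.sum_congr rfl
      intro k _
      apply Finset.sum_congr rfl
      intro j _
      ring
  have hcf : ∀ j k, (∑ k ∈ Finset.range (D + 1), C (a k j) * X ^ k : ℂ[X]).coeff k
      = if k < D + 1 then a k j else 0 := by
    intro j k
    simp [finsetSum_coeff, coeff_X_pow]
  have h2 : ∀ j < rr θ, ∀ k < D + 1, a k j = 0 := by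
    intro j hj k hk
    have := h (∑ k ∈ Finset.range (D + 1), C (a k j) * X ^ k) (by
      intro k
      rw [hcf]
      split_ifs
      · exact ha k j
      · exact zero_mem (Cy N)) (by
      rw [natDegree_le_iff_coeff_eq_zero]
      intro k hk
      rw [hcf, if_neg (by omega)]) (by
      rw [eval_finsetSum, ← h1 j hj]
      simp)
    have h3 := hcf j k
    rw [this, if_pos hk] at h3
    simpa using h3.symm
  ext k
  rw [coeff_zero]
  rcases Nat.lt_or_ge k (D + 1) with hk | hk
  · rw [hPa]
    apply Finset.sum_eq_zero
    intro j hj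
    rw [h2 j (Finset.mem_range.1 hj) k hk, zero_mul]
  · exact coeff_eq_zero_of_natDegree_lt (by omega)


theorem Nice.mul {D D' : ℕ} {R R' : ℝ} {x y : ℂ} (hx : Nice D R x) (hy : Nice D' R' y) :
    Nice (D * D') (R * R') (x * y) := by
  constructor
  · have := hx.1.mul hy.1
    have e : ((D * D' : ℕ) : ℂ) * (x * y) = D * x * (D' * y) := by push_cast; ring
    rw [e]; exact this
  · intro σ
    rw [map_mul, norm_mul]
    exact mul_le_mul (hx.2 σ) (hy.2 σ) (norm_nonneg _) ((norm_nonneg _).trans (hx.2 σ))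

theorem nice_sum {ι : Type} (s : Finset ι) (f : ι → ℂ) (D : ℕ) (R : ℝ) (h : ∀ i ∈ s, Nice D R (f i)) :
    Nice D (s.card * R) (∑ i ∈ s, f i) := by
  constructor
  · rw [Finset.mul_sum]
    exact IsIntegral.sum _ fun i hi => (h i hi).1
  · intro σ
    rw [map_sum]
    refine (norm_sum_le_of_le _ fun i hi => (h i hi).2 σ).trans ?_
    simp

theorem basis_alg (S : Finset ℂ) (hS : ∀ s ∈ S, IsAlgebraic ℚ s) (s : ℂ) (hs : s ∈ S) (j : ℕ) :
    IsAlgebraic ℚ ((Lagrange.basis S id s).coeff j) := by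
  let F := algebraicClosure ℚ ℂ
  have hmem : ∀ x : ℂ, IsAlgebraic ℚ x → x ∈ F := fun x hx => mem_algebraicClosure_iff.2 hx
  have h1 : Lagrange.basis S id s ∈ lifts (algebraMap F ℂ) := by
    unfold Lagrange.basis
    apply prod_mem
    intro t ht
    unfold Lagrange.basisDivisor
    have ht' := hS t (Finset.mem_of_mem_erase ht)
    apply mul_mem
    · exact C_mem_lifts (algebraMap F ℂ) (⟨_, inv_mem (sub_mem (hmem s (hS s hs)) (hmem t ht'))⟩ : F)
    · have : (X - C (id t) : ℂ[X]) = X + C (-t) := by simp [sub_eq_add_neg]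
      rw [this]
      exact add_mem (X_mem_lifts _) (C_mem_lifts (algebraMap F ℂ) (⟨_, neg_mem (hmem t ht')⟩ : F))
  rw [lifts_iff_coeff_lifts] at h1
  obtain ⟨y, hy⟩ := h1 j
  rw [← hy]
  exact mem_algebraicClosure_iff.1 y.2

theorem TR (θ : ℂ) (hθ : IsAlgebraic ℚ θ) : ∃ (Dt : ℕ) (Rt : ℝ), 0 < Dt ∧ 0 < Rt ∧
    ∀ a : ℕ → ℂ, (∀ j, a j ∈ Qc) → ∀ (D : ℕ) (R : ℝ),
      Nice D R (∑ j ∈ Finset.range (rr θ), a j * θ ^ j) →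
      ∀ j < rr θ, Nice (D * Dt) (R * Rt) (a j) := by
  classical
  have hint : IsIntegral Qc θ := hθ.isIntegral.tower_top
  set μ := (minpoly Qc θ).map (algebraMap Qc ℂ) with hμ
  have hdeg : μ.natDegree = rr θ := natDegree_map _
  have hμ0 : μ ≠ 0 := ((minpoly.monic hint).map _).ne_zero
  set S := μ.roots.toFinset with hS
  have hcard : S.card = rr θ := by
    have hsep : μ.Separable := ((minpoly.irreducible hint).separable).map
    rw [hS, Multiset.toFinset_card_of_nodup (nodup_roots hsep), ← hdeg]
    exact (splits_iff_card_roots.1 (IsAlgClosed.splits μ))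
  have hconj : ∀ s ∈ S, ∃ σ : ℂ →+* ℂ,
      (∀ x : Qc, σ (algebraMap Qc ℂ x) = algebraMap Qc ℂ x) ∧ σ θ = s := by
    intro s hs
    rw [hS, Multiset.mem_toFinset, mem_roots hμ0, IsRoot, hμ, ← eval₂_eq_eval_map, ← aeval_def] at hs
    exact conj_exists Qc θ s hint hs
  choose! σ hσ hσθ using hconj
  have hSalg : ∀ s ∈ S, IsAlgebraic ℚ s := by
    intro s hs
    rw [← hσθ s hs]
    exact hθ.algHom (σ s).toRatAlgHom
  obtain ⟨Dt, Rt, hDt, hRt, hnice⟩ := nice_family (S ×ˢ Finset.range (rr θ))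
    (fun x => (Lagrange.basis S id x.1).coeff x.2) (by
      rintro ⟨s, j⟩ hsj
      exact basis_alg S hSalg s (Finset.mem_product.1 hsj).1 j)
  have hr := rr_pos θ hθ
  refine ⟨Dt, rr θ * Rt, hDt, by positivity, ?_⟩
  intro a ha D R hn j hj
  let A : ℂ[X] := ∑ j ∈ Finset.range (rr θ), C (a j) * X ^ j
  have hAc : A.coeff j = a j := by
    simp only [A, finsetSum_coeff, coeff_C_mul, coeff_X_pow]
    simp [hj]
  have hAd : A.degree < S.card := by
    rw [hcard]
    refine (degree_sum_le _ _).trans_lt ((Finset.sup_lt_iff (WithBot.bot_lt_coe _)).2 ?_)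
    intro k hk
    exact (degree_C_mul_X_pow_le _ _).trans_lt (WithBot.coe_lt_coe.2 (Finset.mem_range.1 hk))
  have hAe : ∀ s ∈ S, A.eval s = σ s (∑ j ∈ Finset.range (rr θ), a j * θ ^ j) := by
    intro s hs
    simp only [A, eval_finsetSum, map_sum, map_mul, map_pow, hσθ s hs]
    apply Finset.sum_congr rfl
    intro k _
    have : σ s (a k) = a k := hσ s hs ⟨a k, ha k⟩
    rw [this]; simp
  have hL := Lagrange.eq_interpolate (v := id) (s := S) (f := A) (Set.injOn_id _) hAd
  rw [Lagrange.interpolate_apply] at hL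
  have h1 : a j = ∑ s ∈ S, A.eval s * (Lagrange.basis S id s).coeff j := by
    rw [← hAc]
    conv_lhs => rw [hL]
    simp [finsetSum_coeff]
  rw [h1]
  have h2 := nice_sum S (fun s => A.eval s * (Lagrange.basis S id s).coeff j) (D * Dt) (R * Rt) (by
    intro s hs
    apply Nice.mul
    · rw [hAe s hs]; exact hn.map _
    · exact hnice (s, j) (Finset.mem_product.2 ⟨hs, Finset.mem_range.2 hj⟩))
  rw [hcard] at h2
  convert h2 using 1
  ring

theorem SA_finite (θ : ℂ) (hθ : IsAlgebraic ℚ θ) (N : ℕ) (hN : 0 < N) (D : ℕ) (hD : 0 < D) (R : ℝ) :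
    {x : ℂ | x ∈ SA θ N ∧ Nice D R x}.Finite := by
  have h1 : IsIntegral ℚ (zr N) := ((zr_prim N hN).isIntegral hN).tower_top
  have i1 : FiniteDimensional ℚ (Cy N) := IntermediateField.adjoin.finiteDimensional h1
  have i2 : FiniteDimensional (Cy N) (SA θ N) :=
    IntermediateField.adjoin.finiteDimensional hθ.isIntegral.tower_top
  have i4 : FiniteDimensional ℚ (SA θ N) := FiniteDimensional.trans ℚ (Cy N) (SA θ N)
  have i5 : NumberField (SA θ N) := { to_finiteDimensional := i4 }
  have i6 : Algebra.IsAlgebraic ℚ (SA θ N) := Algebra.IsAlgebraic.of_finite _ _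
  have h2 := NumberField.Embeddings.finite_of_norm_le (SA θ N) ℂ (D * R)
  have h3 := h2.image (fun x : SA θ N => (x : ℂ) / D)
  refine h3.subset ?_
  rintro x ⟨hx, hn⟩
  have hD0 : (D:ℂ) ≠ 0 := by exact_mod_cast hD.ne'
  refine ⟨(D : SA θ N) * ⟨x, hx⟩, ⟨?_, ?_⟩, ?_⟩
  · rw [← isIntegral_algebraMap_iff (B := ℂ) (algebraMap (SA θ N) ℂ).injective]
    exact hn.1
  · intro φ
    obtain ⟨σ, hσ⟩ := ext_hom (SA θ N) φ
    rw [← hσ]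
    have : algebraMap (SA θ N) ℂ ((D : SA θ N) * ⟨x, hx⟩) = D * x := rfl
    rw [this, map_mul, map_natCast, norm_mul, Complex.norm_natCast]
    exact mul_le_mul_of_nonneg_left (hn.2 σ) (by positivity)
  · change ((D:ℂ) * x) / D = x
    field_simp


noncomputable def hom (F P : ℂ[X]) (w d n : ℕ) : ℂ[X] :=
  ∑ k ∈ Finset.range n, C (F.coeff k) * P ^ k * X ^ (w * (d - k))

theorem hom_eval (F P : ℂ[X]) (w d n : ℕ) (hF : F.natDegree < n) (hn : n ≤ d + 1) (z : ℂ)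
    (hz : z ≠ 0) : (hom F P w d n).eval z = z ^ (w * d) * F.eval (P.eval z / z ^ w) := by
  rw [hom, eval_finsetSum, eval_eq_sum_range' hF, Finset.mul_sum]
  apply Finset.sum_congr rfl
  intro k hk
  rw [Finset.mem_range] at hk
  obtain ⟨e, rfl⟩ := Nat.exists_eq_add_of_le (show k ≤ d by omega)
  have : z ^ w ≠ 0 := pow_ne_zero _ hz
  simp only [eval_mul, eval_C, eval_pow, eval_X, Nat.add_sub_cancel_left, mul_add, pow_add, pow_mul,
    div_pow]
  field_simp

theorem hom_natDegree (F P : ℂ[X]) (w d n : ℕ) (hP : P.natDegree ≤ 2 * w) (hn : n + 1 ≤ d + 1) :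
    (hom F P w d (n + 1)).natDegree ≤ w * d + w * n := by
  apply natDegree_sum_le_of_forall_le
  intro k hk
  rw [Finset.mem_range] at hk
  obtain ⟨e, rfl⟩ := Nat.exists_eq_add_of_le (show k ≤ d by omega)
  refine natDegree_mul_le.trans ?_
  have h1 : (C (F.coeff k) * P ^ k).natDegree ≤ k * (2 * w) :=
    (natDegree_C_mul_le _ _).trans (natDegree_pow_le_of_le k hP)
  have h2 : (X ^ (w * (k + e - k)) : ℂ[X]).natDegree = w * e := by simp
  rw [h2]
  have h3 : w * k ≤ w * n := Nat.mul_le_mul_left w (by omega)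
  calc _ ≤ k * (2 * w) + w * e := by omega
    _ = w * (k + e) + w * k := by ring
    _ ≤ _ := by omega

theorem coeff_closed (S : Subring ℂ) : ∃ S' : Subring ℂ[X], ∀ P, P ∈ S' ↔ ∀ k, P.coeff k ∈ S := by
  refine ⟨liftsRing S.subtype, fun P => ?_⟩
  rw [← lifts_iff_liftsRing, lifts_iff_coeff_lifts]
  constructor
  · intro h k
    obtain ⟨y, hy⟩ := h k
    rw [← hy]; exact y.2
  · intro h k
    exact ⟨⟨_, h k⟩, rfl⟩

theorem expand_one (θ : ℂ) (hθ : IsAlgebraic ℚ θ) (Dt : ℕ) (Rt : ℝ) (hDt : 0 < Dt) (hRt : 0 < Rt)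
    (hTR : ∀ a : ℕ → ℂ, (∀ j, a j ∈ Qc) → ∀ (D : ℕ) (R : ℝ),
      Nice D R (∑ j ∈ Finset.range (rr θ), a j * θ ^ j) →
      ∀ j < rr θ, Nice (D * Dt) (R * Rt) (a j))
    (D : ℕ) (R : ℝ) (hD : 0 < D) (hR : 0 < R) (b B : ℕ)
    (hb : 2 * (((D * Dt : ℕ) : ℝ) * (R * Rt)) ^ 2 ≤ b) (hB : rr θ * b ≤ B) (hB1 : 1 ≤ B)
    (N N' : ℕ) (hN : 0 < N) (ζ : ℂ) (hcas : CasOK N N' ζ)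
    (x : ℂ) (hx : Nice D R x) (a : ℕ → ℂ) (ha : ∀ j, a j ∈ Cy N)
    (hxa : x = ∑ j ∈ Finset.range (rr θ), a j * θ ^ j) :
    ∃ (I : Finset ℕ) (c : ℕ → ℂ), (∀ n, c n ∈ SA θ N') ∧ x = ∑ n ∈ I, c n * ζ ^ n ∧ I.card ≤ B ∧
      ((∃ n : ℕ, 0 < n ∧ x ^ n = 1) → I.card ≤ 1) := by
  classical
  by_cases hU : ∃ n : ℕ, 0 < n ∧ x ^ n = 1
  · obtain ⟨n, hn, hxn⟩ := hU
    have hxQ : x ∈ Qc := IntermediateField.subset_adjoin _ _ ⟨n, hn, hxn⟩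
    have hxC := SA_inter_Qc θ hθ N hN x hxQ a ha hxa
    obtain ⟨I, c, hc, hs, hI⟩ := hcas 1 1 x one_pos one_pos hxC (nice_root_unity x n hn hxn)
    have : I.card ≤ 1 := by
      have h2 : (I.card : ℝ) < ((2:ℕ):ℝ) := by
        norm_num at hI ⊢
        exact_mod_cast hI
      have := Nat.cast_lt.1 h2
      omega
    exact ⟨I, c, fun n => Cy_mem_SA θ N' (hc n), hs, by omega, fun _ => this⟩
  · have hnj := hTR a (fun j => Cy_le_Qc N hN (ha j)) D R (hxa ▸ hx)
    have h1 : ∀ j ∈ Finset.range (rr θ), ∃ (I : Finset ℕ) (c : ℕ → ℂ), (∀ i, c i ∈ Cy N') ∧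
        a j = ∑ i ∈ I, c i * ζ ^ i ∧ I.card ≤ b := by
      intro j hj
      obtain ⟨I, c, hc, hs, hI⟩ := hcas (D * Dt) (R * Rt) (a j) (Nat.mul_pos hD hDt) (by positivity)
        (ha j) (hnj j (Finset.mem_range.1 hj))
      refine ⟨I, c, hc, hs, ?_⟩
      exact_mod_cast (hI.le.trans hb)
    choose! I c hc hs hI using h1
    refine ⟨(Finset.range (rr θ)).biUnion I,
      fun n => ∑ j ∈ Finset.range (rr θ), if n ∈ I j then c j n * θ ^ j else 0, ?_, ?_, ?_,
      fun h => absurd h hU⟩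
    · intro n
      refine sum_mem fun j hj => ?_
      split_ifs
      · exact mul_mem (Cy_mem_SA θ N' (hc j hj n)) (pow_mem (theta_mem θ N') _)
      · exact zero_mem _
    · rw [hxa]
      simp only [Finset.sum_mul]
      rw [Finset.sum_comm]
      apply Finset.sum_congr rfl
      intro j hj
      conv_lhs => rw [hs j hj]
      simp only [ite_mul, zero_mul]
      rw [← Finset.sum_filter, Finset.sum_mul]
      have : ((Finset.range (rr θ)).biUnion I).filter (fun n => n ∈ I j) = I j := by
        ext n
        simp only [Finset.mem_filter, Finset.mem_biUnion]
        exact ⟨fun h => h.2, fun h => ⟨⟨j, hj, h⟩, h⟩⟩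
      rw [this]
      apply Finset.sum_congr rfl
      intro n _
      ring
    · have := Finset.card_biUnion_le_card_mul (Finset.range (rr θ)) I b hI
      rw [Finset.card_range] at this
      omega

theorem core (θ : ℂ) (hθ : IsAlgebraic ℚ θ) (M0 : ℕ)
    (hM0 : ∀ N, 0 < N → M0 ∣ N → ∀ x ∈ SA θ N, ∃ a : ℕ → ℂ, (∀ j, a j ∈ Cy N) ∧
      x = ∑ j ∈ Finset.range (rr θ), a j * θ ^ j)
    (F G : ℂ[X]) (hF : ∀ N k, F.coeff k ∈ SA θ N) (hG : ∀ N k, G.coeff k ∈ SA θ N)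
    (hdeg : G.natDegree + 1 < F.natDegree)
    (D : ℕ) (R : ℝ) (hD : 0 < D) (hR : 0 < R) : ∃ B : ℕ, ∀ L : ℕ, ∃ P0 : ℕ, ∀ N, 0 < N → M0 ∣ N →
    ∀ x : ℕ → ℂ, (∀ i ≤ L, x i ∈ SA θ N ∧ Nice D R (x i)) →
    (∀ i < L, F.eval (x i) = x (i + 1) * G.eval (x i)) →
    ∀ p a : ℕ, p.Prime → p ^ a ∣ N → ¬ p ^ (a + 1) ∣ N → P0 < p ^ a →
    ∃ (N'' w : ℕ) (P : ℕ → ℂ[X]), M0 ∣ N'' ∧ N'' ∣ N ∧ N'' < N ∧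
      (∀ i ≤ L, (P i).support.card ≤ B ∧
        ((∃ n : ℕ, 0 < n ∧ x i ^ n = 1) → (P i).support.card ≤ 1) ∧ (x i ≠ 0 → P i ≠ 0)) ∧
      (∀ i < L, ∀ z, z ≠ 0 → F.eval ((P i).eval z / z ^ w) =
        (P (i + 1)).eval z / z ^ w * G.eval ((P i).eval z / z ^ w)) ∧
      ∀ k, P 0 = C k * X ^ w → x 0 ∈ SA θ N'' := by
  classical
  obtain ⟨Dt, Rt, hDt, hRt, hTR⟩ := TR θ hθ
  obtain ⟨b, hb⟩ := exists_nat_ge (2 * (((D * Dt : ℕ) : ℝ) * (R * Rt)) ^ 2)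
  refine ⟨rr θ * b + 1, fun L => ?_⟩
  set B := rr θ * b + 1 with hB
  set d := F.natDegree with hd
  set Λ := 2 * d + 1 with hΛ
  refine ⟨((Λ + 2) ^ ((L + 1) * B)) ^ 2 * M0, ?_⟩
  intro N hN hMN x hx hchain p a hp hpa hpa' hbig
  obtain ⟨N', ζ, hMN', hcas, hred⟩ := prime_drop M0 N p a Λ ((L + 1) * B) hN hMN hp hpa hpa' hbig
  have h1 : ∀ i ∈ Finset.range (L + 1), ∃ (I : Finset ℕ) (c : ℕ → ℂ), (∀ n, c n ∈ SA θ N') ∧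
      x i = ∑ n ∈ I, c n * ζ ^ n ∧ I.card ≤ B ∧ ((∃ n : ℕ, 0 < n ∧ x i ^ n = 1) → I.card ≤ 1) := by
    intro i hi
    obtain ⟨hxS, hxn⟩ := hx i (by rw [Finset.mem_range] at hi; omega)
    obtain ⟨a, ha, hxa⟩ := hM0 N hN hMN _ hxS
    exact expand_one θ hθ Dt Rt hDt hRt hTR D R hD hR b B hb (by omega) (by omega) N N' hN ζ hcas
      _ hxn a ha hxa
  choose! I c hc hs hI hI1 using h1
  have hJ := Finset.card_biUnion_le_card_mul (Finset.range (L + 1)) I B hI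
  rw [Finset.card_range] at hJ
  obtain ⟨N'', t, w, m, e, hd1, hd2, hlt, ht0, htC, he, hind⟩ := hred _ hJ
  have hN'' : 0 < N'' := Nat.pos_of_dvd_of_pos hd2 hN
  have hMN'' : M0 ∣ N'' := hMN'.trans hd1
  have htQ : t ∈ Qc := Cy_le_Qc N hN htC
  have hind2 := indep_SA θ N'' hN'' t htQ _ (hM0 N'' hN'' hMN'') hind
  have hIJ : ∀ i ∈ Finset.range (L + 1), ∀ n ∈ I i, n ∈ (Finset.range (L + 1)).biUnion I :=
    fun i hi n hn => Finset.mem_biUnion.2 ⟨i, hi, hn⟩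
  let P : ℕ → ℂ[X] := fun i => ∑ n ∈ I i, C (c i n * e n) * X ^ (m n + w).toNat
  have htw : t ^ w ≠ 0 := pow_ne_zero _ ht0
  have hPcard : ∀ i, (P i).support.card ≤ (I i).card := by
    intro i
    refine le_trans (Finset.card_le_card ?_) (Finset.card_image_le (s := I i)
      (f := fun n => (m n + w).toNat))
    intro k hk
    rw [mem_support_iff] at hk
    by_contra hcon
    apply hk
    simp only [P, finsetSum_coeff, coeff_C_mul, coeff_X_pow]
    apply Finset.sum_eq_zero
    intro n hn
    rw [if_neg, mul_zero]
    rintro rfl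
    exact hcon (Finset.mem_image_of_mem _ hn)
  have hPdeg : ∀ i ∈ Finset.range (L + 1), (P i).natDegree ≤ 2 * w := by
    intro i hi
    apply natDegree_sum_le_of_forall_le
    intro n hn
    refine (natDegree_C_mul_X_pow_le _ _).trans ?_
    have := (abs_le.1 (he n (hIJ i hi n hn)).2.2)
    omega
  have hPev : ∀ i ∈ Finset.range (L + 1), (P i).eval t = x i * t ^ w := by
    intro i hi
    rw [hs i hi, Finset.sum_mul]
    simp only [P, eval_finsetSum, eval_mul, eval_C, eval_pow, eval_X]
    apply Finset.sum_congr rfl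
    intro n hn
    obtain ⟨-, h2, h3⟩ := he n (hIJ i hi n hn)
    rw [h2]
    have h4 : t ^ (m n + w).toNat = t ^ (m n) * t ^ w := by
      rw [← zpow_natCast, Int.toNat_of_nonneg (by have := (abs_le.1 h3); omega), zpow_add₀ ht0,
        zpow_natCast]
    rw [h4]; ring
  have hPS : ∀ i ∈ Finset.range (L + 1), ∀ k, (P i).coeff k ∈ SA θ N'' := by
    intro i hi k
    simp only [P, finsetSum_coeff, coeff_C_mul, coeff_X_pow]
    refine sum_mem fun n hn => ?_
    obtain ⟨h2, -, -⟩ := he n (hIJ i hi n hn)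
    refine mul_mem (mul_mem (SA_mono θ hθ hN'' hd1 (hc i hi n)) (Cy_mem_SA θ N'' h2)) ?_
    split_ifs
    · exact one_mem _
    · exact zero_mem _
  refine ⟨N'', w, P, hMN'', hd2, hlt, ?_, ?_, ?_⟩
  · intro i hi
    have hi' : i ∈ Finset.range (L + 1) := Finset.mem_range.2 (by omega)
    exact ⟨(hPcard i).trans (hI i hi'), fun hU => (hPcard i).trans (hI1 i hi' hU), fun h0 hP => by
      have h8 := hPev i hi'
      rw [hP, eval_zero] at h8
      exact mul_ne_zero h0 htw h8.symm⟩
  · intro i hi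
    have hi1 : i ∈ Finset.range (L + 1) := Finset.mem_range.2 (by omega)
    have hi2 : i + 1 ∈ Finset.range (L + 1) := Finset.mem_range.2 (by omega)
    obtain ⟨d', hd'⟩ : ∃ d', d = d' + 1 := ⟨d - 1, by omega⟩
    have hH : X ^ w * hom F (P i) w d (d + 1) - P (i + 1) * hom G (P i) w d (d' + 1) = 0 := by
      apply hind2
      · obtain ⟨S', hS'⟩ := coeff_closed (SA θ N'').toSubalgebra.toSubring
        have hX : (X : ℂ[X]) ∈ S' := by
          rw [hS']
          intro k
          rw [coeff_X]
          split_ifs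
          · exact one_mem (SA θ N'')
          · exact zero_mem (SA θ N'')
        have hC : ∀ c : ℂ, c ∈ SA θ N'' → C c ∈ S' := by
          intro c hc
          rw [hS']
          intro k
          rw [coeff_C]
          split_ifs
          · exact hc
          · exact zero_mem (SA θ N'')
        have hPi := (hS' (P i)).2 (hPS i hi1)
        have hPi1 := (hS' (P (i + 1))).2 (hPS (i + 1) hi2)
        apply (hS' _).1
        apply sub_mem
        · exact mul_mem (pow_mem hX _) (sum_mem fun k _ =>
            mul_mem (mul_mem (hC _ (hF N'' k)) (pow_mem hPi _)) (pow_mem hX _))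
        · exact mul_mem hPi1 (sum_mem fun k _ =>
            mul_mem (mul_mem (hC _ (hG N'' k)) (pow_mem hPi _)) (pow_mem hX _))
      · refine (natDegree_sub_le _ _).trans (max_le ?_ ?_)
        · refine natDegree_mul_le.trans ?_
          have := hom_natDegree F (P i) w d d (hPdeg i hi1) le_rfl
          rw [natDegree_X_pow]
          calc _ ≤ w + (w * d + w * d) := by omega
            _ = Λ * w := by rw [hΛ]; ring
        · refine natDegree_mul_le.trans ?_
          have h3 := hom_natDegree G (P i) w d d' (hPdeg i hi1) (by omega)
          have h4 := hPdeg _ hi2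
          calc _ ≤ 2 * w + (w * d + w * d') := by omega
            _ = Λ * w := by rw [hΛ, hd']; ring
      · rw [eval_sub, eval_mul, eval_mul, eval_pow, eval_X,
          hom_eval F _ w d _ (by omega) le_rfl t ht0, hom_eval G _ w d _ (by omega) (by omega) t ht0,
          hPev i hi1, hPev _ hi2, mul_div_assoc, div_self htw, mul_one, hchain i hi]
        ring
    intro z hz
    have h5 := congrArg (eval z) hH
    rw [eval_sub, eval_mul, eval_mul, eval_pow, eval_X,
          hom_eval F _ w d _ (by omega) le_rfl z hz, hom_eval G _ w d _ (by omega) (by omega) z hz,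
          eval_zero, sub_eq_zero] at h5
    have hzw : z ^ w ≠ 0 := pow_ne_zero _ hz
    have hzd : z ^ (w * d) ≠ 0 := pow_ne_zero _ hz
    apply mul_left_cancel₀ hzw
    apply mul_left_cancel₀ hzd
    rw [mul_left_comm, h5]
    field_simp
  · intro k hk
    have h0 : 0 ∈ Finset.range (L + 1) := Finset.mem_range.2 (by omega)
    have h6 := hPev 0 h0
    rw [hk, eval_mul, eval_C, eval_pow, eval_X] at h6
    have h7 := mul_right_cancel₀ htw h6
    rw [← h7]
    have := hPS 0 h0 w
    rw [hk] at this
    simpa using this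


theorem fin_min (θ : ℂ) (hθ : IsAlgebraic ℚ θ) (M0 : ℕ) (D : ℕ) (hD : 0 < D) (R : ℝ)
    (P0 : ℕ) (T : Set ℂ)
    (hT : ∀ x ∈ T, Nice D R x ∧ ∃ N, 0 < N ∧ M0 ∣ N ∧ x ∈ SA θ N)
    (hdrop : ∀ x ∈ T, ∀ N, 0 < N → M0 ∣ N → x ∈ SA θ N → ∀ p a : ℕ, p.Prime → p ^ a ∣ N →
      ¬ p ^ (a + 1) ∣ N → P0 < p ^ a → ∃ N'', M0 ∣ N'' ∧ N'' ∣ N ∧ N'' < N ∧ x ∈ SA θ N'') :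
    T.Finite := by
  classical
  apply (SA_finite θ hθ P0.factorial P0.factorial_pos D hD R).subset
  intro x hx
  obtain ⟨hn, hex⟩ := hT x hx
  refine ⟨?_, hn⟩
  obtain ⟨hN, hM, hxN⟩ := Nat.find_spec hex
  set N := Nat.find hex with hNdef
  refine SA_mono θ hθ P0.factorial_pos ?_ hxN
  rw [← Nat.factorization_le_iff_dvd hN.ne' P0.factorial_ne_zero]
  intro p
  by_cases hp : p.Prime
  · rw [← hp.pow_dvd_iff_le_factorization P0.factorial_ne_zero]
    apply Nat.dvd_factorial (pow_pos hp.pos _)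
    by_contra hcon
    push Not at hcon
    obtain ⟨N'', h1, h2, h3, h4⟩ := hdrop x hx N hN hM hxN p _ hp (Nat.ordProj_dvd N p)
      (Nat.pow_succ_factorization_not_dvd hN.ne' hp) hcon
    exact Nat.find_min hex h3 ⟨Nat.pos_of_dvd_of_pos h2 hN, h1, h4⟩
  · rw [Nat.factorization_eq_zero_of_not_prime _ hp]
    exact Nat.zero_le _

theorem pre_finite (F G : ℂ[X]) (hdeg : G.natDegree + 1 < F.natDegree) (Z : Set ℂ) (hZ : Z.Finite) :
    {x : ℂ | G.eval x ≠ 0 ∧ F.eval x / G.eval x ∈ Z}.Finite := by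
  have h : (⋃ y ∈ Z, {x | (F - C y * G).IsRoot x}).Finite := by
    apply hZ.biUnion
    intro y _
    apply Polynomial.finite_setOf_isRoot
    intro h0
    rw [sub_eq_zero] at h0
    have := natDegree_C_mul_le y G
    rw [← h0] at this
    omega
  apply h.subset
  rintro x ⟨hx, hy⟩
  simp only [Set.mem_iUnion, Set.mem_setOf_eq, IsRoot, eval_sub, eval_mul, eval_C]
  refine ⟨_, hy, ?_⟩
  field_simp
  ring

theorem eval_mem_SA (θ : ℂ) (N : ℕ) (F : ℂ[X]) (hF : ∀ k, F.coeff k ∈ SA θ N) (x : ℂ)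
    (hx : x ∈ SA θ N) : F.eval x ∈ SA θ N := by
  rw [eval_eq_sum_range]
  exact sum_mem fun i _ => mul_mem (hF i) (pow_mem hx _)

theorem iter_mem_SA (θ : ℂ) (N : ℕ) (F G : ℂ[X]) (hF : ∀ k, F.coeff k ∈ SA θ N)
    (hG : ∀ k, G.coeff k ∈ SA θ N) (n : ℕ) : ∀ (x : ℂ),
    x ∈ SA θ N → (fun x => F.eval x / G.eval x)^[n] x ∈ SA θ N := by
  induction n with
  | zero => intro x hx; exact hx
  | succ n ih =>
    intro x hx
    rw [Function.iterate_succ_apply]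
    exact ih _ (div_mem (eval_mem_SA θ N F hF x hx) (eval_mem_SA θ N G hG x hx))

theorem chain_nice (F G : ℂ[X]) (D : ℕ) (R : ℝ) (hR : 1 ≤ R)
    (hpull : ∀ x y : ℂ, F.eval x = y * G.eval x → Nice D R y → Nice D R x) (k : ℕ) :
    ∀ x : ℂ, (∀ n < k, G.eval ((fun x => F.eval x / G.eval x)^[n] x) ≠ 0) →
    (∃ m : ℕ, 0 < m ∧ ((fun x => F.eval x / G.eval x)^[k] x) ^ m = 1) →
    ∀ i ≤ k, Nice D R ((fun x => F.eval x / G.eval x)^[i] x) := by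
  induction k with
  | zero =>
    rintro x - ⟨m, hm, hx⟩ i hi
    obtain rfl : i = 0 := by omega
    exact (nice_root_unity _ m hm hx).mono (one_dvd _) hR
  | succ k ih =>
    rintro x hG hU i hi
    have h1 := ih (F.eval x / G.eval x) (fun n hn => by
      have := hG (n + 1) (by omega)
      rwa [Function.iterate_succ_apply] at this) (by
      obtain ⟨m, hm, hx⟩ := hU
      rw [Function.iterate_succ_apply] at hx
      exact ⟨m, hm, hx⟩)
    cases i with
    | zero =>
      have h0 := hG 0 (by omega)
      exact hpull _ _ (by
        simp only [Function.iterate_zero, id] at h0 ⊢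
        field_simp) (h1 0 (by omega))
    | succ i =>
      rw [Function.iterate_succ_apply]
      exact h1 i (by omega)

theorem final (θ : ℂ) (hθ : IsAlgebraic ℚ θ) (F G : ℂ[X]) (hF : ∀ N k, F.coeff k ∈ SA θ N)
    (hG : ∀ N k, G.coeff k ∈ SA θ N)
    (hFa : ∀ k, IsAlgebraic ℚ (F.coeff k)) (hGa : ∀ k, IsAlgebraic ℚ (G.coeff k))
    (hcop : IsCoprime F G) (hdeg : G.natDegree + 1 < F.natDegree)
    (hspec : ¬ IsSpecialRatFunc (algebraMap (Polynomial ℂ) (RatFunc ℂ) F /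
        algebraMap (Polynomial ℂ) (RatFunc ℂ) G))
    (hexc : ¬ (G.natDegree = 0 ∧ ∃ a, F = C F.leadingCoeff * (X - C a) ^ F.natDegree)) :
    {α : ℂ | (∃ N, 0 < N ∧ α ∈ SA θ N) ∧ ∃ k : ℕ, 1 ≤ k ∧
      (∀ n : ℕ, n < k → G.eval ((fun x : ℂ => F.eval x / G.eval x)^[n] α) ≠ 0) ∧
      ∃ m : ℕ, 0 < m ∧ ((fun x : ℂ => F.eval x / G.eval x)^[k] α) ^ m = 1}.Finite := by
  classical
  obtain ⟨M0, hM0p, hM0⟩ := exists_M0 θ hθ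
  obtain ⟨D, R, hD, hR, hpull⟩ := nice_pullback F G hdeg hFa hGa
  have hR0 : 0 < R := by linarith
  obtain ⟨B, hcore⟩ := core θ hθ M0 hM0 F G hF hG hdeg D R hD hR0
  have hnice := chain_nice F G D R hR hpull
  set h : ℂ → ℂ := fun x => F.eval x / G.eval x with hh
  have hM : ∀ x, (∃ N, 0 < N ∧ x ∈ SA θ N) → ∃ N, 0 < N ∧ M0 ∣ N ∧ x ∈ SA θ N := by
    rintro x ⟨N, hN, hx⟩
    exact ⟨N * M0, Nat.mul_pos hN hM0p, Dvd.intro_left _ rfl,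
      SA_mono θ hθ (Nat.mul_pos hN hM0p) (Dvd.intro _ rfl) hx⟩
  have hiter : ∀ N x n, x ∈ SA θ N → h^[n] x ∈ SA θ N := fun N x n hx =>
    iter_mem_SA θ N F G (hF N) (hG N) n x hx
  have hstep : ∀ x i, G.eval (h^[i] x) ≠ 0 → F.eval (h^[i] x) = h^[i+1] x * G.eval (h^[i] x) := by
    intro x i hx
    rw [Function.iterate_succ_apply', hh]
    simp only at hx ⊢
    rw [div_mul_cancel₀ _ hx]
  -- step 1
  have hZ : {x : ℂ | (∃ N, 0 < N ∧ x ∈ SA θ N) ∧ G.eval x ≠ 0 ∧ ∃ m : ℕ, 0 < m ∧ (h x) ^ m = 1}.Finite := by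
    obtain ⟨P0, hP0⟩ := hcore 1
    have hn1 : ∀ x, G.eval x ≠ 0 → (∃ m : ℕ, 0 < m ∧ (h x) ^ m = 1) → ∀ i ≤ 1, Nice D R (h^[i] x) := by
      intro x hGx hU
      apply hnice 1 x _ hU
      intro n hn
      obtain rfl : n = 0 := by omega
      exact hGx
    apply fin_min θ hθ M0 D hD R P0
    · rintro x ⟨hx, hGx, hU⟩
      exact ⟨hn1 x hGx hU 0 (by omega), hM x hx⟩
    · rintro x ⟨-, hGx, hU⟩ N hN hMN hx p a hp h1 h2 h3
      obtain ⟨N'', w, P, q1, q2, q3, q4, q5, q6⟩ := hP0 N hN hMN (fun i => h^[i] x)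
        (fun i hi => ⟨hiter N x i hx, hn1 x hGx hU i hi⟩)
        (fun i hi => by
          obtain rfl : i = 0 := by omega
          exact hstep x 0 hGx) p a hp h1 h2 h3
      refine ⟨N'', q1, q2, q3, ?_⟩
      obtain ⟨-, q7, q8⟩ := q4 1 le_rfl
      have q9 := q7 hU
      have q10 : P 1 ≠ 0 := by
        apply q8
        obtain ⟨m, hm, hx1⟩ := hU
        intro h0
        have h0' : h x = 0 := h0
        rw [h0', zero_pow hm.ne'] at hx1
        exact zero_ne_one hx1
      obtain ⟨n, c, hc⟩ := card_support_le_one_iff_monomial.1 q9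
      have hc0 : c ≠ 0 := by
        rintro rfl
        exact q10 (by rw [hc, monomial_zero_right])
      have := partB1 F G hcop (by omega) w (P 0) (fun z => (P 1).eval z / z ^ w) (by
        intro z hz
        simp only [hc, eval_monomial]
        exact div_ne_zero (mul_ne_zero hc0 (pow_ne_zero _ hz)) (pow_ne_zero _ hz))
        (q5 0 (by omega))
      rcases this with ⟨k, hk⟩ | h'
      · exact q6 k hk
      · exact absurd h' hexc
  -- step 2
  obtain ⟨L, hL1, hL⟩ := partB F G hcop hdeg hspec B
  have hA : {x : ℂ | (∃ N, 0 < N ∧ x ∈ SA θ N) ∧ ∃ k, L ≤ k ∧ (∀ n < k, G.eval (h^[n] x) ≠ 0) ∧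
      ∃ m : ℕ, 0 < m ∧ (h^[k] x) ^ m = 1}.Finite := by
    obtain ⟨P0, hP0⟩ := hcore L
    apply fin_min θ hθ M0 D hD R P0
    · rintro x ⟨hx, k, hk, hGx, hU⟩
      exact ⟨hnice k x hGx hU 0 (by omega), hM x hx⟩
    · rintro x ⟨-, k, hk, hGx, hU⟩ N hN hMN hx p a hp h1 h2 h3
      obtain ⟨N'', w, P, q1, q2, q3, q4, q5, q6⟩ := hP0 N hN hMN (fun i => h^[i] x)
        (fun i hi => ⟨hiter N x i hx, hnice k x hGx hU i (by omega)⟩)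
        (fun i hi => hstep x i (hGx i (by omega))) p a hp h1 h2 h3
      obtain ⟨c, hc⟩ := hL w P (fun i hi => (q4 i hi).1) q5
      exact ⟨N'', q1, q2, q3, q6 c hc⟩
  have hpre : ∀ k, {x : ℂ | (∀ n < k, G.eval (h^[n] x) ≠ 0) ∧ h^[k] x ∈
      {x : ℂ | (∃ N, 0 < N ∧ x ∈ SA θ N) ∧ G.eval x ≠ 0 ∧ ∃ m : ℕ, 0 < m ∧ (h x) ^ m = 1}}.Finite := by
    intro k
    induction k with
    | zero => exact hZ.subset fun x hx => hx.2
    | succ k ih =>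
      apply (pre_finite F G hdeg _ ih).subset
      rintro x ⟨h1, h2⟩
      refine ⟨h1 0 (by omega), ?_, ?_⟩
      · intro n hn
        have := h1 (n + 1) (by omega)
        rwa [Function.iterate_succ_apply] at this
      · rwa [Function.iterate_succ_apply] at h2
  apply (hA.union ((Finset.range L).finite_toSet.biUnion (fun k _ => hpre k))).subset
  rintro x ⟨⟨N, hN, hx⟩, k, hk, hGx, hU⟩
  by_cases hkL : L ≤ k
  · exact Or.inl ⟨⟨N, hN, hx⟩, k, hkL, hGx, hU⟩
  · right
    simp only [Set.mem_iUnion]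
    obtain ⟨j, rfl⟩ : ∃ j, k = j + 1 := ⟨k - 1, by omega⟩
    refine ⟨j, by simp; omega, fun n hn => hGx n (by omega), ⟨N, hN, hiter N x j hx⟩,
      hGx j (by omega), ?_⟩
    rwa [Function.iterate_succ_apply'] at hU


theorem exc_case
    (K : IntermediateField ℚ ℂ)
    (Kc : IntermediateField K ℂ)
    (hU : ∀ x : ℂ, (∃ n : ℕ, 0 < n ∧ x ^ n = 1) → x ∈ Kc)
    (f g : Polynomial K) (d : ℕ) (hd : f.natDegree = d) (hd1 : 1 ≤ d)
    (hroot : ∀ m : ℕ, 1 ≤ m → m ≤ d → ∀ r : RatFunc Kc,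
      Polynomial.eval r
        (f.map ((algebraMap (↥Kc) (RatFunc Kc)).comp (algebraMap (↥K) (↥Kc)))
          - Polynomial.C (RatFunc.X ^ m) *
            g.map ((algebraMap (↥Kc) (RatFunc Kc)).comp (algebraMap (↥K) (↥Kc)))) ≠ 0)
    (hg : (g.map (algebraMap K ℂ)).natDegree = 0)
    (a : ℂ) (ha : f.map (algebraMap K ℂ) = C (f.map (algebraMap K ℂ)).leadingCoeff *
      (X - C a) ^ (f.map (algebraMap K ℂ)).natDegree)
    (β ζ : ℂ) (hβ : β ∈ Kc) (hG : (g.map (algebraMap K ℂ)).eval β ≠ 0)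
    (hζ : ∃ n : ℕ, 0 < n ∧ ζ ^ n = 1)
    (hF : (f.map (algebraMap K ℂ)).eval β = ζ * (g.map (algebraMap K ℂ)).eval β) : False := by
  have hinj : Function.Injective (algebraMap K ℂ) := (algebraMap K ℂ).injective
  have hd0 : (d : ℂ) ≠ 0 := by exact_mod_cast (by omega : d ≠ 0)
  rw [leadingCoeff_map, natDegree_map, hd] at ha
  set l := f.leadingCoeff with hl
  have hl0 : algebraMap K ℂ l ≠ 0 := by
    rw [Ne, map_eq_zero, hl, leadingCoeff_eq_zero]
    rintro rfl
    simp at hd; omega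
  have haK : a ∈ Kc := by
    have h1 := congrArg nextCoeff ha
    rw [nextCoeff_map hinj, nextCoeff_C_mul, (monic_X_sub_C a).nextCoeff_pow, nextCoeff_X_sub_C] at h1
    have h2 : a = -(algebraMap K ℂ f.nextCoeff) / (algebraMap K ℂ l * d) := by
      rw [h1]
      simp only [nsmul_eq_mul]
      field_simp
    rw [h2]
    exact div_mem (neg_mem (Kc.algebraMap_mem _)) (mul_mem (Kc.algebraMap_mem _) (natCast_mem Kc d))
  obtain ⟨η, hη⟩ := IsAlgClosed.exists_pow_nat_eq ζ (by omega : 0 < d)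
  obtain ⟨n, hn, hζn⟩ := hζ
  have hηK : η ∈ Kc := hU η ⟨d * n, Nat.mul_pos (by omega) hn, by rw [pow_mul, hη, hζn]⟩
  have hζ0 : ζ ≠ 0 := by
    rintro rfl
    rw [zero_pow hn.ne'] at hζn
    exact zero_ne_one hζn
  have hη0 : η ≠ 0 := by
    rintro rfl
    rw [zero_pow (by omega)] at hη
    exact hζ0 hη.symm
  rw [natDegree_map] at hg
  obtain ⟨g0, rfl⟩ : ∃ g0, g = C g0 := ⟨_, eq_C_of_natDegree_eq_zero hg⟩
  rw [ha] at hF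
  simp only [map_C, eval_C, eval_mul, eval_pow, eval_sub, eval_X] at hF
  have hfK : f.map (algebraMap K Kc) = C (algebraMap K Kc l) * (X - C (⟨a, haK⟩ : Kc)) ^ d := by
    apply map_injective (algebraMap Kc ℂ) (algebraMap Kc ℂ).injective
    rw [Polynomial.map_map, ← IsScalarTower.algebraMap_eq, ha]
    simp only [Polynomial.map_mul, map_C, Polynomial.map_pow, Polynomial.map_sub, map_X]
    rfl
  set u : Kc := (⟨β, hβ⟩ - ⟨a, haK⟩) / ⟨η, hηK⟩ with hu
  have hkey : algebraMap K Kc l * u ^ d = algebraMap K Kc g0 := by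
    apply (algebraMap Kc ℂ).injective
    rw [map_mul, map_pow, ← IsScalarTower.algebraMap_apply, ← IsScalarTower.algebraMap_apply]
    have : algebraMap Kc ℂ u = (β - a) / η := by rw [hu, map_div₀, map_sub]; rfl
    rw [this, div_pow, hη, ← mul_div_assoc, hF]
    field_simp
  apply hroot d hd1 le_rfl (algebraMap Kc (RatFunc Kc) ⟨a, haK⟩ + RatFunc.X * algebraMap Kc (RatFunc Kc) u)
  rw [← Polynomial.map_map, hfK]
  simp only [Polynomial.map_mul, map_C, Polynomial.map_pow, Polynomial.map_sub, map_X, eval_sub,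
    eval_mul, eval_C, eval_pow, eval_X, RingHom.comp_apply]
  rw [← hkey, map_mul, map_pow]
  ring

theorem roots_of_unity_orbits_stmt2
    (K : IntermediateField ℚ ℂ) [FiniteDimensional ℚ K]
    (Kc : IntermediateField K ℂ)
    (hKc : Kc = IntermediateField.adjoin K {x : ℂ | ∃ n : ℕ, 0 < n ∧ x ^ n = 1})
    (f g : Polynomial K) (d e : ℕ)
    (hd : f.natDegree = d) (he : g.natDegree = e)
    (hcop : IsCoprime f g) (hde : e + 1 < d) (hmax : 2 ≤ max d e)
    (hroot : ∀ m : ℕ, 1 ≤ m → m ≤ d → ∀ r : RatFunc Kc,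
      Polynomial.eval r
        (f.map ((algebraMap (↥Kc) (RatFunc Kc)).comp (algebraMap (↥K) (↥Kc)))
          - Polynomial.C (RatFunc.X ^ m) *
            g.map ((algebraMap (↥Kc) (RatFunc Kc)).comp (algebraMap (↥K) (↥Kc)))) ≠ 0)
    (hspec : ¬ IsSpecialRatFunc
      (algebraMap (Polynomial ℂ) (RatFunc ℂ) (f.map (algebraMap (↥K) ℂ)) /
        algebraMap (Polynomial ℂ) (RatFunc ℂ) (g.map (algebraMap (↥K) ℂ)))) :
    {α : ℂ | α ∈ Kc ∧ ∃ k : ℕ, 1 ≤ k ∧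
      (∀ n : ℕ, n < k →
        Polynomial.eval ((fun x : ℂ => Polynomial.eval x (f.map (algebraMap (↥K) ℂ)) /
            Polynomial.eval x (g.map (algebraMap (↥K) ℂ)))^[n] α)
          (g.map (algebraMap (↥K) ℂ)) ≠ 0) ∧
      ∃ m : ℕ, 0 < m ∧
        ((fun x : ℂ => Polynomial.eval x (f.map (algebraMap (↥K) ℂ)) /
            Polynomial.eval x (g.map (algebraMap (↥K) ℂ)))^[k] α) ^ m = 1}.Finite := by
  have hU : ∀ x : ℂ, (∃ n : ℕ, 0 < n ∧ x ^ n = 1) → x ∈ Kc := by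
    intro x hx
    rw [hKc]
    exact IntermediateField.subset_adjoin _ _ hx
  by_cases hexc : (g.map (algebraMap K ℂ)).natDegree = 0 ∧
      ∃ a, f.map (algebraMap K ℂ) = C (f.map (algebraMap K ℂ)).leadingCoeff *
        (X - C a) ^ (f.map (algebraMap K ℂ)).natDegree
  · obtain ⟨hg, a, ha⟩ := hexc
    refine Set.finite_empty.subset ?_
    rintro α ⟨hα, k, hk, hG, hζ⟩
    obtain ⟨j, rfl⟩ : ∃ j, k = j + 1 := ⟨k - 1, by omega⟩
    have hit : ∀ n, (fun x : ℂ => Polynomial.eval x (f.map (algebraMap (↥K) ℂ)) /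
            Polynomial.eval x (g.map (algebraMap (↥K) ℂ)))^[n] α ∈ Kc := by
      have hev : ∀ (q : K[X]) (x : ℂ), x ∈ Kc → (q.map (algebraMap K ℂ)).eval x ∈ Kc := by
        intro q x hx
        rw [eval_eq_sum_range]
        refine sum_mem fun i _ => mul_mem ?_ (pow_mem hx _)
        rw [coeff_map]
        exact Kc.algebraMap_mem _
      intro n
      induction n with
      | zero => exact hα
      | succ n ih =>
        rw [Function.iterate_succ_apply']
        exact div_mem (hev _ _ ih) (hev _ _ ih)
    have hGj := hG j (by omega)
    rw [Function.iterate_succ_apply'] at hζ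
    exact exc_case K Kc hU f g d hd (by omega) hroot hg a ha _ _ (hit j) hGj hζ
      (by rw [div_mul_cancel₀ _ hGj])
  · obtain ⟨θ', hθ'⟩ := Field.exists_primitive_element ℚ K
    set θ : ℂ := (θ' : ℂ) with hθdef
    have hKalg : ∀ y : K, IsAlgebraic ℚ (y : ℂ) := fun y =>
      (Algebra.IsAlgebraic.isAlgebraic (R := ℚ) y).algebraMap (A := ℂ)
    have hθ : IsAlgebraic ℚ θ := hKalg θ'
    have hKS : ∀ N (y : K), (y : ℂ) ∈ SA θ N := by
      intro N y
      have hy : y ∈ IntermediateField.adjoin ℚ {θ'} := by rw [hθ']; trivial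
      induction hy using IntermediateField.adjoin_induction with
      | mem x hx => rw [Set.mem_singleton_iff.1 hx]; exact theta_mem θ N
      | algebraMap x =>
        have := (SA θ N).algebraMap_mem (algebraMap ℚ (Cy N) x)
        rw [← IsScalarTower.algebraMap_apply] at this
        exact this
      | add x y _ _ h1 h2 => exact add_mem h1 h2
      | inv x _ h => 
        have : ((x⁻¹ : K) : ℂ) = (x : ℂ)⁻¹ := by simp
        rw [this]
        exact inv_mem h
      | mul x y _ _ h1 h2 => exact mul_mem h1 h2
    have hKcS : ∀ x ∈ Kc, ∃ N, 0 < N ∧ x ∈ SA θ N := by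
      intro x hx
      rw [hKc] at hx
      induction hx using IntermediateField.adjoin_induction with
      | mem x hx =>
        obtain ⟨n, hn, hx⟩ := hx
        exact ⟨n, hn, Cy_mem_SA θ n (mem_Cy n hn x hx)⟩
      | algebraMap x => exact ⟨1, one_pos, hKS 1 x⟩
      | add x y _ _ h1 h2 =>
        obtain ⟨N, hN, h1⟩ := h1
        obtain ⟨M, hM, h2⟩ := h2
        have hNM := Nat.mul_pos hN hM
        exact ⟨N * M, hNM, add_mem (SA_mono θ hθ hNM (Dvd.intro _ rfl) h1)
          (SA_mono θ hθ hNM (Dvd.intro_left _ rfl) h2)⟩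
      | inv x _ h =>
        obtain ⟨N, hN, h⟩ := h
        exact ⟨N, hN, inv_mem h⟩
      | mul x y _ _ h1 h2 =>
        obtain ⟨N, hN, h1⟩ := h1
        obtain ⟨M, hM, h2⟩ := h2
        have hNM := Nat.mul_pos hN hM
        exact ⟨N * M, hNM, mul_mem (SA_mono θ hθ hNM (Dvd.intro _ rfl) h1)
          (SA_mono θ hθ hNM (Dvd.intro_left _ rfl) h2)⟩
    refine (final θ hθ (f.map (algebraMap K ℂ)) (g.map (algebraMap K ℂ))
      (fun N k => by rw [coeff_map]; exact hKS N _) (fun N k => by rw [coeff_map]; exact hKS N _)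
      (fun k => by rw [coeff_map]; exact hKalg _) (fun k => by rw [coeff_map]; exact hKalg _)
      (hcop.map (mapRingHom (algebraMap K ℂ))) (by rw [natDegree_map, natDegree_map]; omega)
      hspec hexc).subset ?_
    rintro α ⟨hα, h⟩
    exact ⟨hKcS α hα, h⟩
end

section
/- Let K be a number field, let f(X) = X^d + a_{d−1}X^{d−1} + ⋯ + a_0 and g(X) = X^e + b_{e−1}X^{e−1} + ⋯ + b_0 be monic polynomials in K[X], set h = f/g, and let |·|_v be a non-archimedean absolute value on the algebraic closure of ℚ. Assume d − e > 1. If α is an algebraic number with |α|_v > max{1, |a_0|_v, …, |a_{d−1}|_v, |b_0|_v, …, |b_{e−1}|_v}, then the orbit α_0 = α, α_n = h(α_{n−1}) is well defined for all n (i.e. g(α_{n−1}) ≠ 0 for every n ≥ 1), and the sequence |α_n|_v, n = 0, 1, 2, …, is strictly increasing. -/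
open Polynomial

theorem aux_val {F : Type*} [Field F] (v : AbsoluteValue F ℝ)
    (hv : ∀ x y : F, v (x + y) ≤ max (v x) (v y)) (d : ℕ) (c : Fin d → F) (x : F)
    (hx : 1 < v x) (hc : ∀ i, v (c i) < v x) :
    v ((X ^ d + ∑ i : Fin d, C (c i) * X ^ (i : ℕ) : Polynomial F).eval x) = v x ^ d := by
  have h0 : 0 < v x := by linarith
  have key : ∀ s : Finset (Fin d), v (∑ i ∈ s, c i * x ^ (i : ℕ)) < v x ^ d := by
    intro s
    induction s using Finset.induction_on with
    | empty => simpa using pow_pos h0 d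
    | insert i s hi ih =>
      rw [Finset.sum_insert hi]
      refine (hv _ _).trans_lt (max_lt ?_ ih)
      rw [map_mul, map_pow]
      calc v (c i) * v x ^ (i : ℕ) < v x * v x ^ (i : ℕ) :=
            mul_lt_mul_of_pos_right (hc i) (pow_pos h0 _)
        _ = v x ^ ((i : ℕ) + 1) := by ring
        _ ≤ v x ^ d := pow_le_pow_right₀ hx.le i.2
  have hs := key Finset.univ
  have he : (X ^ d + ∑ i : Fin d, C (c i) * X ^ (i : ℕ) : Polynomial F).eval x
      = x ^ d + ∑ i : Fin d, c i * x ^ (i : ℕ) := by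
    simp [Polynomial.eval_finset_sum]
  rw [he]
  generalize (∑ i : Fin d, c i * x ^ (i : ℕ)) = t at hs
  apply le_antisymm
  · refine (hv _ _).trans (max_le ?_ hs.le)
    rw [map_pow]
  · have h := hv (x ^ d + t) (-t)
    rw [add_neg_cancel_right, map_pow, v.map_neg] at h
    rcases le_max_iff.1 h with h | h
    · exact h
    · exact absurd h (not_le.2 hs)

/-- Let `K` be a number field (a finite extension of `ℚ` inside the algebraic
closure `ℚ̄`), let `f(X) = X^d + a_{d-1}X^{d-1} + ⋯ + a_0` and
`g(X) = X^e + b_{e-1}X^{e-1} + ⋯ + b_0` be monic polynomials in `K[X]`, set `h = f/g`, and let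
`v` be a non-archimedean absolute value on `ℚ̄`.  Assume `d - e > 1`.  If `α ∈ ℚ̄` satisfies
`|α|_v > max {1, |a_i|_v, |b_j|_v}`, then the orbit `α_0 = α`, `α_n = h(α_{n-1})` is well
defined for all `n` (i.e. `g(α_{n-1}) ≠ 0` for every `n ≥ 1`), and the sequence `|α_n|_v`,
`n = 0, 1, 2, …`, is strictly increasing. -/
theorem roots_of_unity_orbits_stmt5
    (K : IntermediateField ℚ (AlgebraicClosure ℚ)) [FiniteDimensional ℚ K]
    (d e : ℕ) (hde : e + 1 < d) (a : Fin d → K) (b : Fin e → K)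
    (f g : Polynomial (AlgebraicClosure ℚ))
    (hf : f = X ^ d + ∑ i : Fin d, C ((a i : AlgebraicClosure ℚ)) * X ^ (i : ℕ))
    (hg : g = X ^ e + ∑ j : Fin e, C ((b j : AlgebraicClosure ℚ)) * X ^ (j : ℕ))
    (v : AbsoluteValue (AlgebraicClosure ℚ) ℝ)
    (hv : ∀ x y : AlgebraicClosure ℚ, v (x + y) ≤ max (v x) (v y))
    (α : AlgebraicClosure ℚ)
    (hα1 : 1 < v α)
    (hαa : ∀ i : Fin d, v ((a i : AlgebraicClosure ℚ)) < v α)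
    (hαb : ∀ j : Fin e, v ((b j : AlgebraicClosure ℚ)) < v α)
    (orb : ℕ → AlgebraicClosure ℚ)
    (horb : orb = fun n => (fun x => f.eval x / g.eval x)^[n] α) :
    (∀ n : ℕ, g.eval (orb n) ≠ 0) ∧ StrictMono (fun n : ℕ => v (orb n)) := by
  have hF : ∀ x, v α ≤ v x → v (f.eval x) = v x ^ d := fun x hx => by
    rw [hf]
    exact aux_val v hv d (fun i => (a i : AlgebraicClosure ℚ)) x (hα1.trans_le hx)
      (fun i => (hαa i).trans_le hx)
  have hG : ∀ x, v α ≤ v x → v (g.eval x) = v x ^ e := fun x hx => by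
    rw [hg]
    exact aux_val v hv e (fun i => (b i : AlgebraicClosure ℚ)) x (hα1.trans_le hx)
      (fun i => (hαb i).trans_le hx)
  have step : ∀ x, v α ≤ v x → v x < v (f.eval x / g.eval x) := fun x hx => by
    have h1 : 1 < v x := hα1.trans_le hx
    have h0 : 0 < v x := by linarith
    rw [map_div₀, hF x hx, hG x hx, lt_div_iff₀ (pow_pos h0 e), ← pow_succ']
    exact pow_lt_pow_right₀ h1 hde
  have hs : ∀ n, orb (n + 1) = f.eval (orb n) / g.eval (orb n) := fun n => by
    rw [horb]
    simp only [Function.iterate_succ_apply']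
  have hge : ∀ n, v α ≤ v (orb n) := by
    intro n
    induction n with
    | zero => simp [horb]
    | succ n ih =>
      rw [hs]
      exact ih.trans (step _ ih).le
  refine ⟨fun n h => ?_, strictMono_nat_of_lt_succ fun n => ?_⟩
  · have h2 := hG _ (hge n)
    rw [h, map_zero] at h2
    have h0 : 0 < v (orb n) := by linarith [hge n]
    exact (pow_pos h0 e).ne h2
  · simp only [hs n]
    exact step _ (hge n)
end

section
/- Let K be a number field, let f(X) = X^d + a_{d−1}X^{d−1} + ⋯ + a_0 and g(X) = X^d + b_{d−1}X^{d−1} + ⋯ + b_0 be monic polynomials in K[X] of the same degree d ≥ 1, set h = f/g, and let |·|_v be a non-archimedean absolute value on the algebraic closure of ℚ. Assume that |a_i|_v < 1 and |b_j|_v < 1 for all 0 ≤ i, j ≤ d − 1. If α is an algebraic number with |α|_v > 1, then the orbit α_0 = α, α_n = h(α_{n−1}) is well defined for all n (i.e. g(α_{n−1}) ≠ 0 for every n ≥ 1) and |α_n|_v = 1 for all n ≥ 1. -/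
open Polynomial

lemma aux_eval {L : Type*} [Field L] (v : AbsoluteValue L ℝ)
    (hv : ∀ x y : L, v (x + y) ≤ max (v x) (v y)) (d : ℕ) (c : Fin d → L)
    (hc : ∀ i, v (c i) < 1) (x : L) (hx : 1 ≤ v x) :
    v ((X ^ d + ∑ i : Fin d, C (c i) * X ^ (i : ℕ) : Polynomial L).eval x) = v x ^ d := by
  have hpos : 0 < v x ^ d := pow_pos (by linarith) d
  have hs : ∀ s : Finset (Fin d), v (∑ i ∈ s, c i * x ^ (i : ℕ)) < v x ^ d := by
    intro s
    induction s using Finset.induction_on with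
    | empty => simpa using hpos
    | insert i s hi ih =>
      rw [Finset.sum_insert hi]
      refine lt_of_le_of_lt (hv _ _) (max_lt ?_ ih)
      rw [map_mul, map_pow]
      have h1 : v x ^ (i : ℕ) ≤ v x ^ d := pow_le_pow_right₀ hx i.2.le
      have h2 : 0 < v x ^ (i : ℕ) := pow_pos (by linarith) _
      nlinarith [hc i]
  have h := hs Finset.univ
  simp only [eval_add, eval_pow, eval_X, eval_finset_sum, eval_mul, eval_C]
  set S := ∑ i : Fin d, c i * x ^ (i : ℕ)
  apply le_antisymm
  · refine (hv _ _).trans (max_le ?_ h.le)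
    rw [map_pow]
  · have h3 := hv (x ^ d + S) (-S)
    rw [add_neg_cancel_right, map_pow, v.map_neg] at h3
    rcases le_max_iff.1 h3 with h4 | h4
    · exact h4
    · linarith

/-- Let `K` be a number field (a finite extension of `ℚ` inside the algebraic
closure `ℚ̄`), let `f(X) = X^d + a_{d-1}X^{d-1} + ⋯ + a_0` and
`g(X) = X^d + b_{d-1}X^{d-1} + ⋯ + b_0` be monic polynomials in `K[X]` of the same degree
`d ≥ 1`, set `h = f/g`, and let `v` be a non-archimedean absolute value on `ℚ̄`.  Assume
`|a_i|_v < 1` and `|b_j|_v < 1` for all `0 ≤ i, j ≤ d - 1`.  If `α ∈ ℚ̄` satisfies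
`|α|_v > 1`, then the orbit `α_0 = α`, `α_n = h(α_{n-1})` is well defined for all `n`
(i.e. `g(α_{n-1}) ≠ 0` for every `n ≥ 1`) and `|α_n|_v = 1` for all `n ≥ 1`. -/
theorem roots_of_unity_orbits_stmt7
    (K : IntermediateField ℚ (AlgebraicClosure ℚ)) [FiniteDimensional ℚ K]
    (d : ℕ) (hd : 1 ≤ d) (a b : Fin d → K)
    (f g : Polynomial (AlgebraicClosure ℚ))
    (hf : f = X ^ d + ∑ i : Fin d, C ((a i : AlgebraicClosure ℚ)) * X ^ (i : ℕ))
    (hg : g = X ^ d + ∑ j : Fin d, C ((b j : AlgebraicClosure ℚ)) * X ^ (j : ℕ))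
    (v : AbsoluteValue (AlgebraicClosure ℚ) ℝ)
    (hv : ∀ x y : AlgebraicClosure ℚ, v (x + y) ≤ max (v x) (v y))
    (ha : ∀ i : Fin d, v ((a i : AlgebraicClosure ℚ)) < 1)
    (hb : ∀ j : Fin d, v ((b j : AlgebraicClosure ℚ)) < 1)
    (α : AlgebraicClosure ℚ) (hα1 : 1 < v α)
    (orb : ℕ → AlgebraicClosure ℚ)
    (horb : orb = fun n => (fun x => f.eval x / g.eval x)^[n] α) :
    (∀ n : ℕ, g.eval (orb n) ≠ 0) ∧ ∀ n : ℕ, 1 ≤ n → v (orb n) = 1 := by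
  have hF : ∀ x, 1 ≤ v x → v (f.eval x) = v x ^ d := fun x hx => by
    rw [hf]; exact aux_eval v hv d (fun i => (a i : AlgebraicClosure ℚ)) ha x hx
  have hG : ∀ x, 1 ≤ v x → v (g.eval x) = v x ^ d := fun x hx => by
    rw [hg]; exact aux_eval v hv d (fun i => (b i : AlgebraicClosure ℚ)) hb x hx
  have hstep : ∀ x, 1 ≤ v x → v (f.eval x / g.eval x) = 1 := fun x hx => by
    rw [map_div₀, hF x hx, hG x hx]
    exact div_self (pow_pos (by linarith) d).ne'
  have hsucc : ∀ n, orb (n + 1) = f.eval (orb n) / g.eval (orb n) := fun n => by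
    simp only [horb, Function.iterate_succ_apply']
  have hge : ∀ n, 1 ≤ v (orb n) := by
    intro n
    induction n with
    | zero => simpa [horb] using hα1.le
    | succ n ih => rw [hsucc, hstep _ ih]
  refine ⟨fun n h0 => ?_, fun n hn => ?_⟩
  · have h1 := hG _ (hge n)
    rw [h0, map_zero] at h1
    have : 0 < v (orb n) ^ d := pow_pos (by linarith [hge n]) d
    linarith
  · obtain ⟨m, rfl⟩ := Nat.exists_eq_add_of_le' hn
    rw [hsucc, hstep _ (hge m)]
end
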